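/- arXiv:1307.5138 — 3 statements merged into one kernel-verified Lean document; each statement's English description precedes it below -/
import Mathlib

section
/- Fair division by translated face fans: Let q = p^k be a power of a prime p ≥ 2, let n ≥ 1, and set d = n(q−1). Let Δ = conv{a_0,…,a_d} ⊂ ℝ^d be a non-degenerate simplex with barycenter at the origin, and let μ_1,…,μ_n be continuous mass distributions on ℝ^d with compact support. Then there exist a point x ∈ ℝ^d and an allocation function θ : {0,…,d} → {1,…,q} such that for every i ∈ {1,…,n} and every j ∈ {1,…,q}, Σ_{ν : θ(ν)=j} μ_i(x + cone(F_ν)) = (1/q)·μ_i(ℝ^d). -/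
open MeasureTheory

noncomputable section

/-- The cone over the facet `F i = conv {a j | j ≠ i}` of the simplex with vertex
set `a`, with apex at the origin: `cone(F i) = {∑_{j ≠ i} t j • a j : t j ≥ 0}`. -/
def coneFace {d : ℕ} (a : Fin (d + 1) → EuclideanSpace ℝ (Fin d)) (i : Fin (d + 1)) :
    Set (EuclideanSpace ℝ (Fin d)) :=
  {z | ∃ t : Fin (d + 1) → ℝ, (∀ k, 0 ≤ t k) ∧ t i = 0 ∧ z = ∑ k, t k • a k}

section ListChains

variable {K X Y : Type*} [CommRing K]

/-- Prepending a vertex to every simplex of a chain of ordered simplices. -/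
def chainCone (K : Type*) [CommRing K] {X : Type*} (a : X) : (List X →₀ K) →ₗ[K] (List X →₀ K) :=
  Finsupp.lmapDomain K K (List.cons a)

/-- The augmented simplicial boundary of an ordered simplex, given as a list of vertices. -/
def listBoundary (K : Type*) [CommRing K] {X : Type*} : List X → (List X →₀ K)
  | [] => 0
  | a :: l => Finsupp.single l 1 - chainCone K a (listBoundary K l)

/-- The augmented simplicial boundary on chains of ordered simplices. -/
def chainBoundary (K : Type*) [CommRing K] (X : Type*) : (List X →₀ K) →ₗ[K] (List X →₀ K) :=
  Finsupp.linearCombination K (listBoundary K)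

/-- The chain map induced by a map of vertices. -/
def chainMap (K : Type*) [CommRing K] {X Y : Type*} (f : X → Y) :
    (List X →₀ K) →ₗ[K] (List Y →₀ K) :=
  Finsupp.lmapDomain K K (List.map f)

@[simp] lemma chainCone_single (a : X) (l : List X) (c : K) :
    chainCone K a (Finsupp.single l c) = Finsupp.single (a :: l) c := by
  simp [chainCone, Finsupp.mapDomain_single]

@[simp] lemma chainMap_single (f : X → Y) (l : List X) (c : K) :
    chainMap K f (Finsupp.single l c) = Finsupp.single (l.map f) c := by
  simp [chainMap, Finsupp.mapDomain_single]

@[simp] lemma chainBoundary_single (l : List X) (c : K) :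
    chainBoundary K X (Finsupp.single l c) = c • listBoundary K l := by
  simp [chainBoundary]

lemma chainBoundary_chainCone (a : X) (c : List X →₀ K) :
    chainBoundary K X (chainCone K a c) = c - chainCone K a (chainBoundary K X c) := by
  induction c using Finsupp.induction_linear with
  | zero => simp
  | add f g hf hg => simp only [map_add, hf, hg]; abel
  | single l r =>
    simp [listBoundary, smul_sub]

lemma chainBoundary_listBoundary (l : List X) :
    chainBoundary K X (listBoundary K l) = 0 := by
  induction l with
  | nil => simp [listBoundary]
  | cons a l ih => simp [listBoundary, chainBoundary_chainCone, ih]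

lemma chainMap_chainCone (f : X → Y) (a : X) (c : List X →₀ K) :
    chainMap K f (chainCone K a c) = chainCone K (f a) (chainMap K f c) := by
  induction c using Finsupp.induction_linear with
  | zero => simp
  | add f g hf hg => simp only [map_add, hf, hg]
  | single l r => simp

lemma listBoundary_map (f : X → Y) (l : List X) :
    listBoundary K (l.map f) = chainMap K f (listBoundary K l) := by
  induction l with
  | nil => simp [listBoundary]
  | cons a l ih => simp [listBoundary, chainMap_chainCone, ih]

lemma chainBoundary_chainMap (f : X → Y) (c : List X →₀ K) :
    chainBoundary K Y (chainMap K f c) = chainMap K f (chainBoundary K X c) := by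
  induction c using Finsupp.induction_linear with
  | zero => simp
  | add f g hf hg => simp only [map_add, hf, hg]
  | single l r => simp [listBoundary_map]

lemma map_mem_supported {α β : Type*} (F : (α →₀ K) →ₗ[K] (β →₀ K)) {s : Set α} {t : Set β}
    (h : ∀ a ∈ s, F (Finsupp.single a 1) ∈ Finsupp.supported K K t) {c : α →₀ K}
    (hc : c ∈ Finsupp.supported K K s) : F c ∈ Finsupp.supported K K t := by
  rw [← c.sum_single, Finsupp.sum, map_sum]
  refine Submodule.sum_mem _ fun a ha => ?_
  rw [← mul_one (c a), ← smul_eq_mul, ← Finsupp.smul_single, map_smul]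
  exact Submodule.smul_mem _ _ (h a ((Finsupp.mem_supported K c).1 hc ha))

lemma linearMap_congr_supported {α M : Type*} [AddCommGroup M] [Module K M]
    (F F' : (α →₀ K) →ₗ[K] M) {s : Set α}
    (h : ∀ a ∈ s, F (Finsupp.single a 1) = F' (Finsupp.single a 1)) {c : α →₀ K}
    (hc : c ∈ Finsupp.supported K K s) : F c = F' c := by
  rw [← c.sum_single, Finsupp.sum, map_sum, map_sum]
  refine Finset.sum_congr rfl fun a ha => ?_
  rw [← mul_one (c a), ← smul_eq_mul, ← Finsupp.smul_single, map_smul, map_smul,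
    h a ((Finsupp.mem_supported K c).1 hc ha)]

lemma listBoundary_mem_supported (l : List X) :
    listBoundary K l ∈ Finsupp.supported K K {l' | l'.Sublist l ∧ l'.length + 1 = l.length} := by
  induction l with
  | nil => simp [listBoundary]
  | cons a l ih =>
    refine Submodule.sub_mem _ (Finsupp.single_mem_supported K _ (by simp)) ?_
    refine map_mem_supported _ (fun l' hl' => ?_) ih
    rw [chainCone_single]
    refine Finsupp.single_mem_supported K _ ⟨hl'.1.cons_cons a, ?_⟩
    simpa using hl'.2

/-- Auxiliary recursion on the length for `subdivision`. -/
def subdivisionAux (K : Type*) [CommRing K] {X Y : Type*} (b : List X → Y) :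
    ℕ → List X → (List Y →₀ K)
  | 0, _ => Finsupp.single [] 1
  | n + 1, l => chainCone K (b l)
      (Finsupp.linearCombination K (subdivisionAux K b n) (listBoundary K l))

/-- The subdivision operator which cones off the subdivided boundary of a simplex `l`
from the vertex `b l`. -/
def subdivision (K : Type*) [CommRing K] {X Y : Type*} (b : List X → Y) :
    (List X →₀ K) →ₗ[K] (List Y →₀ K) :=
  Finsupp.linearCombination K fun l => subdivisionAux K b l.length l

@[simp] lemma subdivision_single_nil (b : List X → Y) :
    subdivision K b (Finsupp.single [] 1) = Finsupp.single [] 1 := by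
  simp [subdivision, subdivisionAux]

lemma subdivision_single (b : List X → Y) {l : List X} (hl : l ≠ []) :
    subdivision K b (Finsupp.single l 1) =
      chainCone K (b l) (subdivision K b (listBoundary K l)) := by
  obtain ⟨n, hn⟩ : ∃ n, l.length = n + 1 :=
    Nat.exists_eq_succ_of_ne_zero (by simpa using hl)
  have h1 : subdivision K b (Finsupp.single l 1) = chainCone K (b l)
      (Finsupp.linearCombination K (subdivisionAux K b n) (listBoundary K l)) := by
    simp [subdivision, hn, subdivisionAux]
  rw [h1]
  congr 1
  refine linearMap_congr_supported _ _ (fun l' hl' => ?_) (listBoundary_mem_supported l)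
  have h2 : l'.length = n := by have := hl'.2; omega
  simp [subdivision, h2]

lemma chainBoundary_subdivision (b : List X → Y) (c : List X →₀ K) :
    chainBoundary K Y (subdivision K b c) = subdivision K b (chainBoundary K X c) := by
  suffices h : ∀ n, ∀ l : List X, l.length = n →
      chainBoundary K Y (subdivision K b (Finsupp.single l 1)) =
        subdivision K b (listBoundary K l) by
    refine linearMap_congr_supported (chainBoundary K Y ∘ₗ subdivision K b)
      (subdivision K b ∘ₗ chainBoundary K X) (s := Set.univ) (fun l _ => ?_) (by simp)
    simp [h _ l rfl]
  intro n
  induction n with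
  | zero =>
    intro l hl
    obtain rfl := List.length_eq_zero_iff.1 hl
    simp [listBoundary]
  | succ n ih =>
    intro l hl
    rw [subdivision_single b (by rintro rfl; simp at hl), chainBoundary_chainCone]
    have : chainBoundary K Y (subdivision K b (listBoundary K l)) =
        subdivision K b (chainBoundary K X (listBoundary K l)) := by
      refine linearMap_congr_supported (chainBoundary K Y ∘ₗ subdivision K b)
        (subdivision K b ∘ₗ chainBoundary K X) (fun l' hl' => ?_) (listBoundary_mem_supported l)
      have h2 : l'.length = n := by have := hl'.2; omega
      simp [ih l' h2]
    rw [this, chainBoundary_listBoundary]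
    simp

lemma subdivision_chainMap (b : List X → Y) (f : X → X) (f' : Y → Y)
    (hb : ∀ l, b (l.map f) = f' (b l)) (c : List X →₀ K) :
    subdivision K b (chainMap K f c) = chainMap K f' (subdivision K b c) := by
  suffices h : ∀ n, ∀ l : List X, l.length = n →
      subdivision K b (Finsupp.single (l.map f) 1) =
        chainMap K f' (subdivision K b (Finsupp.single l 1)) by
    refine linearMap_congr_supported (subdivision K b ∘ₗ chainMap K f)
      (chainMap K f' ∘ₗ subdivision K b) (s := Set.univ) (fun l _ => ?_) (by simp)
    simp [h _ l rfl]
  intro n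
  induction n with
  | zero =>
    intro l hl
    obtain rfl := List.length_eq_zero_iff.1 hl
    simp
  | succ n ih =>
    intro l hl
    have hne : l ≠ [] := by rintro rfl; simp at hl
    rw [subdivision_single b hne, subdivision_single b (by simpa using hne), hb,
      listBoundary_map, chainMap_chainCone]
    congr 1
    refine linearMap_congr_supported (subdivision K b ∘ₗ chainMap K f)
      (chainMap K f' ∘ₗ subdivision K b) (fun l' hl' => ?_) (listBoundary_mem_supported l)
    have h2 : l'.length = n := by have := hl'.2; omega
    simp [ih l' h2]

lemma subdivision_mem_supported (b : List X → Y) (R : List X → List Y → Prop)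
    (h0 : R [] [])
    (h1 : ∀ l l₁ l', l ≠ [] → l₁.Sublist l → l₁.length + 1 = l.length → R l₁ l' →
      R l (b l :: l')) (l : List X) :
    subdivision K b (Finsupp.single l 1) ∈ Finsupp.supported K K {l' | R l l'} := by
  induction hn : l.length generalizing l with
  | zero =>
    obtain rfl := List.length_eq_zero_iff.1 hn
    rw [subdivision_single_nil]
    exact Finsupp.single_mem_supported K _ h0
  | succ n ih =>
    have hne : l ≠ [] := by rintro rfl; simp at hn
    rw [subdivision_single b hne]
    refine map_mem_supported (chainCone K (b l))
      (s := {l' | ∃ l₁ : List X, l₁.Sublist l ∧ l₁.length + 1 = l.length ∧ R l₁ l'})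
      ?_ (map_mem_supported _ ?_ (listBoundary_mem_supported l))
    · rintro l' ⟨l₁, h2, h3, h4⟩
      rw [chainCone_single]
      exact Finsupp.single_mem_supported K _ (h1 l l₁ l' hne h2 h3 h4)
    · intro l₁ hl₁
      refine Finsupp.supported_mono ?_ (ih l₁ (by have := hl₁.2; omega))
      exact fun l' hl' => ⟨l₁, hl₁.1, hl₁.2, hl'⟩

/-- Evaluation of a cochain on a chain. -/
abbrev chainEval (u : List X → K) : (List X →₀ K) →ₗ[K] K := Finsupp.linearCombination K u

lemma chainEval_chainCone (u : List X → K) (a : X) (c : List X →₀ K) :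
    chainEval u (chainCone K a c) = chainEval (fun l => u (a :: l)) c := by
  induction c using Finsupp.induction_linear with
  | zero => simp
  | add f g hf hg => simp only [map_add, hf, hg]
  | single l r => simp

/-- The coboundary of a normalized cochain is normalized. -/
lemma chainEval_listBoundary_of_repeat (u : List X → K)
    (hu : ∀ l₁ a l₂, u (l₁ ++ a :: a :: l₂) = 0) (l₁ : List X) (a : X) (l₂ : List X) :
    chainEval u (listBoundary K (l₁ ++ a :: a :: l₂)) = 0 := by
  induction l₁ generalizing u with
  | nil =>
    have h : (fun l => u (a :: a :: l)) = 0 := funext fun l => hu [] a l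
    simp [listBoundary, chainEval_chainCone, h]
  | cons c l₁ ih =>
    have h1 := ih (fun l => u (c :: l)) (fun l₁ a l₂ => by simpa using hu (c :: l₁) a l₂)
    simp only [List.cons_append, listBoundary, map_sub, chainEval_chainCone, h1]
    simp [hu]

end ListChains

section ShiftOperator

/-- The operator `∑ i, b i • (g (b i) - 1)` attached to a representation `φ` of the additive group
of a field `K` and a family `b` of elements of `K`. -/
def shiftSum {K A ι : Type*} [Field K] [Ring A] [Algebra K A] [Fintype ι] (b : ι → K)
    (φ : Multiplicative K →* A) : A :=
  ∑ i, b i • (φ (Multiplicative.ofAdd (b i)) - 1)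

variable {K A ι : Type*} [Field K] [Ring A] [Algebra K A] [Fintype ι]

lemma shiftSum_eq_lift (b : ι → K) (φ : Multiplicative K →* A) :
    shiftSum b φ = AddMonoidAlgebra.lift K A K φ
      (∑ i, b i • (AddMonoidAlgebra.single (b i) 1 - 1)) := by
  simp [shiftSum, AddMonoidAlgebra.lift_single]

lemma charP_addMonoidAlgebra (K : Type*) [Field K] (p : ℕ) [CharP K p] :
    CharP (AddMonoidAlgebra K K) p :=
  charP_of_injective_algebraMap (FaithfulSMul.algebraMap_injective K (AddMonoidAlgebra K K)) p

lemma single_pow_char (p : ℕ) [CharP K p] (g : K) :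
    (AddMonoidAlgebra.single g 1 : AddMonoidAlgebra K K) ^ p = 1 := by
  rw [AddMonoidAlgebra.single_pow]
  simp [AddMonoidAlgebra.one_def]

lemma shiftSum_pow_char (p : ℕ) [Fact p.Prime] [CharP K p] (b : ι → K)
    (φ : Multiplicative K →* A) : shiftSum b φ ^ p = 0 := by
  have := charP_addMonoidAlgebra K p
  have : ExpChar (AddMonoidAlgebra K K) p := ExpChar.prime Fact.out
  rw [shiftSum_eq_lift, ← map_pow, sum_pow_char]
  simp [smul_pow, sub_pow_char]

lemma weyl_apply {M : Type*} [AddCommGroup M] [Module K M] {S D : Module.End K M}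
    (h : S * D - D * S = 1) (v : M) : S (D v) = D (S v) + v :=
  sub_eq_iff_eq_add'.1 (LinearMap.congr_fun h v)

lemma weyl_pow_apply {M : Type*} [AddCommGroup M] [Module K M] {S D : Module.End K M}
    (h : S * D - D * S = 1) {u : M} (hu : S u = 0) (m : ℕ) :
    (S ^ m) ((D ^ m) u) = (m.factorial : K) • u := by
  have hc := weyl_apply h
  have h1 : ∀ j : ℕ, S ((D ^ (j + 1)) u) = ((j + 1 : ℕ) : K) • (D ^ j) u := by
    intro j
    induction j with
    | zero => simp [hc, hu]
    | succ j ih =>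
      rw [pow_succ', Module.End.mul_apply, hc, ih, map_smul, ← Module.End.mul_apply, ← pow_succ',
        Nat.cast_succ (j + 1), add_smul, one_smul]
  induction m with
  | zero => simp
  | succ m ih =>
    rw [pow_succ, Module.End.mul_apply, h1, map_smul, ih, smul_smul, Nat.factorial_succ]
    push_cast
    rfl

lemma weyl_mem_range {M : Type*} [AddCommGroup M] [Module K M] {S D : Module.End K M}
    (h : S * D - D * S = 1) (p : ℕ) [CharP K p] (m : ℕ) (hm : m < p) (u : M)
    (hu : (S ^ m) u = 0) : ∃ v, S v = u := by
  induction m generalizing u with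
  | zero => exact ⟨0, by simpa using hu.symm⟩
  | succ m ih =>
    have hc := weyl_apply h
    have h1 : ∀ (j : ℕ) v, (S ^ (j + 1)) (D v) =
        D ((S ^ (j + 1)) v) + ((j + 1 : ℕ) : K) • (S ^ j) v := by
      intro j
      induction j with
      | zero => intro v; simp [hc]
      | succ j ih2 =>
        intro v
        rw [pow_succ' S (j + 1), Module.End.mul_apply, ih2, map_add, hc, map_smul,
          ← Module.End.mul_apply S (S ^ j), ← pow_succ', Nat.cast_succ (j + 1), add_smul, one_smul,
          Module.End.mul_apply S]
        abel
    have hne : ((m + 1 : ℕ) : K) ≠ 0 := by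
      rw [Ne, CharP.cast_eq_zero_iff K p]
      exact fun hd => absurd (Nat.le_of_dvd (Nat.succ_pos m) hd) (by omega)
    obtain ⟨v, hv⟩ := ih (by omega) (u - (((m + 1 : ℕ) : K)⁻¹) • S (D u)) (by
      rw [map_sub, map_smul, ← Module.End.mul_apply (S ^ m) S, ← pow_succ, h1, hu, map_zero,
        zero_add, smul_smul, inv_mul_cancel₀ hne, one_smul, sub_self])
    refine ⟨v + (((m + 1 : ℕ) : K)⁻¹) • D u, ?_⟩
    rw [map_add, hv, map_smul]
    abel

/-- The representation of an additive group on functions on a set on which it acts. -/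
def funRep (K Z : Type*) [Field K] [AddAction K Z] :
    Multiplicative K →* Module.End K (Z → K) where
  toFun g := LinearMap.funLeft K K (fun z => g.toAdd +ᵥ z)
  map_one' := by ext u z; simp [LinearMap.funLeft]
  map_mul' g h := by
    ext u z
    change u ((g.toAdd + h.toAdd) +ᵥ z) = u (h.toAdd +ᵥ g.toAdd +ᵥ z)
    rw [add_comm, add_vadd]

lemma funRep_apply {Z : Type*} [AddAction K Z] (g : Multiplicative K) (u : Z → K) (z : Z) :
    funRep K Z g u z = u (g.toAdd +ᵥ z) := rfl

lemma exists_weyl_partner (p : ℕ) [Fact p.Prime] [CharP K p] (b : ι → K) {Z : Type*}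
    [AddAction K Z] (τ : Z → K) (lam : K → K) (hτ : ∀ (g : K) z, τ (g +ᵥ z) = τ z + lam g)
    (hlam : ∑ i, b i * lam (b i) ≠ 0) :
    ∃ D : Module.End K (Z → K),
      shiftSum b (funRep K Z) * D - D * shiftSum b (funRep K Z) = 1 := by
  have := charP_addMonoidAlgebra K p
  have : ExpChar (AddMonoidAlgebra K K) p := ExpChar.prime Fact.out
  have : ExpChar K p := ExpChar.prime Fact.out
  set a := ∑ i, b i * lam (b i) with ha
  set κ : AddMonoidAlgebra K K := ∑ i, (b i * lam (b i)) • AddMonoidAlgebra.single (b i) 1 with hκ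
  set L := AddMonoidAlgebra.lift K (Module.End K (Z → K)) K (funRep K Z) with hL
  have hκp : κ ^ p = algebraMap K _ (a ^ p) := by
    rw [hκ, sum_pow_char, ha, sum_pow_char, map_sum]
    refine Finset.sum_congr rfl fun i _ => ?_
    rw [smul_pow, single_pow_char, Algebra.algebraMap_eq_smul_one]
  set M : Module.End K (Z → K) := LinearMap.mulLeft K τ with hM
  have hcomm : shiftSum b (funRep K Z) * M - M * shiftSum b (funRep K Z) = L κ := by
    rw [hκ, map_sum]
    simp only [shiftSum, Finset.sum_mul, Finset.mul_sum, ← Finset.sum_sub_distrib]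
    refine Finset.sum_congr rfl fun i _ => ?_
    ext u z
    simp [hL, AddMonoidAlgebra.lift_single, hM, funRep_apply, hτ]
    ring
  obtain ⟨r, hr⟩ : ∃ r, p = r + 1 := ⟨p - 1, by have := (Fact.out : p.Prime).pos; omega⟩
  set y := (a ^ p)⁻¹ • κ ^ r with hy
  have hκy : κ * y = 1 := by
    rw [hy, mul_smul_comm, ← pow_succ', ← hr, hκp, Algebra.algebraMap_eq_smul_one, smul_smul,
      inv_mul_cancel₀ (pow_ne_zero _ hlam), one_smul]
  have h1 : shiftSum b (funRep K Z) * L y = L y * shiftSum b (funRep K Z) := by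
    rw [shiftSum_eq_lift, ← map_mul, ← map_mul, mul_comm]
  refine ⟨M * L y, ?_⟩
  rw [mul_assoc M, ← h1, ← mul_assoc, ← mul_assoc, ← sub_mul, hcomm, ← map_mul, hκy, map_one]

end ShiftOperator

section Exactness

variable {K ι : Type*} [Field K] [Fintype ι]

lemma shiftSum_pow_intertwine {M N : Type*} [AddCommGroup M] [Module K M] [AddCommGroup N]
    [Module K N] (b : ι → K) (φ : Multiplicative K →* Module.End K M)
    (ψ : Multiplicative K →* Module.End K N) (F : M →ₗ[K] N)
    (h : ∀ g u, F (φ g u) = ψ g (F u)) (m : ℕ) (u : M) :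
    F ((shiftSum b φ ^ m) u) = (shiftSum b ψ ^ m) (F u) := by
  induction m generalizing u with
  | zero => simp
  | succ m ih =>
    rw [pow_succ, pow_succ, Module.End.mul_apply, Module.End.mul_apply, ih]
    congr 1
    simp [shiftSum, h]

lemma exists_linear_coordinate {p : ℕ} [Fact p.Prime] [Algebra (ZMod p) K]
    (b : Module.Basis ι (ZMod p) K) {Z : Type*} [AddAction K Z] (z₀ : Z)
    (hfix : ∃ g : K, g +ᵥ z₀ ≠ z₀) :
    ∃ (lam : K → K) (τ : AddAction.orbit K z₀ → K), (∀ (g : K) z, τ (g +ᵥ z) = τ z + lam g) ∧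
      ∑ i, b i * lam (b i) ≠ 0 := by
  set U := AddSubgroup.toZModSubmodule p (AddAction.stabilizer K z₀) with hU
  have hmem : ∀ g, g ∈ U ↔ g +ᵥ z₀ = z₀ := fun g => AddAction.mem_stabilizer_iff
  have hlt : U < ⊤ := by
    rw [lt_top_iff_ne_top]
    intro h
    obtain ⟨g, hg⟩ := hfix
    exact hg ((hmem g).1 (h ▸ Submodule.mem_top))
  obtain ⟨f, hf0, hf⟩ := Submodule.exists_le_ker_of_lt_top U hlt
  choose γ hγ using fun w : AddAction.orbit K z₀ => w.2
  have hf' : ∀ g h : K, g +ᵥ z₀ = h +ᵥ z₀ → f g = f h := by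
    intro g h hgh
    have : g - h ∈ U := by
      rw [hmem, sub_eq_neg_add, add_vadd, hgh, neg_vadd_vadd]
    exact sub_eq_zero.1 (by rw [← map_sub]; exact hf this)
  refine ⟨fun g => algebraMap (ZMod p) K (f g), fun w => algebraMap (ZMod p) K (f (γ w)), ?_, ?_⟩
  · intro g z
    rw [← map_add, ← map_add]
    refine congrArg (algebraMap (ZMod p) K) (hf' _ _ ?_)
    have h1 := hγ (g +ᵥ z)
    have h2 := hγ z
    simp only at h1 h2
    rw [h1, add_comm, add_vadd, h2]
    rfl
  · intro h
    have h1 : ∑ i, f (b i) • b i = 0 := by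
      rw [← h]
      exact Finset.sum_congr rfl fun i _ => by rw [Algebra.smul_def, mul_comm]
    have h2 := Fintype.linearIndependent_iff.1 b.linearIndependent _ h1
    exact hf0 (b.ext fun i => by simpa using h2 i)

lemma exists_of_forall_orbit (b : ι → K) {Z : Type*} [AddAction K Z] (m : ℕ) (u : Z → K)
    (h : ∀ z₀ : Z, ∃ v : AddAction.orbit K z₀ → K,
      (shiftSum b (funRep K (AddAction.orbit K z₀)) ^ m) v = fun z : AddAction.orbit K z₀ => u z) :
    ∃ v, (shiftSum b (funRep K Z) ^ m) v = u := by
  choose V hV using h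
  let r : Z → Z := fun z => (Quotient.mk (AddAction.orbitRel K Z) z).out
  have hr : ∀ z, z ∈ AddAction.orbit K (r z) := fun z =>
    (AddAction.orbitRel K Z).symm (Quotient.mk_out (s := AddAction.orbitRel K Z) z)
  have hrr : ∀ z, ∀ w ∈ AddAction.orbit K (r z), r w = r z := fun z w hw => by
    have h1 : (Quotient.mk (AddAction.orbitRel K Z) w) = Quotient.mk (AddAction.orbitRel K Z) z :=
      Quotient.sound (s := AddAction.orbitRel K Z) ((AddAction.orbitRel K Z).trans hw
        ((AddAction.orbitRel K Z).symm (hr z)))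
    simp only [r, h1]
  let v : Z → K := fun z => V (r z) ⟨z, hr z⟩
  refine ⟨v, funext fun z => ?_⟩
  have h1 := shiftSum_pow_intertwine b (funRep K Z) (funRep K (AddAction.orbit K (r z)))
    (LinearMap.funLeft K K (fun w : AddAction.orbit K (r z) => (w : Z))) (fun g u => rfl) m v
  have h2 : LinearMap.funLeft K K (fun w : AddAction.orbit K (r z) => (w : Z)) v = V (r z) := by
    funext w
    have : ∀ z₁ (hz : z₁ = r z) (hw : (w : Z) ∈ AddAction.orbit K z₁),
        V z₁ ⟨w, hw⟩ = V (r z) w := by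
      rintro _ rfl hw; rfl
    exact this _ (hrr z w w.2) _
  rw [h2, hV] at h1
  exact congrFun h1 ⟨z, hr z⟩

/-- Exactness of the pair `s, s ^ (p - 1)` on functions on a set on which the additive group of `K`
acts without fixed points. -/
lemma shiftSum_exact {p : ℕ} [Fact p.Prime] [Algebra (ZMod p) K]
    (b : Module.Basis ι (ZMod p) K) {Z : Type*} [AddAction K Z]
    (hfix : ∀ z : Z, ∃ g : K, g +ᵥ z ≠ z) (u : Z → K) :
    (shiftSum b (funRep K Z) u = 0 → ∃ v, (shiftSum b (funRep K Z) ^ (p - 1)) v = u) ∧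
      ((shiftSum b (funRep K Z) ^ (p - 1)) u = 0 → ∃ v, shiftSum b (funRep K Z) v = u) := by
  have hp : p.Prime := Fact.out
  have : CharP K p := charP_of_injective_algebraMap (algebraMap (ZMod p) K).injective p
  have key : ∀ z₀ : Z, ∃ D : Module.End K (AddAction.orbit K z₀ → K),
      shiftSum b (funRep K _) * D - D * shiftSum b (funRep K _) = 1 := fun z₀ => by
    obtain ⟨lam, τ, hτ, hlam⟩ := exists_linear_coordinate b z₀ (hfix z₀)
    exact exists_weyl_partner p b τ lam hτ hlam
  have hres : ∀ (m : ℕ), (shiftSum b (funRep K Z) ^ m) u = 0 → ∀ z₀ : Z,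
      (shiftSum b (funRep K (AddAction.orbit K z₀)) ^ m) (fun z : AddAction.orbit K z₀ => u z) = 0 := fun m hm z₀ => by
    have h1 := shiftSum_pow_intertwine b (funRep K Z) (funRep K (AddAction.orbit K z₀))
      (LinearMap.funLeft K K (fun w : AddAction.orbit K z₀ => (w : Z))) (fun g u => rfl) m u
    rw [hm, map_zero] at h1
    exact h1.symm
  constructor
  · intro hu
    refine exists_of_forall_orbit b (p - 1) u fun z₀ => ?_
    obtain ⟨D, hD⟩ := key z₀
    have h1 := hres 1 (by simpa using hu) z₀
    rw [pow_one] at h1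
    have h2 := weyl_pow_apply hD h1 (p - 1)
    have h3 : ((p - 1).factorial : K) ≠ 0 := by
      rw [Ne, CharP.cast_eq_zero_iff K p, hp.dvd_factorial]
      have := hp.pos
      omega
    refine ⟨((p - 1).factorial : K)⁻¹ • (D ^ (p - 1)) (fun z : AddAction.orbit K z₀ => u z), ?_⟩
    rw [map_smul, h2, smul_smul, inv_mul_cancel₀ h3, one_smul]
  · intro hu
    have h0 := exists_of_forall_orbit b (Z := Z) 1 u fun z₀ => by
      obtain ⟨D, hD⟩ := key z₀
      simpa using weyl_mem_range hD p (p - 1) (by have := hp.pos; omega) _ (hres _ hu z₀)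
    simpa using h0

end Exactness

section Obstruction

/-- The diagonal action on lists. -/
instance listAddAction {G X : Type*} [AddMonoid G] [AddAction G X] : AddAction G (List X) where
  vadd g l := l.map (g +ᵥ ·)
  zero_vadd l := by
    change l.map (fun x => (0 : G) +ᵥ x) = l
    simp
  add_vadd g h l := by
    change l.map (fun x => (g + h) +ᵥ x) = (l.map (h +ᵥ ·)).map (g +ᵥ ·)
    simp [add_vadd]

variable {K ι X Y : Type*} [Field K]

/-- The augmented simplicial coboundary. -/
def chainCoboundary (K X : Type*) [Field K] : (List X → K) →ₗ[K] (List X → K) where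
  toFun u l := chainEval u (listBoundary K l)
  map_add' u v := by
    funext l
    simp [chainEval, Finsupp.linearCombination_apply, Finsupp.sum_add, mul_add]
  map_smul' a u := by
    funext l
    simp [chainEval, Finsupp.linearCombination_apply, Finsupp.mul_sum, mul_left_comm]

lemma chainCoboundary_apply (u : List X → K) (l : List X) :
    chainCoboundary K X u l = chainEval u (listBoundary K l) := rfl

lemma chainEval_chainBoundary (u : List X → K) (c : List X →₀ K) :
    chainEval u (chainBoundary K X c) = chainEval (chainCoboundary K X u) c := by
  refine linearMap_congr_supported (chainEval u ∘ₗ chainBoundary K X) _ (s := Set.univ)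
    (fun l _ => ?_) (by simp)
  simp [chainCoboundary_apply]

variable [Fintype ι] [AddAction K X] [AddAction K Y]

lemma list_vadd_eq_map (g : K) (l : List X) : g +ᵥ l = l.map (g +ᵥ ·) := rfl

/-- The representation of an additive group on chains of ordered simplices whose vertices it
permutes. -/
def chainRep (K X : Type*) [Field K] [AddAction K X] :
    Multiplicative K →* Module.End K (List X →₀ K) where
  toFun g := chainMap K (g.toAdd +ᵥ ·)
  map_one' := by
    refine Finsupp.lhom_ext fun l c => ?_
    simp
  map_mul' g h := by
    refine Finsupp.lhom_ext fun l c => ?_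
    simp only [chainMap_single, Module.End.mul_apply, toAdd_mul, List.map_map]
    congr 2
    funext x
    simp [add_vadd]

lemma chainRep_apply (g : Multiplicative K) (c : List X →₀ K) :
    chainRep K X g c = chainMap K (g.toAdd +ᵥ ·) c := rfl

lemma chainEval_chainRep (g : Multiplicative K) (u : List X → K) (c : List X →₀ K) :
    chainEval u (chainRep K X g c) = chainEval (funRep K (List X) g u) c := by
  refine linearMap_congr_supported (chainEval u ∘ₗ chainRep K X g) _ (s := Set.univ)
    (fun l _ => ?_) (by simp)
  rw [LinearMap.comp_apply, chainRep_apply, chainMap_single]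
  simp only [chainEval, Finsupp.linearCombination_single]
  rfl

lemma chainCoboundary_funRep (g : Multiplicative K) (u : List X → K) :
    chainCoboundary K X (funRep K (List X) g u) = funRep K (List X) g (chainCoboundary K X u) := by
  funext l
  rw [chainCoboundary_apply, funRep_apply, chainCoboundary_apply, ← chainEval_chainRep,
    list_vadd_eq_map, listBoundary_map]
  rfl

lemma chainEval_shiftSum_pow (b : ι → K) (m : ℕ) (u : List X → K) (c : List X →₀ K) :
    chainEval u ((shiftSum (A := Module.End K (List X →₀ K)) b (chainRep K X) ^ m) c) =
      chainEval ((shiftSum b (funRep K (List X)) ^ m) u) c := by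
  have hadd : ∀ (s : Finset ι) (v : ι → List X → K) (c : List X →₀ K),
      chainEval (∑ i ∈ s, v i) c = ∑ i ∈ s, chainEval (v i) c := fun s v c => by
    simp only [chainEval, Finsupp.linearCombination_apply, Finset.sum_apply, Finset.smul_sum]
    exact Finsupp.sum_finsetSum_comm _ _
  induction m generalizing u with
  | zero => simp
  | succ m ih =>
    rw [pow_succ', pow_succ, Module.End.mul_apply, Module.End.mul_apply, ← ih]
    generalize (shiftSum (A := Module.End K (List X →₀ K)) b (chainRep K X) ^ m) c = c'
    simp only [shiftSum, LinearMap.sum_apply, LinearMap.smul_apply, LinearMap.sub_apply,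
      Module.End.one_apply, map_sum, map_smul, map_sub, chainEval_chainRep, hadd]
    refine Finset.sum_congr rfl fun i _ => ?_
    simp only [chainEval, Finsupp.linearCombination_apply, Finsupp.smul_sum, Pi.smul_apply,
      Pi.sub_apply, smul_sub, ← Finsupp.sum_sub]
    refine Finsupp.sum_congr fun l _ => ?_
    simp only [smul_eq_mul]
    ring

lemma exists_repeat_of_not_pairwise [PartialOrder Y] {l : List Y} (hl : l.Pairwise (· ≥ ·))
    (h : ¬ l.Pairwise (· > ·)) : ∃ l₁ a l₂, l = l₁ ++ a :: a :: l₂ := by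
  induction l with
  | nil => simp at h
  | cons a l ih =>
    rw [List.pairwise_cons] at hl
    by_cases h2 : l.Pairwise (· > ·)
    · rw [List.pairwise_cons, not_and'] at h
      have h3 := h h2
      push Not at h3
      obtain ⟨y, hy, hay⟩ := h3
      have hya : y = a := by
        by_contra hne
        exact hay (lt_of_le_of_ne (hl.1 y hy) hne)
      subst hya
      cases l with
      | nil => simp at hy
      | cons c l =>
        have h4 : c = y := by
          refine le_antisymm (hl.1 c (by simp)) ?_
          rcases List.mem_cons.1 hy with h5 | h5
          · exact h5.le
          · exact (List.pairwise_cons.1 hl.2).1 y h5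
        exact ⟨[], y, l, by simp [h4]⟩
    · obtain ⟨l₁, c, l₂, rfl⟩ := ih hl.2 h2
      exact ⟨a :: l₁, c, l₂, rfl⟩

lemma not_pairwise_of_repeat [PartialOrder Y] (l₁ : List Y) (a : Y) (l₂ : List Y) :
    ¬ (l₁ ++ a :: a :: l₂).Pairwise (· > ·) := by
  intro h
  have h1 := (List.pairwise_append.1 h).2.1
  exact lt_irrefl a ((List.pairwise_cons.1 h1).1 a (by simp))

lemma shiftSum_pow_repeat (b : ι → K) (m : ℕ) (u : List Y → K)
    (hu : ∀ l₁ a l₂, u (l₁ ++ a :: a :: l₂) = 0) (l₁ : List Y) (a : Y) (l₂ : List Y) :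
    (shiftSum b (funRep K (List Y)) ^ m) u (l₁ ++ a :: a :: l₂) = 0 := by
  induction m generalizing l₁ a l₂ with
  | zero => simpa using hu l₁ a l₂
  | succ m ih =>
    rw [pow_succ', Module.End.mul_apply]
    generalize (shiftSum b (funRep K (List Y)) ^ m) u = u' at ih ⊢
    simp [shiftSum, funRep_apply, list_vadd_eq_map, ih]

lemma shiftSum_pow_nil (b : ι → K) {m : ℕ} (hm : m ≠ 0) (u : List Y → K) :
    (shiftSum b (funRep K (List Y)) ^ m) u [] = 0 := by
  obtain ⟨m, rfl⟩ := Nat.exists_eq_succ_of_ne_zero hm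
  rw [pow_succ', Module.End.mul_apply]
  simp [shiftSum, funRep_apply, list_vadd_eq_map]

/-- The exponents `1, p - 1, 1, p - 1, …`. -/
def alternatingExponent (p m : ℕ) : ℕ := if Even m then 1 else p - 1

lemma alternatingExponent_add_two (p m : ℕ) :
    alternatingExponent p (m + 2) = alternatingExponent p m := by
  simp [alternatingExponent, Nat.even_add]

lemma alternatingExponent_add_succ {p : ℕ} (hp : p.Prime) (m : ℕ) :
    alternatingExponent p m + alternatingExponent p (m + 1) = p := by
  have := hp.two_le
  by_cases h : Even m
  · have : ¬ Even (m + 1) := by simpa [Nat.even_add_one] using h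
    simp only [alternatingExponent, h, this, if_true, if_false]
    omega
  · have : Even (m + 1) := by simpa [Nat.even_add_one] using h
    simp only [alternatingExponent, h, this, if_true, if_false]
    omega

lemma alternatingExponent_ne_zero {p : ℕ} (hp : p.Prime) (m : ℕ) :
    alternatingExponent p m ≠ 0 := by
  have := hp.two_le
  unfold alternatingExponent
  split <;> omega

lemma shiftSum_exact_alternating {p : ℕ} [Fact p.Prime] [Algebra (ZMod p) K]
    (b : Module.Basis ι (ZMod p) K) {Z : Type*} [AddAction K Z]
    (hfix : ∀ z : Z, ∃ g : K, g +ᵥ z ≠ z) (m : ℕ) (u : Z → K)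
    (hu : (shiftSum b (funRep K Z) ^ alternatingExponent p (m + 1)) u = 0) :
    ∃ v, (shiftSum b (funRep K Z) ^ alternatingExponent p m) v = u := by
  by_cases h : Even m
  · have h' : ¬ Even (m + 1) := by simpa [Nat.even_add_one] using h
    simp only [alternatingExponent, h, h', if_true, if_false, pow_one] at hu ⊢
    exact (shiftSum_exact b hfix u).2 hu
  · have h' : Even (m + 1) := by simpa [Nat.even_add_one] using h
    simp only [alternatingExponent, h, h', if_true, if_false, pow_one] at hu ⊢
    exact (shiftSum_exact b hfix u).1 hu

/-- The nonempty finite strictly decreasing sequences in `P`. -/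
def StrictFlag [PartialOrder Y] (P : Set Y) : Type _ :=
  {l : List Y // l ≠ [] ∧ l.Pairwise (· > ·) ∧ ∀ y ∈ l, y ∈ P}

/-- The finite weakly decreasing sequences in `P`. -/
def weakFlags [PartialOrder Y] (P : Set Y) : Set (List Y) :=
  {l | l.Pairwise (· ≥ ·) ∧ ∀ y ∈ l, y ∈ P}

/-- The action on strict flags induced by an action through order automorphisms. -/
abbrev strictFlagAddAction [PartialOrder Y] (P : Set Y)
    (hmono : ∀ (g : K) (x y : Y), x < y → g +ᵥ x < g +ᵥ y)
    (hP : ∀ (g : K), ∀ y ∈ P, g +ᵥ y ∈ P) : AddAction K (StrictFlag P) where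
  vadd g l := ⟨g +ᵥ l.1, by
    rw [list_vadd_eq_map]
    refine ⟨by simpa using l.2.1, ?_, ?_⟩
    · rw [List.pairwise_map]
      exact l.2.2.1.imp fun {x y} h => hmono g y x h
    · simp only [List.mem_map, forall_exists_index, and_imp, forall_apply_eq_imp_iff₂]
      exact fun y hy => hP g y (l.2.2.2 y hy)⟩
  zero_vadd l := Subtype.ext (zero_vadd K l.1)
  add_vadd g h l := Subtype.ext (add_vadd g h l.1)

/-- The obstruction: an equivariant system of chains `z 0, …, z d` which looks like a piece of a
free resolution cannot be carried by flags of dimension less than `d` in a partially ordered set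
on which the elementary abelian group acts without fixed points. -/
theorem not_supported_weakFlags {p : ℕ} [Fact p.Prime] [Algebra (ZMod p) K]
    (b : Module.Basis ι (ZMod p) K) [PartialOrder Y] (P : Set Y)
    (hmono : ∀ (g : K) (x y : Y), x < y → g +ᵥ x < g +ᵥ y)
    (hP : ∀ (g : K), ∀ y ∈ P, g +ᵥ y ∈ P) (hfix : ∀ y ∈ P, ∃ g : K, g +ᵥ y ≠ y)
    (d : ℕ) (hd : ∀ l : List Y, l.Pairwise (· > ·) → (∀ y ∈ l, y ∈ P) → l.length ≤ d)
    (z : ℕ → List Y →₀ K) (hz0 : chainBoundary K Y (z 0) = Finsupp.single [] 1)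
    (hz : ∀ m < d, chainBoundary K Y (z (m + 1)) =
      (shiftSum (A := Module.End K (List Y →₀ K)) b (chainRep K Y) ^ alternatingExponent p m) (z m))
    (hzP : ∀ m ≤ d, z m ∈ Finsupp.supported K K (weakFlags P ∩ {l | l.length = m + 1})) :
    False := by
  classical
  have hp : p.Prime := Fact.out
  let _ := strictFlagAddAction P hmono hP
  have hfixZ : ∀ l : StrictFlag P, ∃ g : K, g +ᵥ l ≠ l := by
    rintro ⟨l, hl, hl'⟩
    cases l with
    | nil => exact absurd rfl hl
    | cons a l =>
      obtain ⟨g, hg⟩ := hfix a (hl'.2 a (by simp))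
      refine ⟨g, fun h => hg ?_⟩
      have h1 := congrArg Subtype.val h
      exact (List.cons.inj h1).1
  set S := shiftSum b (funRep K (List Y)) with hS
  have hSδ : ∀ (m : ℕ) u, chainCoboundary K Y ((S ^ m) u) = (S ^ m) (chainCoboundary K Y u) :=
    fun m u => shiftSum_pow_intertwine b _ _ (chainCoboundary K Y) chainCoboundary_funRep m u
  have key : ∀ m ≤ d, ∃ w : List Y → K, (∀ l₁ a l₂, w (l₁ ++ a :: a :: l₂) = 0) ∧
      (∀ l ∈ weakFlags P, (S ^ alternatingExponent p (m + 1)) (chainCoboundary K Y w) l = 0) ∧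
      chainEval w (chainBoundary K Y (z m)) = 1 := by
    intro m
    induction m with
    | zero =>
      intro _
      set w : List Y → K := fun l => if l = [] then 1 else 0 with hw
      refine ⟨w, fun l₁ a l₂ => by simp [hw], fun l _ => ?_, by simp [hz0, hw]⟩
      have h1 : ∀ g, funRep K (List Y) g w = w := fun g => by
        funext l
        change w (l.map (g.toAdd +ᵥ ·)) = w l
        simp [hw]
      have h2 : S w = 0 := by simp [hS, shiftSum, h1]
      obtain ⟨r, hr⟩ := Nat.exists_eq_succ_of_ne_zero (alternatingExponent_ne_zero hp (0 + 1))
      rw [← hSδ, hr, pow_succ, Module.End.mul_apply, h2, map_zero, map_zero, Pi.zero_apply]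
    | succ m ih =>
      intro hm
      obtain ⟨w, hw1, hw2, hw3⟩ := ih (by omega)
      have hR : ∀ (j : ℕ) (u : List Y → K) (l : StrictFlag P),
          (S ^ j) u l.1 = (shiftSum b (funRep K (StrictFlag P)) ^ j) (fun l => u l.1) l :=
        fun j u l => congrFun (shiftSum_pow_intertwine b (funRep K (List Y))
          (funRep K (StrictFlag P)) (LinearMap.funLeft K K fun l : StrictFlag P => l.1)
          (fun g u => rfl) j u) l
      obtain ⟨v, hv⟩ := shiftSum_exact_alternating b hfixZ m
        (fun l : StrictFlag P => chainCoboundary K Y w l.1) (by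
          funext l
          rw [← hR]
          exact hw2 _ ⟨l.2.2.1.imp fun h => le_of_lt h, l.2.2.2⟩)
      set w' : List Y → K := fun l =>
        if hl : l ≠ [] ∧ l.Pairwise (· > ·) ∧ ∀ y ∈ l, y ∈ P then v ⟨l, hl⟩ else 0 with hw'
      have hw'1 : ∀ l₁ a l₂, w' (l₁ ++ a :: a :: l₂) = 0 := fun l₁ a l₂ =>
        dif_neg fun h => not_pairwise_of_repeat l₁ a l₂ h.2.1
      have hw'v : (fun l : StrictFlag P => w' l.1) = v := by
        funext l
        exact dif_pos l.2
      have hA : ∀ l ∈ weakFlags P,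
          (S ^ alternatingExponent p m) w' l = chainCoboundary K Y w l := by
        intro l hl
        by_cases hl0 : l = []
        · subst hl0
          rw [shiftSum_pow_nil b (alternatingExponent_ne_zero hp m), chainCoboundary_apply]
          simp [listBoundary]
        by_cases hls : l.Pairwise (· > ·)
        · have h1 := hR (alternatingExponent p m) w' ⟨l, hl0, hls, hl.2⟩
          rw [hw'v, hv] at h1
          exact h1
        · obtain ⟨l₁, a, l₂, rfl⟩ := exists_repeat_of_not_pairwise hl.1 hls
          rw [shiftSum_pow_repeat b _ _ hw'1, chainCoboundary_apply,
            chainEval_listBoundary_of_repeat w hw1]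
      refine ⟨w', hw'1, fun l hl => ?_, ?_⟩
      · rw [add_assoc, alternatingExponent_add_two, ← hSδ, chainCoboundary_apply,
          linearMap_congr_supported (chainEval ((S ^ alternatingExponent p m) w'))
            (chainEval (chainCoboundary K Y w)) (s := {l' | l'.Sublist l ∧ _}) (fun l' hl' => ?_)
            (listBoundary_mem_supported l), ← chainEval_chainBoundary, chainBoundary_listBoundary,
          map_zero]
        simpa using hA l' ⟨hl.1.sublist hl'.1, fun y hy => hl.2 y (hl'.1.subset hy)⟩
      · rw [hz m (by omega), chainEval_shiftSum_pow, ← hw3, chainEval_chainBoundary]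
        refine linearMap_congr_supported _ _ (fun l hl => ?_) (hzP m (by omega))
        simpa using hA l hl.1
  obtain ⟨w, hw1, -, hw3⟩ := key d le_rfl
  rw [chainEval_chainBoundary] at hw3
  refine one_ne_zero (hw3.symm.trans ?_)
  refine linearMap_congr_supported _ 0 (fun l hl => ?_) (hzP d le_rfl)
  have hls : ¬ l.Pairwise (· > ·) := fun h => by
    have h1 := hd l h hl.1.2
    have h2 : l.length = d + 1 := hl.2
    omega
  obtain ⟨l₁, a, l₂, rfl⟩ := exists_repeat_of_not_pairwise hl.1.1 hls
  simp [chainCoboundary_apply, chainEval_listBoundary_of_repeat w hw1]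

end Obstruction

section SmallSimplices

variable {K ι J V X Y : Type*} [Field K]

/-- The barycenter of a list of points. -/
def listCentroid {V : Type*} [AddCommGroup V] [Module ℝ V] (l : List V) : V :=
  (l.length : ℝ)⁻¹ • l.sum

lemma listCentroid_map [AddCommGroup V] [Module ℝ V] (L : V →ₗ[ℝ] V) (l : List V) :
    listCentroid (l.map L) = L (listCentroid l) := by
  simp [listCentroid, map_list_sum]

lemma listCentroid_mem [AddCommGroup V] [Module ℝ V] {A : Set V} (hA : Convex ℝ A) {l : List V}
    (hl : l ≠ []) (h : ∀ x ∈ l, x ∈ A) : listCentroid l ∈ A := by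
  have h0 : (l.length : ℝ) ≠ 0 := by simpa using hl
  have h1 : listCentroid l = ∑ i : Fin l.length, (l.length : ℝ)⁻¹ • l[i] := by
    rw [listCentroid, ← Finset.smul_sum]
    congr 1
    exact (Fin.sum_univ_getElem l).symm
  rw [h1]
  refine hA.sum_mem (fun i _ => by positivity) ?_ fun i _ => h _ (List.getElem_mem _)
  simp [h0]

lemma dist_listCentroid_le [NormedAddCommGroup V] [NormedSpace ℝ V] {d : ℕ} {l : List V}
    (hd : l.length ≤ d + 1) {D : ℝ} (hD : ∀ x ∈ l, ∀ y ∈ l, dist x y ≤ D) {x : V} (hx : x ∈ l) :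
    dist x (listCentroid l) ≤ d / (d + 1) * D := by
  have hD0 : 0 ≤ D := dist_nonneg.trans (hD x hx x hx)
  obtain ⟨i₀, hi₀, rfl⟩ := List.getElem_of_mem hx
  have h0 : (0 : ℝ) < l.length := by exact_mod_cast Nat.zero_lt_of_lt hi₀
  set y := l[i₀] with hy
  have h1 : listCentroid l - y = (l.length : ℝ)⁻¹ • ∑ i : Fin l.length, (l[i] - y) := by
    rw [Finset.sum_sub_distrib, smul_sub, listCentroid]
    congr 1
    · congr 1
      exact (Fin.sum_univ_getElem l).symm
    · rw [Finset.sum_const, Finset.card_univ, Fintype.card_fin, ← Nat.cast_smul_eq_nsmul ℝ,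
        smul_smul, inv_mul_cancel₀ h0.ne', one_smul]
  have h2 : ‖∑ i : Fin l.length, (l[i] - y)‖ ≤ (l.length - 1 : ℝ) * D := by
    rw [← Finset.add_sum_erase _ _ (Finset.mem_univ (⟨i₀, hi₀⟩ : Fin l.length))]
    have h3 : l[(⟨i₀, hi₀⟩ : Fin l.length)] - y = 0 := sub_self _
    rw [h3, zero_add]
    refine (norm_sum_le_of_le _ (f := fun i => l[i] - y) (n := fun _ => D) fun i _ => ?_).trans_eq
      ?_
    · rw [← dist_eq_norm]
      exact hD _ (List.getElem_mem _) _ hx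
    · rw [Finset.sum_const, nsmul_eq_mul, Finset.card_erase_of_mem (Finset.mem_univ _), Finset.card_univ, Fintype.card_fin,
        Nat.cast_pred (Nat.zero_lt_of_lt hi₀)]
  rw [dist_comm, dist_eq_norm, h1, norm_smul, norm_inv, Real.norm_of_nonneg h0.le]
  refine (mul_le_mul_of_nonneg_left h2 (by positivity)).trans ?_
  rw [← mul_assoc]
  refine mul_le_mul_of_nonneg_right ?_ hD0
  have h4 : (l.length : ℝ) ≤ d + 1 := by exact_mod_cast hd
  rw [inv_mul_eq_div, div_le_div_iff₀ h0 (by positivity)]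
  nlinarith

/-- Barycentric subdivision stays in convex sets and shrinks diameters. -/
lemma subdivision_listCentroid_mem_supported [NormedAddCommGroup V] [NormedSpace ℝ V] (d : ℕ)
    (l : List V) : subdivision K listCentroid (Finsupp.single l 1) ∈ Finsupp.supported K K
      {l' | l'.length = l.length ∧
        (∀ A, Convex ℝ A → (∀ x ∈ l, x ∈ A) → ∀ x ∈ l', x ∈ A) ∧
        ∀ D : ℝ, l.length ≤ d + 1 → (∀ x ∈ l, ∀ y ∈ l, dist x y ≤ D) →
          ∀ x ∈ l', ∀ y ∈ l', dist x y ≤ d / (d + 1) * D} := by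
  refine subdivision_mem_supported listCentroid (fun l l' => l'.length = l.length ∧
        (∀ A, Convex ℝ A → (∀ x ∈ l, x ∈ A) → ∀ x ∈ l', x ∈ A) ∧
        ∀ D : ℝ, l.length ≤ d + 1 → (∀ x ∈ l, ∀ y ∈ l, dist x y ≤ D) →
          ∀ x ∈ l', ∀ y ∈ l', dist x y ≤ d / (d + 1) * D) (by simp) ?_ l
  rintro l l₁ l' hl hl₁ hlen ⟨h1, h2, h3⟩
  refine ⟨by simp [h1, hlen], fun A hA hlA x hx => ?_, fun D hd hD => ?_⟩
  · rcases List.mem_cons.1 hx with rfl | hx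
    · exact listCentroid_mem hA hl hlA
    · exact h2 A hA (fun y hy => hlA y (hl₁.subset hy)) x hx
  · have h4 : ∀ x ∈ l', dist x (listCentroid l) ≤ d / (d + 1) * D := fun x hx =>
      h2 _ (convex_closedBall (listCentroid l) (d / (d + 1) * D))
        (fun y hy => dist_listCentroid_le hd hD (hl₁.subset hy)) x hx
    have h5 : 0 ≤ d / (d + 1) * D := by
      obtain ⟨x, hx⟩ := List.exists_mem_of_ne_nil l hl
      have := dist_nonneg.trans (hD x hx x hx)
      positivity
    intro x hx y hy
    rcases List.mem_cons.1 hx with rfl | hx <;> rcases List.mem_cons.1 hy with rfl | hy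
    · simpa using h5
    · rw [dist_comm]
      exact h4 y hy
    · exact h4 x hx
    · exact h3 D (by omega) (fun x hx y hy => hD x (hl₁.subset hx) y (hl₁.subset hy)) x hx y hy

/-- Subdividing along a monotone labelling produces flags of labels. -/
lemma subdivision_mem_supported_of_monotone [PartialOrder Y] (b : List X → Y)
    (hb : ∀ l₁ l₂, l₁ ⊆ l₂ → b l₁ ≤ b l₂) (l : List X) :
    subdivision K b (Finsupp.single l 1) ∈ Finsupp.supported K K
      {l' | l'.length = l.length ∧ l'.Pairwise (· ≥ ·) ∧
        ∀ y ∈ l', ∃ l₁, l₁ ≠ [] ∧ l₁ ⊆ l ∧ l₁.length ≤ l.length ∧ b l₁ = y} := by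
  refine subdivision_mem_supported b (fun l l' => l'.length = l.length ∧ l'.Pairwise (· ≥ ·) ∧
        ∀ y ∈ l', ∃ l₁, l₁ ≠ [] ∧ l₁ ⊆ l ∧ l₁.length ≤ l.length ∧ b l₁ = y) (by simp) ?_ l
  rintro l l₁ l' hl hl₁ hlen ⟨h1, h2, h3⟩
  have h4 : ∀ y ∈ l', ∃ l₁, l₁ ≠ [] ∧ l₁ ⊆ l ∧ l₁.length ≤ l.length ∧ b l₁ = y := by
    intro y hy
    obtain ⟨l₂, h5, h6, h7, h8⟩ := h3 y hy
    exact ⟨l₂, h5, fun x hx => hl₁.subset (h6 hx), by omega, h8⟩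
  refine ⟨by simp [h1, hlen], List.pairwise_cons.2 ⟨fun y hy => ?_, h2⟩, fun y hy => ?_⟩
  · obtain ⟨l₂, -, h6, -, rfl⟩ := h4 y hy
    exact hb _ _ h6
  · rcases List.mem_cons.1 hy with rfl | hy
    · exact ⟨l, hl, fun _ h => h, le_rfl, rfl⟩
    · exact h4 y hy

variable [Fintype ι] [AddAction K X] [AddAction K Y]

lemma shiftSum_pow_mem_supported (b : ι → K) {s : Set (List X)}
    (hs : ∀ (g : K), ∀ l ∈ s, l.map (g +ᵥ ·) ∈ s) (m : ℕ) {c : List X →₀ K}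
    (hc : c ∈ Finsupp.supported K K s) :
    (shiftSum (A := Module.End K (List X →₀ K)) b (chainRep K X) ^ m) c ∈
      Finsupp.supported K K s := by
  induction m with
  | zero => simpa using hc
  | succ m ih =>
    rw [pow_succ', Module.End.mul_apply]
    generalize (shiftSum (A := Module.End K (List X →₀ K)) b (chainRep K X) ^ m) c = c' at ih ⊢
    simp only [shiftSum, LinearMap.sum_apply, LinearMap.smul_apply, LinearMap.sub_apply,
      Module.End.one_apply]
    refine Submodule.sum_mem _ fun i _ => Submodule.smul_mem _ _ (Submodule.sub_mem _ ?_ ih)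
    refine map_mem_supported _ (fun l hl => ?_) ih
    rw [chainRep_apply, chainMap_single]
    exact Finsupp.single_mem_supported K _ (hs _ l hl)

/-- The piece of a resolution carried by the iterated join of the orbits `v j`. -/
def joinChain (p : ℕ) (b : ι → K) (v : ℕ → K → X) (m : ℕ) : List X →₀ K :=
  Nat.rec (Finsupp.single [v 0 0] 1) (fun m c => chainCone K (v (m + 1) 0)
    ((shiftSum (A := Module.End K (List X →₀ K)) b (chainRep K X) ^ alternatingExponent p m) c)) m

lemma joinChain_succ (p : ℕ) (b : ι → K) (v : ℕ → K → X) (m : ℕ) :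
    joinChain p b v (m + 1) = chainCone K (v (m + 1) 0)
      ((shiftSum (A := Module.End K (List X →₀ K)) b (chainRep K X) ^ alternatingExponent p m)
        (joinChain p b v m)) := rfl

lemma chainBoundary_shiftSum_pow (b : ι → K) (m : ℕ) (c : List X →₀ K) :
    chainBoundary K X ((shiftSum (A := Module.End K (List X →₀ K)) b (chainRep K X) ^ m) c) =
      (shiftSum (A := Module.End K (List X →₀ K)) b (chainRep K X) ^ m) (chainBoundary K X c) := by
  have h : ∀ (g : Multiplicative K) (c : List X →₀ K),
      chainBoundary K X (chainRep K X g c) = chainRep K X g (chainBoundary K X c) :=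
    fun g c => chainBoundary_chainMap _ c
  exact shiftSum_pow_intertwine b _ _ (chainBoundary K X) h m c

lemma chainBoundary_joinChain_zero (p : ℕ) (b : ι → K) (v : ℕ → K → X) :
    chainBoundary K X (joinChain p b v 0) = Finsupp.single [] 1 := by
  simp [joinChain, listBoundary]

lemma chainBoundary_joinChain_succ (p : ℕ) [Fact p.Prime] [CharP K p] (b : ι → K)
    (v : ℕ → K → X) (m : ℕ) :
    chainBoundary K X (joinChain p b v (m + 1)) =
      (shiftSum (A := Module.End K (List X →₀ K)) b (chainRep K X) ^ alternatingExponent p m)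
        (joinChain p b v m) := by
  have hp : p.Prime := Fact.out
  induction m with
  | zero =>
    rw [joinChain_succ, chainBoundary_chainCone, chainBoundary_shiftSum_pow,
      chainBoundary_joinChain_zero]
    simp [alternatingExponent, shiftSum, chainRep_apply]
  | succ m ih =>
    rw [joinChain_succ, chainBoundary_chainCone, chainBoundary_shiftSum_pow, ih,
      ← Module.End.mul_apply (shiftSum (A := Module.End K (List X →₀ K)) b (chainRep K X) ^
        alternatingExponent p (m + 1)), ← pow_add, add_comm (alternatingExponent p (m + 1)),
      alternatingExponent_add_succ hp, shiftSum_pow_char p]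
    simp

lemma joinChain_mem_supported (p : ℕ) (b : ι → K) (v : ℕ → K → X)
    (hv : ∀ (g : K) j h, g +ᵥ v j h = v j (g + h)) (m : ℕ) :
    joinChain p b v m ∈ Finsupp.supported K K
      {l | l.length = m + 1 ∧ ∃ θ : ℕ → K, ∀ x ∈ l, ∃ j ≤ m, x = v j (θ j)} := by
  induction m with
  | zero => exact Finsupp.single_mem_supported K _ ⟨rfl, 0, by simp⟩
  | succ m ih =>
    rw [joinChain_succ]
    refine map_mem_supported (chainCone K (v (m + 1) 0)) ?_ (shiftSum_pow_mem_supported b ?_ _ ih)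
    · rintro l ⟨h1, θ, h2⟩
      rw [chainCone_single]
      refine Finsupp.single_mem_supported K _
        ⟨by simp [h1], Function.update θ (m + 1) 0, fun x hx => ?_⟩
      rcases List.mem_cons.1 hx with rfl | hx
      · exact ⟨m + 1, le_rfl, by simp⟩
      · obtain ⟨j, hj, rfl⟩ := h2 x hx
        exact ⟨j, by omega, by rw [Function.update_of_ne (by omega)]⟩
    · rintro g l ⟨h1, θ, h2⟩
      refine ⟨by simp [h1], fun j => g + θ j, fun x hx => ?_⟩
      obtain ⟨y, hy, rfl⟩ := List.mem_map.1 hx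
      obtain ⟨j, hj, rfl⟩ := h2 y hy
      exact ⟨j, hj, hv g j _⟩

/-- An equivariant monotone labelling of small simplices in a join of `d + 1` copies of an
elementary abelian group cannot take values in a poset of dimension less than `d` without fixed
points. -/
theorem not_label_mem {p : ℕ} [Fact p.Prime] [Algebra (ZMod p) K]
    (b : Module.Basis ι (ZMod p) K) [PartialOrder Y] (P : Set Y)
    (hmono : ∀ (g : K) (x y : Y), x < y → g +ᵥ x < g +ᵥ y)
    (hP : ∀ (g : K), ∀ y ∈ P, g +ᵥ y ∈ P) (hfix : ∀ y ∈ P, ∃ g : K, g +ᵥ y ≠ y)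
    (d : ℕ) (hd : ∀ l : List Y, l.Pairwise (· > ·) → (∀ y ∈ l, y ∈ P) → l.length ≤ d)
    [NormedAddCommGroup V] [NormedSpace ℝ V] [AddAction K V]
    (hlin : ∀ g : K, ∃ L : V →ₗ[ℝ] V, ∀ x, g +ᵥ x = L x)
    (v : ℕ → K → V) (hv : ∀ (g : K) j h, g +ᵥ v j h = v j (g + h))
    (hv1 : ∀ i g j h, dist (v i g) (v j h) ≤ 1)
    (label : List V → Y) (hlabel : ∀ l₁ l₂, l₁ ⊆ l₂ → label l₁ ≤ label l₂)
    (hlabel' : ∀ (g : K) l, label (l.map (g +ᵥ ·)) = g +ᵥ label l) (δ : ℝ) (hδ : 0 < δ)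
    (hlabelP : ∀ (θ : ℕ → K) (l : List V), l ≠ [] → (∀ x ∈ l, ∀ y ∈ l, dist x y ≤ δ) →
      (∀ x ∈ l, x ∈ convexHull ℝ {y | ∃ j ≤ d, y = v j (θ j)}) → label l ∈ P) : False := by
  have : CharP K p := by
    have := charP_of_injective_algebraMap (algebraMap (ZMod p) K).injective p
    exact this
  set ρ : ℝ := d / (d + 1) with hρ
  have hρ0 : 0 ≤ ρ := by positivity
  have hρ1 : ρ < 1 := by
    rw [hρ, div_lt_one (by positivity)]
    linarith
  obtain ⟨N, hN⟩ := exists_pow_lt_of_lt_one hδ hρ1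
  set B : (List V →₀ K) →ₗ[K] (List V →₀ K) := subdivision K listCentroid with hB
  set T : (List V →₀ K) →ₗ[K] (List Y →₀ K) := subdivision K label ∘ₗ (B ^ N) with hT
  have hBN : ∀ c, chainBoundary K V ((B ^ N) c) = (B ^ N) (chainBoundary K V c) := by
    have h1 : Commute (chainBoundary K V : Module.End K (List V →₀ K)) B :=
      LinearMap.ext fun c => chainBoundary_subdivision listCentroid c
    exact fun c => LinearMap.congr_fun (h1.pow_right N) c
  have hBg : ∀ (g : Multiplicative K) c, (B ^ N) (chainRep K V g c) =
      chainRep K V g ((B ^ N) c) := by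
    intro g
    have h1 : Commute (chainRep K V g) B := by
      refine LinearMap.ext fun c => (subdivision_chainMap _ _ _ (fun l => ?_) c).symm
      obtain ⟨L, hL⟩ := hlin g.toAdd
      simp only [hL, listCentroid_map]
    exact fun c => (LinearMap.congr_fun (h1.pow_right N) c).symm
  have hTb : ∀ c, chainBoundary K Y (T c) = T (chainBoundary K V c) := fun c => by
    rw [hT, LinearMap.comp_apply, LinearMap.comp_apply, chainBoundary_subdivision, hBN]
  have hTg : ∀ (g : Multiplicative K) c, T (chainRep K V g c) = chainRep K Y g (T c) :=
    fun g c => by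
      rw [hT, LinearMap.comp_apply, LinearMap.comp_apply, hBg]
      exact subdivision_chainMap _ _ _ (hlabel' g.toAdd) _
  refine not_supported_weakFlags b P hmono hP hfix d hd (fun m => T (joinChain p b v m)) ?_ ?_ ?_
  · rw [hTb, chainBoundary_joinChain_zero]
    have h1 : ∀ n, (B ^ n) (Finsupp.single [] 1) = Finsupp.single [] 1 := by
      intro n
      induction n with
      | zero => rfl
      | succ n ih =>
        rw [pow_succ, Module.End.mul_apply, hB, subdivision_single_nil]
        exact ih
    rw [hT, LinearMap.comp_apply, h1, subdivision_single_nil]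
  · intro m _
    rw [hTb, chainBoundary_joinChain_succ]
    exact shiftSum_pow_intertwine b _ _ T hTg _ _
  · intro m hm
    have h1 : ∀ n, (B ^ n) (joinChain p b v m) ∈ Finsupp.supported K K
        {l | l.length = m + 1 ∧ (∃ θ : ℕ → K,
          ∀ x ∈ l, x ∈ convexHull ℝ {y | ∃ j ≤ d, y = v j (θ j)}) ∧
          ∀ x ∈ l, ∀ y ∈ l, dist x y ≤ ρ ^ n} := by
      intro n
      induction n with
      | zero =>
        refine Finsupp.supported_mono ?_ (joinChain_mem_supported p b v hv m)
        rintro l ⟨h1, θ, h2⟩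
        refine ⟨h1, ⟨θ, fun x hx => subset_convexHull ℝ _ ?_⟩, fun x hx y hy => ?_⟩
        · obtain ⟨j, hj, rfl⟩ := h2 x hx
          exact ⟨j, hj.trans hm, rfl⟩
        · obtain ⟨i, hi, rfl⟩ := h2 x hx
          obtain ⟨j, hj, rfl⟩ := h2 y hy
          simpa using hv1 _ _ _ _
      | succ n ih =>
        rw [pow_succ' B, Module.End.mul_apply]
        refine map_mem_supported _ ?_ ih
        rintro l ⟨h2, ⟨θ, h3⟩, h4⟩
        refine Finsupp.supported_mono ?_ (subdivision_listCentroid_mem_supported d l)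
        rintro l' ⟨h5, h6, h7⟩
        refine ⟨h5.trans h2, ⟨θ, h6 _ (convex_convexHull ℝ _) h3⟩, ?_⟩
        rw [pow_succ' ρ]
        exact h7 _ (by omega) h4
    refine map_mem_supported (subdivision K label) ?_ (h1 N)
    rintro l ⟨h2, ⟨θ, h3⟩, h4⟩
    refine Finsupp.supported_mono ?_ (subdivision_mem_supported_of_monotone label hlabel l)
    rintro l' ⟨h5, h6, h7⟩
    refine ⟨⟨h6, fun y hy => ?_⟩, h5.trans h2⟩
    obtain ⟨l₁, h8, h9, -, rfl⟩ := h7 y hy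
    exact hlabelP θ l₁ h8
      (fun x hx y hy => (h4 x (h9 hx) y (h9 hy)).trans hN.le) fun x hx => h3 x (h9 hx)

end SmallSimplices

section LabelPoset

variable {K J : Type*} [Field K] [Fintype K] [DecidableEq K] [Fintype J] [DecidableEq J]

/-- The action on sets of pairs by translation of the second component. -/
abbrev finsetShift (K J : Type*) [Field K] [Fintype K] [DecidableEq K] [Fintype J]
    [DecidableEq J] : AddAction K (Finset (J × K)) where
  vadd g S := Finset.univ.filter fun v => (v.1, v.2 - g) ∈ S
  zero_vadd S := by
    ext v
    change v ∈ Finset.univ.filter (fun v : J × K => (v.1, v.2 - (0 : K)) ∈ S) ↔ _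
    simp
  add_vadd g h S := by
    ext v
    change v ∈ Finset.univ.filter (fun v : J × K => (v.1, v.2 - (g + h)) ∈ S) ↔
      v ∈ Finset.univ.filter (fun v : J × K =>
        (v.1, v.2 - g) ∈ Finset.univ.filter (fun v : J × K => (v.1, v.2 - h) ∈ S))
    simp [sub_sub]

attribute [local instance] finsetShift

lemma mem_finsetShift (g : K) (S : Finset (J × K)) (i : J) (h : K) :
    (i, h) ∈ g +ᵥ S ↔ (i, h - g) ∈ S := by
  change (i, h) ∈ Finset.univ.filter (fun v : J × K => (v.1, v.2 - g) ∈ S) ↔ _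
  simp

lemma finsetShift_le_iff (g : K) (S T : Finset (J × K)) : g +ᵥ S ≤ g +ᵥ T ↔ S ≤ T := by
  constructor
  · rintro h ⟨i, a⟩ ha
    have h1 := h ((mem_finsetShift g S i (a + g)).2 (by simpa using ha))
    simpa [mem_finsetShift] using h1
  · rintro h ⟨i, a⟩ ha
    rw [mem_finsetShift] at ha ⊢
    exact h ha

/-- The nonempty sets of pairs which contain no full row. -/
def noFullRow (K J : Type*) : Set (Finset (J × K)) :=
  {S | S.Nonempty ∧ ∀ i, ∃ g, (i, g) ∉ S}

lemma vadd_mem_noFullRow (g : K) {S : Finset (J × K)} (hS : S ∈ noFullRow K J) :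
    g +ᵥ S ∈ noFullRow K J := by
  obtain ⟨⟨⟨i, a⟩, ha⟩, h⟩ := hS
  refine ⟨⟨(i, a + g), by simpa [mem_finsetShift] using ha⟩, fun j => ?_⟩
  obtain ⟨c, hc⟩ := h j
  exact ⟨c + g, by simpa [mem_finsetShift] using hc⟩

lemma exists_vadd_ne_of_mem_noFullRow {S : Finset (J × K)} (hS : S ∈ noFullRow K J) :
    ∃ g : K, g +ᵥ S ≠ S := by
  obtain ⟨⟨⟨i, a⟩, ha⟩, h⟩ := hS
  obtain ⟨c, hc⟩ := h i
  refine ⟨c - a, fun he => hc ?_⟩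
  rw [← he, mem_finsetShift]
  simpa using ha

end LabelPoset

lemma length_le_of_noFullRow {K J : Type*} [Fintype K] [DecidableEq K] [Fintype J] [DecidableEq J]
    {l : List (Finset (J × K))} (hl : l.Pairwise (· > ·))
    (hP : ∀ S ∈ l, S ∈ noFullRow K J) :
    l.length ≤ Fintype.card J * (Fintype.card K - 1) := by
  have hcard : ∀ S ∈ l, S.card ∈ Finset.Icc 1 (Fintype.card J * (Fintype.card K - 1)) := by
    intro S hS
    obtain ⟨h1, h2⟩ := hP S hS
    choose g hg using h2
    have h3 : (Finset.univ.image fun i => (i, g i)) ⊆ Sᶜ := by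
      intro v hv
      obtain ⟨i, -, rfl⟩ := Finset.mem_image.1 hv
      simpa using hg i
    have h4 := Finset.card_le_card h3
    rw [Finset.card_image_of_injective _ (fun i j h => (Prod.ext_iff.1 h).1), Finset.card_univ,
      Finset.card_compl, Fintype.card_prod] at h4
    have h5 := S.card_le_univ
    rw [Fintype.card_prod] at h5
    rw [Finset.mem_Icc, Nat.mul_sub, mul_one]
    exact ⟨h1.card_pos, by omega⟩
  have hnd : (l.map Finset.card).Nodup := by
    rw [List.Nodup, List.pairwise_map]
    exact hl.imp fun h => (Finset.card_lt_card h).ne'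
  rw [← List.length_map Finset.card, ← List.toFinset_card_of_nodup hnd]
  refine (Finset.card_le_card (t := Finset.Icc 1 (Fintype.card J * (Fintype.card K - 1)))
    fun m hm => ?_).trans_eq (by simp)
  obtain ⟨S, hS, rfl⟩ := List.mem_map.1 (List.mem_toFinset.1 hm)
  exact hcard S hS

section EqualSplit

/-- The action on `K`-indexed vectors by translation of the index. -/
abbrev vectorShift (K I : Type*) [Field K] : AddAction K (I → K → ℝ) where
  vadd g z := fun ν h => z ν (h - g)
  zero_vadd z := by
    funext ν h
    change z ν (h - 0) = z ν h
    rw [sub_zero]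
  add_vadd g h z := by
    funext ν c
    change z ν (c - (g + h)) = z ν (c - g - h)
    rw [sub_sub]

variable {K J I : Type*} [Fintype K] [Fintype I]

/-- The sum of the coordinates over each block. -/
def blockSum (z : I → K → ℝ) : I → ℝ := fun ν => ∑ h, z ν h

/-- The simplex in the join spanned by the vertices `(ν, θ ν)`. -/
def coloredSimplex (θ : I → K) : Set (I → K → ℝ) :=
  {z | (∀ ν h, 0 ≤ z ν h) ∧ (∀ ν h, h ≠ θ ν → z ν h = 0) ∧ ∑ ν, blockSum z ν = 1}

lemma convex_coloredSimplex (θ : I → K) : Convex ℝ (coloredSimplex θ) := by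
  rintro z ⟨h1, h2, h3⟩ w ⟨h4, h5, h6⟩ a b ha hb hab
  refine ⟨fun ν h => ?_, fun ν h hh => ?_, ?_⟩
  · have := h1 ν h
    have := h4 ν h
    simp only [Pi.add_apply, Pi.smul_apply, smul_eq_mul]
    positivity
  · simp [h2 ν h hh, h5 ν h hh]
  · simp only [blockSum] at h3 h6 ⊢
    simp only [Pi.add_apply, Pi.smul_apply, smul_eq_mul, Finset.sum_add_distrib, ← Finset.mul_sum,
      h3, h6, mul_one, hab]

lemma blockSum_mem_stdSimplex {θ : I → K} {z : I → K → ℝ} (hz : z ∈ coloredSimplex θ) :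
    blockSum z ∈ stdSimplex ℝ I :=
  ⟨fun ν => Finset.sum_nonneg fun h _ => hz.1 ν h, hz.2.2⟩

lemma dist_blockSum_le (z w : I → K → ℝ) :
    dist (blockSum z) (blockSum w) ≤ Fintype.card K * dist z w := by
  rw [dist_pi_le_iff (by positivity)]
  intro ν
  rw [Real.dist_eq, blockSum, blockSum, ← Finset.sum_sub_distrib]
  refine (Finset.abs_sum_le_sum_abs _ _).trans ?_
  refine (Finset.sum_le_card_nsmul _ _ (dist z w) fun h _ => ?_).trans_eq (by simp)
  rw [← Real.dist_eq]
  exact (dist_le_pi_dist (z ν) (w ν) h).trans (dist_le_pi_dist z w ν)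

/-- The excess over the average of the amount of `f i` allocated to `g` by `θ` at `x`. -/
def splitExcess [DecidableEq K] (f : J → I → (I → ℝ) → ℝ) (x : I → ℝ) (θ : I → K) (i : J) (g : K) : ℝ :=
  Fintype.card K * ∑ ν with θ ν = g, f i ν x - ∑ ν, f i ν x

lemma sum_splitExcess [DecidableEq K] (f : J → I → (I → ℝ) → ℝ) (x : I → ℝ) (θ : I → K) (i : J) :
    ∑ g, splitExcess f x θ i g = 0 := by
  simp only [splitExcess, Finset.sum_sub_distrib, ← Finset.mul_sum, Finset.sum_const,
    Finset.card_univ, nsmul_eq_mul, Finset.sum_fiberwise, sub_self]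

lemma continuous_splitExcess [DecidableEq K] {f : J → I → (I → ℝ) → ℝ} (hf : ∀ i ν, Continuous (f i ν))
    (θ : I → K) (i : J) (g : K) : Continuous fun x => splitExcess f x θ i g := by
  unfold splitExcess
  fun_prop

/-- An extension of `splitExcess` to the join, independent of the allocation. -/
def joinExcess (f : J → I → (I → ℝ) → ℝ) (z : I → K → ℝ) (i : J) (g : K) : ℝ :=
  Fintype.card K * ∑ ν with z ν g ≠ 0, f i ν (blockSum z) - ∑ ν, f i ν (blockSum z)

lemma joinExcess_eq_splitExcess [DecidableEq K] {f : J → I → (I → ℝ) → ℝ}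
    (hf0 : ∀ i ν, ∀ x ∈ stdSimplex ℝ I, x ν = 0 → f i ν x = 0) {θ : I → K} {z : I → K → ℝ}
    (hz : z ∈ coloredSimplex θ) (i : J) (g : K) :
    joinExcess f z i g = splitExcess f (blockSum z) θ i g := by
  have h1 : ∀ ν, blockSum z ν = z ν (θ ν) := fun ν =>
    Finset.sum_eq_single (θ ν) (fun h _ hh => hz.2.1 ν h hh) (by simp)
  unfold joinExcess splitExcess
  congr 2
  rw [Finset.sum_filter, Finset.sum_filter]
  refine Finset.sum_congr rfl fun ν _ => ?_
  by_cases hθ : θ ν = g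
  · subst hθ
    by_cases h2 : z ν (θ ν) = 0
    · simp [h2, hf0 i ν _ (blockSum_mem_stdSimplex hz) ((h1 ν).trans h2)]
    · simp [h2]
  · simp [hθ, hz.2.1 ν g (Ne.symm hθ)]

section

attribute [local instance] vectorShift finsetShift

lemma vectorShift_apply {K I : Type*} [Field K] (g : K) (z : I → K → ℝ) (ν : I) (h : K) :
    (g +ᵥ z) ν h = z ν (h - g) := rfl

lemma joinExcess_vadd [Field K] (f : J → I → (I → ℝ) → ℝ) (g : K) (z : I → K → ℝ) (i : J) (h : K) :
    joinExcess f (g +ᵥ z) i h = joinExcess f z i (h - g) := by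
  have h1 : blockSum (g +ᵥ z) = blockSum z := by
    funext ν
    exact (Equiv.subRight g).sum_comp fun h => z ν h
  simp only [joinExcess, h1, vectorShift_apply]

/-- The vertices of the join. -/
def joinVertex (K : Type*) [DecidableEq K] (d : ℕ) (j : ℕ) (h : K) : Fin (d + 1) → K → ℝ :=
  fun ν h' => if ν.val = j ∧ h' = h then 1 else 0

lemma vadd_joinVertex {K : Type*} [Field K] [DecidableEq K] (d : ℕ) (g : K) (j : ℕ) (h : K) :
    g +ᵥ joinVertex K d j h = joinVertex K d j (g + h) := by
  funext ν h'
  simp only [vectorShift_apply, joinVertex, sub_eq_iff_eq_add, add_comm]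

lemma dist_joinVertex_le [DecidableEq K] (d : ℕ) (i : ℕ) (g : K) (j : ℕ) (h : K) :
    dist (joinVertex K d i g) (joinVertex K d j h) ≤ 1 := by
  rw [dist_pi_le_iff zero_le_one]
  intro ν
  rw [dist_pi_le_iff zero_le_one]
  intro c
  unfold joinVertex
  split_ifs <;> simp

lemma convexHull_joinVertex_subset [DecidableEq K] (d : ℕ) (θ : ℕ → K) :
    convexHull ℝ {y | ∃ j ≤ d, y = joinVertex K d j (θ j)} ⊆
      coloredSimplex fun ν : Fin (d + 1) => θ ν := by
  refine convexHull_min ?_ (convex_coloredSimplex _)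
  rintro _ ⟨j, hj, rfl⟩
  refine ⟨fun ν h => ?_, fun ν h hh => ?_, ?_⟩
  · unfold joinVertex
    split_ifs <;> simp
  · refine if_neg ?_
    rintro ⟨rfl, rfl⟩
    exact hh rfl
  · rw [Finset.sum_eq_single (⟨j, by omega⟩ : Fin (d + 1))]
    · simp [blockSum, joinVertex]
    · intro ν _ hν
      refine Finset.sum_eq_zero fun h _ => if_neg ?_
      rintro ⟨rfl, -⟩
      exact hν rfl
    · simp

/-- **Equal splitting.** Continuous functions `f i ν` on a simplex of dimension `n (q - 1)`, where
`f i ν` vanishes on the facet opposite to the vertex `ν`, can at some point be distributed equally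
among the elements of a finite field with `q` elements. -/
theorem exists_splitExcess_eq_zero [Field K] [DecidableEq K] {p : ℕ} [Fact p.Prime] [Algebra (ZMod p) K] {n d : ℕ}
    (hd : d = n * (Fintype.card K - 1))
    (f : Fin n → Fin (d + 1) → (Fin (d + 1) → ℝ) → ℝ) (hf : ∀ i ν, Continuous (f i ν))
    (hf0 : ∀ i ν, ∀ x ∈ stdSimplex ℝ (Fin (d + 1)), x ν = 0 → f i ν x = 0) :
    ∃ x, ∃ θ : Fin (d + 1) → K, ∀ i g, splitExcess f x θ i g = 0 := by
  classical
  by_contra! hno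
  have hpos : ∀ x (θ : Fin (d + 1) → K), ∃ i g, 0 < splitExcess f x θ i g := by
    intro x θ
    obtain ⟨i, g, hig⟩ := hno x θ
    refine ⟨i, ?_⟩
    by_contra! hle
    exact hig ((Finset.sum_eq_zero_iff_of_nonpos fun g _ => hle g).1 (sum_splitExcess f x θ i) g
      (Finset.mem_univ g))
  have hcompact : IsCompact (stdSimplex ℝ (Fin (d + 1))) := isCompact_stdSimplex ℝ _
  obtain ⟨ε, hε, hεx⟩ : ∃ ε > 0, ∀ x ∈ stdSimplex ℝ (Fin (d + 1)), ∀ θ : Fin (d + 1) → K,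
      ∃ i g, ε ≤ splitExcess f x θ i g := by
    obtain ⟨m, hm⟩ := hcompact.elim_directed_cover
      (fun m : ℕ => {x | ∀ θ : Fin (d + 1) → K, ∃ i g, 1 / ((m : ℝ) + 1) < splitExcess f x θ i g})
      (fun m => by
        simp only [Set.ofPred_forall, Set.ofPred_exists]
        exact isOpen_iInter_of_finite fun θ => isOpen_iUnion fun i => isOpen_iUnion fun g =>
          isOpen_lt continuous_const (continuous_splitExcess hf θ i g))
      (fun x _ => by
        choose i g hig using hpos x
        obtain ⟨θ₀, hθ₀⟩ := Finite.exists_min fun θ => splitExcess f x θ (i θ) (g θ)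
        obtain ⟨m, hm⟩ := exists_nat_one_div_lt (hig θ₀)
        exact Set.mem_iUnion.2 ⟨m, fun θ => ⟨i θ, g θ, hm.trans_le (hθ₀ θ)⟩⟩)
      (by
        refine Monotone.directed_le fun m m' hmm x hx θ => ?_
        obtain ⟨i, g, hig⟩ := hx θ
        exact ⟨i, g, (Nat.one_div_le_one_div hmm).trans_lt hig⟩)
    refine ⟨1 / ((m : ℝ) + 1), by positivity, fun x hx θ => ?_⟩
    obtain ⟨i, g, hig⟩ := hm hx θ
    exact ⟨i, g, hig.le⟩
  obtain ⟨δ, hδ, hδx⟩ : ∃ δ > 0, ∀ x ∈ stdSimplex ℝ (Fin (d + 1)),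
      ∀ y ∈ stdSimplex ℝ (Fin (d + 1)), dist x y < δ → ∀ (θ : Fin (d + 1) → K) i g,
        |splitExcess f x θ i g - splitExcess f y θ i g| < ε := by
    have h1 : ContinuousOn (fun x (θ : Fin (d + 1) → K) i g => splitExcess f x θ i g)
        (stdSimplex ℝ (Fin (d + 1))) :=
      (continuous_pi fun θ => continuous_pi fun i => continuous_pi fun g =>
        continuous_splitExcess hf θ i g).continuousOn
    obtain ⟨δ, hδ, h2⟩ := Metric.uniformContinuousOn_iff.1
      (hcompact.uniformContinuousOn_of_continuous h1) ε hε
    refine ⟨δ, hδ, fun x hx y hy hxy θ i g => ?_⟩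
    rw [← Real.dist_eq]
    have h3 := h2 x hx y hy hxy
    rw [dist_pi_lt_iff hε] at h3
    have h4 := h3 θ
    rw [dist_pi_lt_iff hε] at h4
    have h5 := h4 i
    rw [dist_pi_lt_iff hε] at h5
    exact h5 g
  have hq : (0 : ℝ) < Fintype.card K := by exact_mod_cast Fintype.card_pos
  set label : List (Fin (d + 1) → K → ℝ) → Finset (Fin n × K) := fun l =>
    Finset.univ.filter fun v => ∃ z ∈ l, ε ≤ joinExcess f z v.1 v.2 with hlabel
  have : Module.Finite (ZMod p) K := Module.Finite.of_finite
  refine not_label_mem (Module.finBasis (ZMod p) K) (noFullRow K (Fin n)) (fun g S T h => ?_)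
    (fun g S hS => vadd_mem_noFullRow g hS) (fun S hS => exists_vadd_ne_of_mem_noFullRow hS) d
    (fun l hl hlP => ?_) (fun g => ⟨⟨⟨fun z => g +ᵥ z, fun _ _ => rfl⟩, fun _ _ => rfl⟩,
      fun _ => rfl⟩) (joinVertex K d) (vadd_joinVertex d) (dist_joinVertex_le d) label
    (fun l₁ l₂ h => ?_) (fun g l => ?_) (δ / (2 * Fintype.card K)) (by positivity)
    (fun θ l hl hlδ hlθ => ?_)
  · rw [lt_iff_le_not_ge, finsetShift_le_iff, finsetShift_le_iff]
    exact lt_iff_le_not_ge.1 h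
  · refine (length_le_of_noFullRow hl hlP).trans_eq ?_
    rw [Fintype.card_fin, hd]
  · intro v hv
    simp only [hlabel, Finset.mem_filter_univ] at hv ⊢
    obtain ⟨z, hz, hz'⟩ := hv
    exact ⟨z, h hz, hz'⟩
  · ext ⟨i, h⟩
    rw [mem_finsetShift]
    simp [hlabel, joinExcess_vadd]
  · have hmem : ∀ z ∈ l, z ∈ coloredSimplex fun ν : Fin (d + 1) => θ ν :=
      fun z hz => convexHull_joinVertex_subset d θ (hlθ z hz)
    obtain ⟨z₀, hz₀⟩ := List.exists_mem_of_ne_nil l hl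
    refine ⟨?_, fun i => ?_⟩
    · obtain ⟨i, g, hig⟩ := hεx _ (blockSum_mem_stdSimplex (hmem z₀ hz₀)) (fun ν => θ ν)
      refine ⟨(i, g), ?_⟩
      simp only [hlabel, Finset.mem_filter_univ]
      exact ⟨z₀, hz₀, by rwa [joinExcess_eq_splitExcess hf0 (hmem z₀ hz₀)]⟩
    · by_contra! hfull
      refine (Finset.sum_pos (fun g _ => ?_) Finset.univ_nonempty).ne'
        (sum_splitExcess f (blockSum z₀) (fun ν : Fin (d + 1) => θ ν) i)
      have h1 := hfull g
      simp only [hlabel, Finset.mem_filter_univ] at h1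
      obtain ⟨z, hz, hz'⟩ := h1
      rw [joinExcess_eq_splitExcess hf0 (hmem z hz)] at hz'
      have h2 : dist (blockSum z) (blockSum z₀) < δ := by
        refine (dist_blockSum_le z z₀).trans_lt ?_
        calc Fintype.card K * dist z z₀ ≤ Fintype.card K * (δ / (2 * Fintype.card K)) :=
              mul_le_mul_of_nonneg_left (hlδ z hz z₀ hz₀) hq.le
          _ = δ / 2 := by field_simp
          _ < δ := half_lt_self hδ
      have h3 := (abs_lt.1 (hδx _ (blockSum_mem_stdSimplex (hmem z hz)) _
        (blockSum_mem_stdSimplex (hmem z₀ hz₀)) h2 (fun ν => θ ν) i g)).2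
      linarith

end

end EqualSplit

section FaceFan

variable {d : ℕ} {a : Fin (d + 1) → EuclideanSpace ℝ (Fin d)}
  {L : Fin (d + 1) → EuclideanSpace ℝ (Fin d) →ₗ[ℝ] ℝ}

/-- The linear parts of the barycentric coordinates of a simplex with barycenter at the origin. -/
lemma exists_simplexCoord
    (hnondeg : LinearIndependent ℝ (fun i : Fin d => a i.succ - a 0)) (hbary : ∑ i, a i = 0) :
    ∃ L : Fin (d + 1) → EuclideanSpace ℝ (Fin d) →ₗ[ℝ] ℝ, (∀ z, ∑ k, L k z • a k = z) ∧
      ∀ j k, L j (a k) = (if j = k then 1 else 0) - 1 / ((d : ℝ) + 1) := by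
  have hind : AffineIndependent ℝ a := by
    rw [affineIndependent_iff_linearIndependent_vsub ℝ a 0,
      ← linearIndependent_equiv (finSuccAboveEquiv (0 : Fin (d + 1)))]
    exact hnondeg
  have htop : affineSpan ℝ (Set.range a) = ⊤ := by
    rw [hind.affineSpan_eq_top_iff_card_eq_finrank_add_one]
    simp
  let b : AffineBasis (Fin (d + 1)) ℝ (EuclideanSpace ℝ (Fin d)) := ⟨a, hind, htop⟩
  have hdec : ∀ j z, b.coord j z = (b.coord j).linear z + b.coord j 0 := fun j z =>
    congrFun (b.coord j).decomp z
  have hba : ∀ k, b k = a k := fun k => rfl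
  have hL : ∀ j k, (b.coord j).linear (a k) = (if j = k then 1 else 0) - b.coord j 0 := by
    intro j k
    rw [eq_sub_iff_add_eq, ← hdec, ← hba, b.coord_apply]
  have h0 : ∀ j, b.coord j 0 = 1 / ((d : ℝ) + 1) := by
    intro j
    have h1 := congrArg (b.coord j).linear hbary
    rw [map_sum, map_zero] at h1
    simp only [hL, Finset.sum_sub_distrib, Finset.sum_ite_eq, Finset.mem_univ, if_true,
      Finset.sum_const, Finset.card_univ, Fintype.card_fin, nsmul_eq_mul, Nat.cast_add,
      Nat.cast_one] at h1
    rw [eq_div_iff (by positivity)]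
    linarith
  refine ⟨fun j => (b.coord j).linear, fun z => ?_, fun j k => by rw [hL, h0]⟩
  have h1 := b.linear_combination_coord_eq_self z
  have h2 : ∀ j, b.coord j z = (b.coord j).linear z + 1 / ((d : ℝ) + 1) := fun j => by
    rw [hdec, h0]
  simp only [h2, add_smul, Finset.sum_add_distrib, hba, ← Finset.smul_sum, hbary, smul_zero,
    add_zero] at h1
  exact h1

lemma mem_coneFace_iff (hbary : ∑ i, a i = 0) (hLz : ∀ z, ∑ k, L k z • a k = z)
    (hLa : ∀ j k, L j (a k) = (if j = k then 1 else 0) - 1 / ((d : ℝ) + 1)) (i : Fin (d + 1))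
    (z : EuclideanSpace ℝ (Fin d)) : z ∈ coneFace a i ↔ ∀ k, L i z ≤ L k z := by
  constructor
  · rintro ⟨t, ht, hti, rfl⟩ k
    have h1 : ∀ j, L j (∑ k, t k • a k) = t j - (∑ k, t k) * (1 / ((d : ℝ) + 1)) := by
      intro j
      simp [map_sum, hLa, mul_sub, Finset.sum_sub_distrib, Finset.sum_mul]
    rw [h1, h1, hti]
    linarith [ht k]
  · intro h
    refine ⟨fun k => L k z - L i z, fun k => sub_nonneg.2 (h k), sub_self _, ?_⟩
    simp only [sub_smul, Finset.sum_sub_distrib, hLz, ← Finset.smul_sum, hbary, smul_zero,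
      sub_zero]

lemma mem_translate_coneFace_iff (hbary : ∑ i, a i = 0) (hLz : ∀ z, ∑ k, L k z • a k = z)
    (hLa : ∀ j k, L j (a k) = (if j = k then 1 else 0) - 1 / ((d : ℝ) + 1)) (i : Fin (d + 1))
    (x y : EuclideanSpace ℝ (Fin d)) :
    y ∈ (x + ·) '' coneFace a i ↔ ∀ k, L i (y - x) ≤ L k (y - x) := by
  rw [← mem_coneFace_iff hbary hLz hLa, Set.image_add_left, Set.mem_preimage, neg_add_eq_sub]

lemma ae_simplexCoord_ne
    (hLa : ∀ j k, L j (a k) = (if j = k then 1 else 0) - 1 / ((d : ℝ) + 1))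
    {μ : Measure (EuclideanSpace ℝ (Fin d))}
    (hac : μ ≪ (volume : Measure (EuclideanSpace ℝ (Fin d)))) {i j : Fin (d + 1)} (hij : i ≠ j)
    (x : EuclideanSpace ℝ (Fin d)) : ∀ᵐ y ∂μ, L i (y - x) ≠ L j (y - x) := by
  refine hac.ae_le (ae_iff.2 ?_)
  have h1 : LinearMap.ker (L i - L j) ≠ ⊤ := by
    intro h
    have h2 : a i ∈ LinearMap.ker (L i - L j) := h ▸ Submodule.mem_top
    rw [LinearMap.mem_ker, LinearMap.sub_apply, hLa, hLa] at h2
    simp [hij.symm] at h2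
  have h2 := Measure.addHaar_submodule (volume : Measure (EuclideanSpace ℝ (Fin d))) _ h1
  rw [← measure_preimage_add_right volume (-x)] at h2
  rw [← h2]
  congr 1
  ext y
  simp [sub_eq_zero, ← sub_eq_add_neg]

lemma measurableSet_translate_coneFace (hbary : ∑ i, a i = 0)
    (hLz : ∀ z, ∑ k, L k z • a k = z)
    (hLa : ∀ j k, L j (a k) = (if j = k then 1 else 0) - 1 / ((d : ℝ) + 1)) (i : Fin (d + 1))
    (x : EuclideanSpace ℝ (Fin d)) : MeasurableSet ((x + ·) '' coneFace a i) := by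
  have h : (x + ·) '' coneFace a i = {y | ∀ k, L i (y - x) ≤ L k (y - x)} :=
    Set.ext (mem_translate_coneFace_iff hbary hLz hLa i x)
  have hc : ∀ k, Continuous (L k) := fun k => (L k).continuous_of_finiteDimensional
  rw [h]
  refine MeasurableSet.congr (s := ⋂ k, {y | L i (y - x) ≤ L k (y - x)}) ?_ (by ext y; simp)
  exact MeasurableSet.iInter fun k => (isClosed_le ((hc i).comp (continuous_sub_right x))
    ((hc k).comp (continuous_sub_right x))).measurableSet

lemma sum_measure_translate_coneFace (hbary : ∑ i, a i = 0)
    (hLz : ∀ z, ∑ k, L k z • a k = z)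
    (hLa : ∀ j k, L j (a k) = (if j = k then 1 else 0) - 1 / ((d : ℝ) + 1))
    {μ : Measure (EuclideanSpace ℝ (Fin d))}
    (hac : μ ≪ (volume : Measure (EuclideanSpace ℝ (Fin d)))) (x : EuclideanSpace ℝ (Fin d)) :
    ∑ ν, μ ((x + ·) '' coneFace a ν) = μ Set.univ := by
  have hmem := mem_translate_coneFace_iff hbary hLz hLa
  rw [← measure_biUnion_finset₀]
  · congr 1
    refine Set.eq_univ_of_forall fun y => ?_
    obtain ⟨i, hi⟩ := Finite.exists_min fun k => L k (y - x)
    exact Set.mem_biUnion (Finset.mem_coe.2 (Finset.mem_univ i)) ((hmem i x y).2 hi)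
  · intro i _ j _ hij
    refine measure_mono_null (fun y hy => ?_) (ae_iff.1 (ae_simplexCoord_ne hLa hac hij x))
    exact not_not.2 (le_antisymm ((hmem i x y).1 hy.1 j) ((hmem j x y).1 hy.2 i))
  · exact fun i _ => (measurableSet_translate_coneFace hbary hLz hLa i x).nullMeasurableSet

lemma continuous_measure_translate_coneFace (hbary : ∑ i, a i = 0)
    (hLz : ∀ z, ∑ k, L k z • a k = z)
    (hLa : ∀ j k, L j (a k) = (if j = k then 1 else 0) - 1 / ((d : ℝ) + 1))
    {μ : Measure (EuclideanSpace ℝ (Fin d))} [IsFiniteMeasure μ]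
    (hac : μ ≪ (volume : Measure (EuclideanSpace ℝ (Fin d)))) (ν : Fin (d + 1)) :
    Continuous fun x : EuclideanSpace ℝ (Fin d) => μ.real ((x + ·) '' coneFace a ν) := by
  have hc : ∀ k, Continuous (L k) := fun k => (L k).continuous_of_finiteDimensional
  rw [continuous_iff_continuousAt]
  intro x
  refine (ENNReal.continuousAt_toReal (measure_ne_top _ _)).tendsto.comp ?_
  refine tendsto_measure_of_ae_tendsto_indicator_of_isFiniteMeasure _
    (measurableSet_translate_coneFace hbary hLz hLa ν x)
    (fun x => measurableSet_translate_coneFace hbary hLz hLa ν x) ?_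
  have h1 : ∀ᵐ y ∂μ, ∀ k, ν ≠ k → L ν (y - x) ≠ L k (y - x) :=
    ae_all_iff.2 fun k => by
      by_cases h : ν = k
      · exact Filter.Eventually.of_forall fun y hn => absurd h hn
      · filter_upwards [ae_simplexCoord_ne hLa hac h x] with y hy _ using hy
  filter_upwards [h1] with y hy
  have h2 : ∀ᶠ x' in nhds x, ∀ k, (L ν (y - x') ≤ L k (y - x') ↔ L ν (y - x) ≤ L k (y - x)) := by
    refine Filter.eventually_all.2 fun k => ?_
    by_cases hk : ν = k
    · subst hk
      simp
    have hck : ∀ k, ContinuousAt (fun x' => L k (y - x')) x := fun k =>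
      ((hc k).comp (continuous_sub_left y)).continuousAt
    rcases lt_or_gt_of_ne (hy k hk) with h | h
    · filter_upwards [(hck ν).eventually_lt (hck k) h] with x' hx'
      exact iff_of_true hx'.le h.le
    · filter_upwards [(hck k).eventually_lt (hck ν) h] with x' hx'
      exact iff_of_false hx'.not_ge h.not_ge
  filter_upwards [h2] with x' hx'
  rw [mem_translate_coneFace_iff hbary hLz hLa, mem_translate_coneFace_iff hbary hLz hLa]
  exact forall_congr' hx'

/-- If `x` is far out on the facet opposite to the vertex `ν`, then its translated cone over that
facet misses a given compact set. -/
lemma measure_translate_coneFace_eq_zero (hbary : ∑ i, a i = 0)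
    (hLz : ∀ z, ∑ k, L k z • a k = z)
    (hLa : ∀ j k, L j (a k) = (if j = k then 1 else 0) - 1 / ((d : ℝ) + 1))
    {μ : Measure (EuclideanSpace ℝ (Fin d))} {S : Set (EuclideanSpace ℝ (Fin d))}
    (hS : μ Sᶜ = 0) {B : ℝ} (hB : ∀ k, ∀ y ∈ S, |L k y| ≤ B) {t : Fin (d + 1) → ℝ}
    (ht : t ∈ stdSimplex ℝ (Fin (d + 1))) {ν : Fin (d + 1)} (hν : t ν = 0) {R : ℝ}
    (hR0 : 0 ≤ R) (hR : ((d : ℝ) + 1) * (2 * B) < R) :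
    μ ((R • ∑ k, t k • a k + ·) '' coneFace a ν) = 0 := by
  refine measure_mono_null (fun y hy => ?_) hS
  intro hyS
  rw [mem_translate_coneFace_iff hbary hLz hLa] at hy
  obtain ⟨k, hk⟩ : ∃ k, 1 ≤ ((d : ℝ) + 1) * t k := by
    by_contra! h
    have h1 : ∑ k, ((d : ℝ) + 1) * t k < ∑ _k : Fin (d + 1), (1 : ℝ) :=
      Finset.sum_lt_sum_of_nonempty Finset.univ_nonempty fun k _ => h k
    rw [← Finset.mul_sum, ht.2] at h1
    simp at h1
  have h1 : ∀ j, L j (R • ∑ k, t k • a k) = R * (t j - 1 / ((d : ℝ) + 1)) := by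
    intro j
    have h2 : ∑ k, t k * ((d : ℝ) + 1)⁻¹ = ((d : ℝ) + 1)⁻¹ := by
      rw [← Finset.sum_mul, ht.2, one_mul]
    simp [map_sum, hLa, mul_sub, Finset.sum_sub_distrib, h2]
  have h2 := hy k
  rw [map_sub, map_sub, h1, h1, hν] at h2
  have h3 := abs_le.1 (hB k y hyS)
  have h4 := abs_le.1 (hB ν y hyS)
  have h5 : R * t k ≤ 2 * B := by linarith
  have h6 : R * 1 ≤ R * (((d : ℝ) + 1) * t k) := mul_le_mul_of_nonneg_left hk hR0
  have h7 : ((d : ℝ) + 1) * (R * t k) ≤ ((d : ℝ) + 1) * (2 * B) :=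
    mul_le_mul_of_nonneg_left h5 (by positivity)
  linarith

end FaceFan

/-- **Fair division by translated face fans.** For `q = p^k` a prime power,
`d = n (q - 1)`, a non-degenerate simplex `Δ ⊂ ℝ^d` with barycenter at the origin,
and compactly supported continuous mass distributions `μ 1, …, μ n`, there is a
translate `x + F_Δ` of the face fan of `Δ` and an allocation
`θ : {0,…,d} → {1,…,q}` so that every color class gets exactly `1/q` of each measure. -/
theorem fair_division_translated_face_fan
    (p k n : ℕ) (hp : p.Prime) (hk : 0 < k) (hn : 1 ≤ n)
    (q : ℕ) (hq : q = p ^ k) (d : ℕ) (hd : d = n * (q - 1))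
    (a : Fin (d + 1) → EuclideanSpace ℝ (Fin d))
    (hnondeg : LinearIndependent ℝ (fun i : Fin d => a i.succ - a 0))
    (hbary : ∑ i, a i = 0)
    (μ : Fin n → Measure (EuclideanSpace ℝ (Fin d)))
    (hfin : ∀ i, IsFiniteMeasure (μ i))
    (hac : ∀ i, μ i ≪ (volume : Measure (EuclideanSpace ℝ (Fin d))))
    (hsupp : ∀ i, ∃ K : Set (EuclideanSpace ℝ (Fin d)), IsCompact K ∧ μ i Kᶜ = 0) :
    ∃ (x : EuclideanSpace ℝ (Fin d)) (θ : Fin (d + 1) → Fin q),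
      ∀ (i : Fin n) (j : Fin q),
        ∑ ν ∈ Finset.univ.filter (fun ν => θ ν = j),
            μ i ((x + ·) '' coneFace a ν) = μ i Set.univ / q := by
  classical
  have : Fact p.Prime := ⟨hp⟩
  have : ∀ i, IsFiniteMeasure (μ i) := hfin
  have hq0 : q ≠ 0 := hq ▸ pow_ne_zero _ hp.ne_zero
  let : Fintype (GaloisField p k) := Fintype.ofFinite _
  have hcard : Fintype.card (GaloisField p k) = q := by
    rw [← Nat.card_eq_fintype_card, GaloisField.card p k hk.ne', hq]
  obtain ⟨L, hLz, hLa⟩ := exists_simplexCoord hnondeg hbary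
  choose S hS hμS using hsupp
  have hbdd : ∀ v : Fin n × Fin (d + 1), ∃ B : ℝ, ∀ y ∈ S v.1, |L v.2 y| ≤ B := by
    rintro ⟨i, j⟩
    obtain ⟨B, hB⟩ := (hS i).exists_bound_of_continuousOn
      (L j).continuous_of_finiteDimensional.continuousOn
    exact ⟨B, hB⟩
  choose C hC using hbdd
  obtain ⟨B, hB⟩ := Finite.exists_le C
  obtain ⟨R, hR⟩ := exists_gt (max 0 (((d : ℝ) + 1) * (2 * B)))
  obtain ⟨t, θ, hθ⟩ := exists_splitExcess_eq_zero (K := GaloisField p k) (p := p)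
    (by rw [hcard, hd] : d = n * (Fintype.card (GaloisField p k) - 1))
    (fun i ν t => (μ i).real ((R • ∑ k, t k • a k + ·) '' coneFace a ν))
    (fun i ν => (continuous_measure_translate_coneFace hbary hLz hLa (hac i) ν).comp
      (by fun_prop))
    (fun i ν t ht hν => by
      rw [measureReal_def, measure_translate_coneFace_eq_zero hbary hLz hLa (hμS i)
        (fun k y hy => (hC (i, k) y hy).trans (hB _)) ht hν ((le_max_left _ _).trans hR.le)
        ((le_max_right _ _).trans_lt hR), ENNReal.toReal_zero])
  let e : GaloisField p k ≃ Fin q := Fintype.equivFinOfCardEq hcard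
  refine ⟨R • ∑ k, t k • a k, fun ν => e (θ ν), fun i j => ?_⟩
  have h1 := hθ i (e.symm j)
  simp only [splitExcess, hcard, measureReal_def] at h1
  rw [← ENNReal.toReal_sum (fun _ _ => measure_ne_top _ _),
    ← ENNReal.toReal_sum (fun _ _ => measure_ne_top _ _),
    sum_measure_translate_coneFace hbary hLz hLa (hac i)] at h1
  simp only [← Equiv.eq_symm_apply e]
  have hq1 : (q : ENNReal) ≠ 0 := by exact_mod_cast hq0
  rw [← ENNReal.toReal_eq_toReal_iff' (ENNReal.sum_ne_top.2 fun _ _ => measure_ne_top _ _)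
    (ENNReal.div_ne_top (measure_ne_top _ _) hq1), ENNReal.toReal_div, ENNReal.toReal_natCast,
    eq_div_iff (by exact_mod_cast hq0), mul_comm]
  exact sub_eq_zero.1 h1
end
end

section
/- Fair division by moving-apex cones: Let q = p^k be a power of a prime p ≥ 2, let n ≥ 1, and set d = n(q−1). Let Δ = conv{a_0,…,a_d} ⊂ ℝ^d be a non-degenerate simplex, and let μ_1,…,μ_n be continuous mass distributions on ℝ^d whose supports are contained in Δ. Then there exist a point x ∈ Δ and an allocation function θ : {0,…,d} → {1,…,q} such that for every i ∈ {1,…,n} and every j ∈ {1,…,q}, Σ_{ν : θ(ν)=j} μ_i(cone(x, F_ν)) = (1/q)·μ_i(ℝ^d), where cone(x, F_ν) = {x + t(y − x) : t ≥ 0, y ∈ F_ν} is the cone with apex x generated by the facet F_ν. -/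
open MeasureTheory

noncomputable section

/-- The cone with apex `x` generated by the set `F`:
`cone(x, F) = {x + t (y - x) : t ≥ 0, y ∈ F}`. -/
def coneApex {d : ℕ} (x : EuclideanSpace ℝ (Fin d)) (F : Set (EuclideanSpace ℝ (Fin d))) :
    Set (EuclideanSpace ℝ (Fin d)) :=
  {z | ∃ t : ℝ, 0 ≤ t ∧ ∃ y ∈ F, z = x + t • (y - x)}

/-- The facet `F i = conv {a j : j ≠ i}` of the simplex with vertex set `a`,
opposite the vertex `a i`. -/
def facet {d : ℕ} (a : Fin (d + 1) → EuclideanSpace ℝ (Fin d)) (i : Fin (d + 1)) :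
    Set (EuclideanSpace ℝ (Fin d)) :=
  convexHull ℝ (a '' {j | j ≠ i})

namespace FairDivision

/-! ### Ordered chains

Chains are finitely supported functions on lists of points; the empty list spans the augmentation
degree. -/

section Chains

variable {E F : Type*} [CommRing F]

/-- Put the vertex `v` in front of every list of a chain. -/
def cone (v : E) : (List E →₀ F) →ₗ[F] (List E →₀ F) :=
  Finsupp.lmapDomain F F (List.cons v)

/-- The boundary of an ordered simplex. -/
def bdList (F : Type*) [CommRing F] : List E → (List E →₀ F)
  | [] => 0
  | v :: l => Finsupp.single l 1 - cone v (bdList F l)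

/-- The boundary of a chain. -/
def bd : (List E →₀ F) →ₗ[F] (List E →₀ F) :=
  Finsupp.linearCombination F (bdList F)

/-- The value of a cochain on a chain. -/
def ev (φ : List E → F) : (List E →₀ F) →ₗ[F] F :=
  Finsupp.linearCombination F φ

@[simp] lemma cone_single (v : E) (l : List E) (r : F) :
    cone v (Finsupp.single l r) = Finsupp.single (v :: l) r := by
  simp [cone]

@[simp] lemma bd_single (l : List E) : bd (Finsupp.single l (1 : F)) = bdList F l := by
  simp [bd]

@[simp] lemma ev_single (φ : List E → F) (l : List E) (r : F) :
    ev φ (Finsupp.single l r) = r * φ l := by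
  simp [ev]

lemma bd_cone (v : E) (c : List E →₀ F) : bd (cone v c) = c - cone v (bd c) := by
  have : bd ∘ₗ cone v = LinearMap.id - cone v ∘ₗ (bd : (List E →₀ F) →ₗ[F] _) := by
    ext l : 2
    simp [bdList]
  exact LinearMap.congr_fun this c

lemma bd_bdList (l : List E) : bd (bdList F l) = 0 := by
  induction l with
  | nil => simp [bdList]
  | cons v l ih => simp [bdList, bd_cone, ih]

/-- The chains all of whose simplices satisfy `P`. -/
abbrev chainsIn (F : Type*) [CommRing F] (P : List E → Prop) : Submodule F (List E →₀ F) :=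
  Finsupp.supported F F {l | P l}

lemma map_mem_of_single {M : Type*} [AddCommGroup M] [Module F M] {P : List E → Prop}
    (f : (List E →₀ F) →ₗ[F] M) (K : Submodule F M)
    (h : ∀ l, P l → f (Finsupp.single l 1) ∈ K) {c : List E →₀ F} (hc : c ∈ chainsIn F P) :
    f c ∈ K := by
  rw [chainsIn, Finsupp.supported_eq_span_single] at hc
  have : Submodule.span F ((fun i => Finsupp.single i (1 : F)) '' {l | P l}) ≤ K.comap f := by
    rw [Submodule.span_le]
    rintro _ ⟨l, hl, rfl⟩
    exact h l hl
  exact this hc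

lemma eq_of_single {M : Type*} [AddCommGroup M] [Module F M] {P : List E → Prop}
    (f g : (List E →₀ F) →ₗ[F] M)
    (h : ∀ l, P l → f (Finsupp.single l 1) = g (Finsupp.single l 1))
    {c : List E →₀ F} (hc : c ∈ chainsIn F P) : f c = g c := by
  have := map_mem_of_single (f - g) ⊥ (P := P) (fun l hl => by simp [h l hl]) hc
  simpa [sub_eq_zero] using this

lemma single_mem_chainsIn {P : List E → Prop} {l : List E} (h : P l) (r : F) :
    Finsupp.single l r ∈ chainsIn F P :=
  Finsupp.single_mem_supported F r h

lemma chainsIn_mono {P Q : List E → Prop} (h : ∀ l, P l → Q l) : chainsIn F P ≤ chainsIn F Q :=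
  Finsupp.supported_mono h

lemma cone_mem_chainsIn {P Q : List E → Prop} (v : E) (h : ∀ l, P l → Q (v :: l))
    {c : List E →₀ F} (hc : c ∈ chainsIn F P) : cone v c ∈ chainsIn F Q :=
  map_mem_of_single _ _ (fun l hl => by simpa using single_mem_chainsIn (h l hl) 1) hc

/-- Faces of a simplex arise by erasing one vertex. -/
lemma bdList_mem_chainsIn (l : List E) :
    bdList F l ∈ chainsIn F (fun l' => l'.length + 1 = l.length ∧ l'.Sublist l) := by
  induction l with
  | nil => simp [bdList]
  | cons v l ih =>
    refine Submodule.sub_mem _ (single_mem_chainsIn (by simp) 1) (cone_mem_chainsIn v ?_ ih)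
    rintro l' ⟨h1, h2⟩
    exact ⟨by simp [h1], h2.cons_cons v⟩

end Chains

/-! ### Barycentric subdivision -/

section Subdivision

variable {E F : Type*} [CommRing F] [NormedAddCommGroup E] [NormedSpace ℝ E]

/-- The barycenter of the vertices of a simplex. -/
def bary (l : List E) : E := (l.length : ℝ)⁻¹ • l.sum

/-- Barycentric subdivision of chains consisting of lists of length `m`. -/
def sd (F : Type*) [CommRing F] : ℕ → ((List E →₀ F) →ₗ[F] (List E →₀ F))
  | 0 => LinearMap.id
  | m + 1 => Finsupp.linearCombination F (fun l => cone (bary l) (sd F m (bdList F l)))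

@[simp] lemma sd_succ_single (m : ℕ) (l : List E) :
    sd F (m + 1) (Finsupp.single l 1) = cone (bary l) (sd F m (bdList F l)) := by
  simp [sd]

lemma bd_sd (m : ℕ) (c : List E →₀ F) : bd (sd F (m + 1) c) = sd F m (bd c) := by
  have key : bd ∘ₗ sd F (m + 1) = sd F m ∘ₗ (bd : (List E →₀ F) →ₗ[F] _) := by
    induction m with
    | zero =>
      ext l : 2
      simp [bd_cone, sd, bd_bdList]
    | succ m ih =>
      ext l : 2
      have := LinearMap.congr_fun ih (bdList F l)
      simp only [LinearMap.comp_apply, bd_bdList, map_zero] at this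
      simp [bd_cone, this]
  exact LinearMap.congr_fun key c

lemma bd_sd_pow (N m : ℕ) (c : List E →₀ F) :
    bd ((sd F (m + 1) ^ N) c) = (sd F m ^ N) (bd c) := by
  induction N generalizing c with
  | zero => simp
  | succ N ih => rw [pow_succ', pow_succ', Module.End.mul_apply, Module.End.mul_apply, bd_sd, ih]

lemma bary_mem {S : Set E} (hS : Convex ℝ S) {l : List E} (hl : l ≠ []) (h : ∀ v ∈ l, v ∈ S) :
    bary l ∈ S := by
  have hpos : (0 : ℝ) < l.length := by
    exact_mod_cast List.length_pos_iff.2 hl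
  have : bary l = ∑ i : Fin l.length, (l.length : ℝ)⁻¹ • l[i] := by
    rw [← Finset.smul_sum, bary, show ∑ j : Fin l.length, l[j] = l.sum from Fin.sum_univ_getElem l]
  rw [this]
  refine hS.sum_mem (fun _ _ => by positivity) ?_ fun i _ => h _ (by simp)
  simp [hpos.ne']

lemma sd_mem (m : ℕ) {S : Set E} (hS : Convex ℝ S) {c : List E →₀ F}
    (hc : c ∈ chainsIn F (fun l => l.length = m ∧ ∀ v ∈ l, v ∈ S)) :
    sd F m c ∈ chainsIn F (fun l => l.length = m ∧ ∀ v ∈ l, v ∈ S) := by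
  induction m generalizing c with
  | zero => simpa [sd] using hc
  | succ m ih =>
    refine map_mem_of_single _ _ (fun l hl => ?_) hc
    rw [sd_succ_single]
    have hl0 : l ≠ [] := by rintro rfl; simp at hl
    refine cone_mem_chainsIn _ ?_ (ih (chainsIn_mono ?_ (bdList_mem_chainsIn l)))
    · rintro l' ⟨h1, h2⟩
      refine ⟨by simp [h1], ?_⟩
      simpa using ⟨bary_mem hS hl0 hl.2, h2⟩
    · rintro l' ⟨h1, h2⟩
      exact ⟨by omega, fun v hv => hl.2 v (h2.subset hv)⟩

lemma sd_pow_mem (N m : ℕ) {S : Set E} (hS : Convex ℝ S) {c : List E →₀ F}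
    (hc : c ∈ chainsIn F (fun l => l.length = m ∧ ∀ v ∈ l, v ∈ S)) :
    (sd F m ^ N) c ∈ chainsIn F (fun l => l.length = m ∧ ∀ v ∈ l, v ∈ S) := by
  induction N with
  | zero => simpa using hc
  | succ N ih => rw [pow_succ', Module.End.mul_apply]; exact sd_mem m hS ih

lemma dist_bary_le {l : List E} {D : ℝ} (h : ∀ v ∈ l, ∀ w ∈ l, dist v w ≤ D)
    {v : E} (hv : v ∈ l) : dist v (bary l) ≤ ((l.length : ℝ) - 1) / l.length * D := by
  have hpos : (0 : ℝ) < l.length := by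
    exact_mod_cast List.length_pos_iff.2 (List.ne_nil_of_mem hv)
  obtain ⟨i, hi, rfl⟩ := List.getElem_of_mem hv
  have e : l[i] - bary l = (l.length : ℝ)⁻¹ • ∑ j : Fin l.length, (l[i] - l[j]) := by
    rw [Finset.sum_sub_distrib, bary, smul_sub,
      show ∑ j : Fin l.length, l[j] = l.sum from Fin.sum_univ_getElem l]
    simp [← Nat.cast_smul_eq_nsmul ℝ, smul_smul, hpos.ne']
  rw [dist_eq_norm, e, norm_smul, norm_inv, Real.norm_natCast, div_mul_eq_mul_div, inv_mul_eq_div]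
  gcongr
  calc ‖∑ j : Fin l.length, (l[i] - l[j])‖
      = ‖∑ j ∈ Finset.univ.erase (⟨i, hi⟩ : Fin l.length), (l[i] - l[j])‖ := by
        rw [Finset.sum_erase]; simp
    _ ≤ ∑ j ∈ Finset.univ.erase (⟨i, hi⟩ : Fin l.length), D := by
        refine norm_sum_le_of_le _ fun j _ => ?_
        rw [← dist_eq_norm]
        exact h _ (by simp) _ (by simp)
    _ = ((l.length : ℝ) - 1) * D := by
        rw [Finset.sum_const, Finset.card_erase_of_mem (Finset.mem_univ _), nsmul_eq_mul]
        rw [Finset.card_univ, Fintype.card_fin, Nat.cast_sub (by omega)]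
        simp

lemma sd_mesh (d m : ℕ) (hm : m ≤ d + 1) {D : ℝ} {c : List E →₀ F}
    (hc : c ∈ chainsIn F (fun l => l.length = m ∧ ∀ v ∈ l, ∀ w ∈ l, dist v w ≤ D)) :
    sd F m c ∈ chainsIn F (fun l => l.length = m ∧
      ∀ v ∈ l, ∀ w ∈ l, dist v w ≤ (d : ℝ) / (d + 1) * D) := by
  induction m generalizing c with
  | zero =>
    refine map_mem_of_single _ _ (fun l hl => ?_) hc
    obtain rfl : l = [] := List.length_eq_zero_iff.1 hl.1
    exact single_mem_chainsIn (by simp) 1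
  | succ m ih =>
    refine map_mem_of_single _ _ (fun l hl => ?_) hc
    rw [sd_succ_single]
    have hl0 : l ≠ [] := by rintro rfl; simp at hl
    have hD : 0 ≤ D := by
      obtain ⟨v, hv⟩ := List.exists_mem_of_ne_nil l hl0
      simpa using hl.2 v hv v hv
    have hratio : ((l.length : ℝ) - 1) / l.length * D ≤ (d : ℝ) / (d + 1) * D := by
      refine mul_le_mul_of_nonneg_right ?_ hD
      rw [hl.1]
      push_cast
      have : (m : ℝ) ≤ d := by exact_mod_cast (by omega : m ≤ d)
      rw [div_le_div_iff₀ (by positivity) (by positivity)]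
      nlinarith
    have h1 := ih (by omega) (chainsIn_mono (F := F)
      (Q := fun l' => l'.length = m ∧ ∀ v ∈ l', ∀ w ∈ l', dist v w ≤ D)
      (fun l' h => ⟨by omega, fun v hv w hw => hl.2 v (h.2.subset hv) w (h.2.subset hw)⟩)
      (bdList_mem_chainsIn l))
    have h2 := sd_mem m (convex_convexHull ℝ {v | v ∈ l}) (chainsIn_mono (F := F)
      (Q := fun l' => l'.length = m ∧ ∀ v ∈ l', v ∈ convexHull ℝ {v | v ∈ l})
      (fun l' h => ⟨by omega, fun v hv => subset_convexHull ℝ _ (h.2.subset hv)⟩)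
      (bdList_mem_chainsIn l))
    have h12 : sd F m (bdList F l) ∈ chainsIn F (fun l' =>
        (l'.length = m ∧ ∀ v ∈ l', ∀ w ∈ l', dist v w ≤ (d : ℝ) / (d + 1) * D) ∧
        (l'.length = m ∧ ∀ v ∈ l', v ∈ convexHull ℝ {v | v ∈ l})) :=
      fun x hx => ⟨h1 hx, h2 hx⟩
    have hball : convexHull ℝ {v | v ∈ l} ⊆
        Metric.closedBall (bary l) ((d : ℝ) / (d + 1) * D) :=
      convexHull_min (fun v hv => (dist_bary_le hl.2 hv).trans hratio) (convex_closedBall _ _)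
    refine cone_mem_chainsIn _ ?_ h12
    rintro l' ⟨⟨h3, h4⟩, -, h5⟩
    refine ⟨by simp [h3], ?_⟩
    intro v hv w hw
    rcases List.mem_cons.1 hv with rfl | hv <;> rcases List.mem_cons.1 hw with rfl | hw
    · rw [dist_self]; positivity
    · rw [dist_comm]; exact hball (h5 w hw)
    · exact hball (h5 v hv)
    · exact h4 v hv w hw

lemma sd_pow_mesh (d N : ℕ) {D : ℝ} {c : List E →₀ F}
    (hc : c ∈ chainsIn F (fun l => l.length = d + 1 ∧ ∀ v ∈ l, ∀ w ∈ l, dist v w ≤ D)) :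
    (sd F (d + 1) ^ N) c ∈ chainsIn F (fun l => l.length = d + 1 ∧
      ∀ v ∈ l, ∀ w ∈ l, dist v w ≤ ((d : ℝ) / (d + 1)) ^ N * D) := by
  induction N with
  | zero => simpa using hc
  | succ N ih =>
    rw [pow_succ' (sd F (d + 1)), Module.End.mul_apply]
    refine chainsIn_mono ?_ (sd_mesh d (d + 1) le_rfl ih)
    intro l hl
    rwa [pow_succ', mul_assoc]

end Subdivision

/-! ### Weighted sums over colorings -/

section Colorings

variable {G F : Type*} [AddCommGroup G] [Fintype G] [CommRing F]

/-- Translate the colors of `0, …, m` by `u`, and give color `0` to all other indices. -/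
def shift (m : ℕ) (u : G) (g : ℕ → G) : ℕ → G := fun i => if i ≤ m then g i + u else 0

/-- The sum over all colorings `g` of `0, …, m` with `g m = 0`, where `g` is weighted by the
product of the `w i (g i - g (i + 1))`. -/
def colorSum (w : ℕ → G → F) : ℕ → (((ℕ → G) → F) →ₗ[F] F)
  | 0 => LinearMap.proj 0
  | m + 1 => ∑ u, w m u • (colorSum w m ∘ₗ LinearMap.funLeft F F (shift m u))

lemma colorSum_succ (w : ℕ → G → F) (m : ℕ) (f : (ℕ → G) → F) :
    colorSum w (m + 1) f = ∑ u, w m u * colorSum w m (fun g => f (shift m u g)) := by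
  simp [colorSum, LinearMap.sum_apply]
  rfl

lemma colorSum_eq_zero (w : ℕ → G → F) (hw0 : ∑ u, w 0 u = 0)
    (hw : ∀ m s, ∑ u, w (m + 1) u * w m (s - u) = 0) (m i : ℕ) (hi : i ≤ m)
    (f : (ℕ → G) → F) (hf : ∀ g g' : ℕ → G, (∀ j, j ≠ i → g j = g' j) → f g = f g') :
    colorSum w (m + 1) f = 0 := by
  induction m generalizing f with
  | zero =>
    obtain rfl : i = 0 := by omega
    rw [colorSum_succ]
    have : ∀ u, colorSum w 0 (fun g => f (shift 0 u g)) = f 0 := fun u => by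
      change f (shift 0 u 0) = f 0
      refine hf _ _ fun j hj => ?_
      simp [shift, hj]
    simp [this, ← Finset.sum_mul, hw0]
  | succ m ih =>
    rw [colorSum_succ]
    rcases Nat.lt_or_ge i (m + 1) with him | him
    · refine Finset.sum_eq_zero fun u _ => ?_
      rw [ih (by omega), mul_zero]
      intro g g' h
      refine hf _ _ fun j hj => ?_
      simp [shift, h j hj]
    · obtain rfl : i = m + 1 := by omega
      have : ∀ u u', colorSum w m (fun g => f (shift (m + 1) u (shift m u' g))) =
          colorSum w m (fun g => f (shift m (u + u') g)) := fun u u' => by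
        congr 1
        funext g
        refine hf _ _ fun j hj => ?_
        rcases Nat.lt_or_ge m j with h | h
        · simp [shift, show ¬ j ≤ m + 1 by omega, show ¬ j ≤ m by omega]
        · simp [shift, h, show j ≤ m + 1 by omega, add_assoc, add_comm u u']
      simp_rw [colorSum_succ, this, Finset.mul_sum]
      have h2 : ∀ u, ∑ u', w (m + 1) u * (w m u' * colorSum w m (fun g => f (shift m (u + u') g)))
          = ∑ s, w (m + 1) u * w m (s - u) * colorSum w m (fun g => f (shift m s g)) := fun u => by
        rw [← Equiv.sum_comp (Equiv.addLeft u)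
          (fun s => w (m + 1) u * w m (s - u) * colorSum w m (fun g => f (shift m s g)))]
        simp [mul_assoc]
      simp_rw [h2]
      rw [Finset.sum_comm]
      simp_rw [← Finset.sum_mul, hw]
      simp

end Colorings

/-! ### Colored simplices -/

section Colored

variable {G F : Type*} [AddCommGroup G] [Fintype G] [CommRing F] {d : ℕ}

/-- The vertices of the standard simplex. -/
def vert (d i : ℕ) : Fin (d + 1) → ℝ := Pi.single (Fin.ofNat (d + 1) i) 1

lemma vert_mem (d i : ℕ) : vert d i ∈ stdSimplex ℝ (Fin (d + 1)) :=
  single_mem_stdSimplex ℝ _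

lemma vert_eq_zero {i : ℕ} (hi : i ≤ d) {j : Fin (d + 1)} (h : (j : ℕ) ≠ i) :
    vert d i j = 0 := by
  refine Pi.single_eq_of_ne ?_ _
  rintro rfl
  exact h (by simp [Nat.mod_eq_of_lt (show i < d + 1 by omega)])

/-- The face of the standard simplex with vertices `m, …, 0`, in this order. -/
def face (d : ℕ) : ℕ → List (Fin (d + 1) → ℝ)
  | 0 => [vert d 0]
  | m + 1 => vert d (m + 1) :: face d m

lemma face_eq (d m : ℕ) : face d m = (List.range (m + 1)).reverse.map (vert d) := by
  induction m with
  | zero => rfl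
  | succ m ih => rw [face, ih, List.range_succ (n := m + 1)]; simp

/-- The iterated subdivision of a face of the standard simplex. -/
def sdFace (F : Type*) [CommRing F] (d N m : ℕ) : List (Fin (d + 1) → ℝ) →₀ F :=
  (sd F (m + 1) ^ N) (Finsupp.single (face d m) 1)

lemma length_face (d m : ℕ) : (face d m).length = m + 1 := by simp [face_eq]

lemma mem_face {m : ℕ} {v : Fin (d + 1) → ℝ} : v ∈ face d m ↔ ∃ i ≤ m, vert d i = v := by
  simp [face_eq]

lemma convex_eq_zero (I : Fin (d + 1) → Prop) :
    Convex ℝ (stdSimplex ℝ (Fin (d + 1)) ∩ {v | ∀ j, I j → v j = 0}) := by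
  refine (convex_stdSimplex ℝ _).inter ?_
  intro x hx y hy a b _ _ _ j hj
  simp [hx j hj, hy j hj]

lemma sdFace_mem (N : ℕ) {m : ℕ} (hm : m ≤ d) :
    sdFace F d N m ∈ chainsIn F (fun l => l.length = m + 1 ∧
      ∀ v ∈ l, v ∈ stdSimplex ℝ (Fin (d + 1)) ∩ {v | ∀ j : Fin (d + 1), m < j → v j = 0}) := by
  refine sd_pow_mem N (m + 1) (convex_eq_zero (fun j : Fin (d + 1) => m < j))
    (single_mem_chainsIn ⟨length_face d m, ?_⟩ 1)
  intro v hv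
  obtain ⟨i, hi, rfl⟩ := mem_face.1 hv
  exact ⟨vert_mem d i, fun j hj => vert_eq_zero (by omega) (by omega)⟩

/-- A family of cochains indexed by colorings is local if its value on a simplex of the standard
simplex depends only on the colors of the indices in the supports of the vertices. -/
def IsLocal (φ : (ℕ → G) → List (Fin (d + 1) → ℝ) → F) : Prop :=
  ∀ g g' l, (∀ v ∈ l, v ∈ stdSimplex ℝ (Fin (d + 1))) →
    (∀ v ∈ l, ∀ i : Fin (d + 1), v i ≠ 0 → g i = g' i) → φ g l = φ g' l

lemma colorSum_bd_sdFace (w : ℕ → G → F) (hw0 : ∑ u, w 0 u = 0)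
    (hw : ∀ m s, ∑ u, w (m + 1) u * w m (s - u) = 0)
    {ψ : (ℕ → G) → List (Fin (d + 1) → ℝ) → F} (hψ : IsLocal ψ) (N : ℕ) {m : ℕ} (hm : m < d) :
    colorSum w (m + 1) (fun g => ev (ψ g) (bd (sdFace F d N (m + 1)))) =
      ∑ u, w m u * colorSum w m (fun g => ev (ψ (fun i => g i + u)) (sdFace F d N m)) := by
  have hbd : bd (sdFace F d N (m + 1)) = sdFace F d N m -
      (sd F (m + 1) ^ N) (cone (vert d (m + 1)) (bdList F (face d m))) := by
    rw [sdFace, bd_sd_pow, bd_single, face, bdList, map_sub]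
    rfl
  let Φ : (List (Fin (d + 1) → ℝ) →₀ F) →ₗ[F] ((ℕ → G) → F) := LinearMap.pi fun g => ev (ψ g)
  have hside : (colorSum w (m + 1) ∘ₗ Φ ∘ₗ (sd F (m + 1) ^ N))
      (cone (vert d (m + 1)) (bdList F (face d m))) = 0 := by
    have hmem : cone (vert d (m + 1)) (bdList F (face d m)) ∈ chainsIn F (fun l =>
        l.length = m + 1 ∧ ∃ i ≤ m, ∀ v ∈ l,
          v ∈ stdSimplex ℝ (Fin (d + 1)) ∩ {v | ∀ j : Fin (d + 1), (j : ℕ) = i → v j = 0}) := by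
      refine cone_mem_chainsIn _ ?_ (bdList_mem_chainsIn _)
      rintro l ⟨h1, h2⟩
      rw [length_face] at h1
      refine ⟨by simp [h1], ?_⟩
      rw [face_eq, List.sublist_map_iff] at h2
      obtain ⟨s, hs, rfl⟩ := h2
      have hnd : s.Nodup := hs.nodup (List.nodup_reverse.2 List.nodup_range)
      have : ∃ i ≤ m, i ∉ s := by
        by_contra! hcon
        have h3 : Finset.range (m + 1) ⊆ s.toFinset := fun i hi => by
          simpa using hcon i (by simpa [Nat.lt_succ_iff] using hi)
        have h4 := Finset.card_le_card h3
        have h5 := s.toFinset_card_le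
        simp at h4 h1
        omega
      obtain ⟨i, him, his⟩ := this
      refine ⟨i, him, ?_⟩
      intro v hv
      rcases List.mem_cons.1 hv with rfl | hv
      · exact ⟨vert_mem _ _, fun j hj => vert_eq_zero (by omega) (by omega)⟩
      · obtain ⟨k, hk, rfl⟩ := List.mem_map.1 hv
        have hk' : k ≤ m := by simpa [Nat.lt_succ_iff] using hs.subset hk
        refine ⟨vert_mem _ _, fun j hj => vert_eq_zero (by omega) ?_⟩
        rintro rfl
        exact his (hj ▸ hk)
    have := map_mem_of_single (colorSum w (m + 1) ∘ₗ Φ ∘ₗ (sd F (m + 1) ^ N)) ⊥ ?_ hmem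
    · simpa using this
    rintro l ⟨hl, i, hi, hli⟩
    have hl2 := sd_pow_mem (F := F) N (m + 1) (convex_eq_zero (fun j : Fin (d + 1) => (j : ℕ) = i))
      (single_mem_chainsIn ⟨hl, hli⟩ 1)
    rw [Submodule.mem_bot]
    refine colorSum_eq_zero w hw0 hw m i hi _ fun g g' hg => ?_
    refine eq_of_single (ev (ψ g)) (ev (ψ g')) ?_ hl2
    rintro l' ⟨-, hl'⟩
    simp only [ev_single, one_mul]
    refine hψ _ _ _ (fun v hv => (hl' v hv).1) fun v hv j hj => hg _ ?_
    intro hji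
    exact hj ((hl' v hv).2 j hji)
  have h1 : colorSum w (m + 1) (fun g => ev (ψ g) (bd (sdFace F d N (m + 1)))) =
      colorSum w (m + 1) (fun g => ev (ψ g) (sdFace F d N m)) := by
    change colorSum w (m + 1) (Φ _) = colorSum w (m + 1) (Φ _)
    rw [hbd, map_sub, map_sub]
    change _ - (colorSum w (m + 1) ∘ₗ Φ ∘ₗ (sd F (m + 1) ^ N)) _ = _
    rw [hside, sub_zero]
  rw [h1, colorSum_succ]
  refine Finset.sum_congr rfl fun u _ => ?_
  congr 2
  funext g
  refine eq_of_single (ev (ψ _)) (ev (ψ _)) ?_ (sdFace_mem N hm.le)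
  rintro l ⟨-, hl⟩
  simp only [ev_single, one_mul]
  refine hψ _ _ _ (fun v hv => (hl v hv).1) fun v hv j hj => ?_
  have : (j : ℕ) ≤ m := by
    by_contra h
    exact hj ((hl v hv).2 j (by omega))
  simp [shift, this]

end Colored

/-! ### Integer lifts of residues -/

section Carry

lemma valMinAbs_neg_of_odd {p : ℕ} (hp : Odd p) (a : ZMod p) : (-a).valMinAbs = -a.valMinAbs := by
  refine ZMod.valMinAbs_neg_of_ne_half ?_
  intro h
  obtain ⟨k, hk⟩ := hp
  omega

variable {p : ℕ} [NeZero p]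

/-- The carry in the addition of two residues. -/
def carry (a s : ZMod p) : ℤ := ((a.val : ℤ) + s.val - (a + s).val) / p

lemma mul_carry (a s : ZMod p) : p * carry a s = (a.val : ℤ) + s.val - (a + s).val := by
  refine Int.mul_ediv_cancel' ((ZMod.intCast_zmod_eq_zero_iff_dvd _ p).1 ?_)
  push_cast
  simp

lemma sum_carry (a : ZMod p) : ∑ s, carry a s = a.val := by
  have hp : (p : ℤ) ≠ 0 := by exact_mod_cast NeZero.ne p
  refine mul_left_cancel₀ hp ?_
  rw [Finset.mul_sum]
  simp_rw [mul_carry]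
  rw [Finset.sum_sub_distrib, Finset.sum_add_distrib,
    Equiv.sum_comp (Equiv.addLeft a) (fun s => (s.val : ℤ)) |>.symm]
  simp [ZMod.card]

/-- The failure of `ZMod.val` to agree, up to a coboundary, with the symmetric lift. -/
def lift₁ (a b : ZMod p) : ℤ := ((b - a).valMinAbs - ((b.val : ℤ) - a.val)) / p

lemma mul_lift₁ (a b : ZMod p) :
    p * lift₁ a b = (b - a).valMinAbs - ((b.val : ℤ) - a.val) := by
  refine Int.mul_ediv_cancel' ((ZMod.intCast_zmod_eq_zero_iff_dvd _ p).1 ?_)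
  push_cast
  simp

lemma lift₁_add (a b s : ZMod p) :
    lift₁ (a + s) (b + s) = lift₁ a b + carry b s - carry a s := by
  have hp : (p : ℤ) ≠ 0 := by exact_mod_cast NeZero.ne p
  refine mul_left_cancel₀ hp ?_
  rw [mul_sub, mul_add, mul_lift₁, mul_lift₁, mul_carry, mul_carry, add_sub_add_right_eq_sub]
  ring

/-- The translation invariant 2-cocycle of `ZMod p` given by the symmetric lift. -/
def euler (a b c : ZMod p) : ℤ := lift₁ b c - lift₁ a c + lift₁ a b

lemma mul_euler (a b c : ZMod p) :
    p * euler a b c = (c - b).valMinAbs - (c - a).valMinAbs + (b - a).valMinAbs := by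
  rw [euler, mul_add, mul_sub, mul_lift₁, mul_lift₁, mul_lift₁]
  ring

lemma euler_add (a b c s : ZMod p) : euler (a + s) (b + s) (c + s) = euler a b c := by
  simp only [euler, lift₁_add]
  ring

lemma euler_ne_zero (hp : Odd p) {a b c : ZMod p} (h : euler a b c ≠ 0) :
    a ≠ b ∧ b ≠ c ∧ a ≠ c := by
  have hp0 : (p : ℤ) ≠ 0 := by exact_mod_cast NeZero.ne p
  have h' : p * euler a b c ≠ 0 := mul_ne_zero hp0 h
  rw [mul_euler] at h'
  refine ⟨?_, ?_, ?_⟩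
  · rintro rfl
    simp at h'
  · rintro rfl
    simp at h'
  · rintro rfl
    rw [← neg_sub b a, valMinAbs_neg_of_odd hp] at h'
    simp at h'

end Carry

/-! ### Cup products with label cochains -/

section Cup

variable {G F : Type*} [AddCommGroup G] [Fintype G] [CommRing F] {d : ℕ}

/-- A family of cochains is invariant if it is unchanged by translations of the coloring. -/
def IsInv (φ : (ℕ → G) → List (Fin (d + 1) → ℝ) → F) : Prop :=
  ∀ g t l, (∀ v ∈ l, v ∈ stdSimplex ℝ (Fin (d + 1))) → φ (fun i => g i + t) l = φ g l

/-- The family consists of cocycles on simplices with `m + 1` vertices. -/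
def IsCocycle (m : ℕ) (φ : (ℕ → G) → List (Fin (d + 1) → ℝ) → F) : Prop :=
  ∀ g l, l.length = m + 2 → ev (φ g) (bdList F l) = 0

/-- Labels of colored points which only depend on the colors of the indices in the support. -/
def IsLocalLabel {X : Type*} (lab : (ℕ → G) → (Fin (d + 1) → ℝ) → X) : Prop :=
  ∀ g g' v, v ∈ stdSimplex ℝ (Fin (d + 1)) →
    (∀ i : Fin (d + 1), v i ≠ 0 → g i = g' i) → lab g v = lab g' v

/-- The cup product with a function of one vertex. -/
def cup₀ {E : Type*} (f : E → F) (ω : List E → F) : List E → F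
  | a :: l => f a * ω (a :: l)
  | _ => 0

/-- The cup product with a function of two vertices. -/
def cup₁ {E : Type*} (f : E → E → F) (ω : List E → F) : List E → F
  | a :: b :: l => f a b * ω (b :: l)
  | _ => 0

/-- The cup product with a function of three vertices. -/
def cup₂ {E : Type*} (f : E → E → E → F) (ω : List E → F) : List E → F
  | a :: b :: c :: l => f a b c * ω (c :: l)
  | _ => 0

variable {E : Type*}

lemma ev_cup₀_cone (f : E → F) (ω : List E → F) (a : E) (c : List E →₀ F) :
    ev (cup₀ f ω) (cone a c) = f a * ev ω (cone a c) := by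
  have : ev (cup₀ f ω) ∘ₗ cone a = f a • (ev ω ∘ₗ cone a) := by
    ext l : 2
    simp [cup₀]
  exact LinearMap.congr_fun this c

lemma ev_cup₁_cone (f : E → E → F) (ω : List E → F) (a b : E) (c : List E →₀ F) :
    ev (cup₁ f ω) (cone a (cone b c)) = f a b * ev ω (cone b c) := by
  have : ev (cup₁ f ω) ∘ₗ cone a ∘ₗ cone b = f a b • (ev ω ∘ₗ cone b) := by
    ext l : 2
    simp [cup₁]
  exact LinearMap.congr_fun this c

lemma ev_cup₂_cone (f : E → E → E → F) (ω : List E → F) (a b e : E) (c : List E →₀ F) :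
    ev (cup₂ f ω) (cone a (cone b (cone e c))) = f a b e * ev ω (cone e c) := by
  have : ev (cup₂ f ω) ∘ₗ cone a ∘ₗ cone b ∘ₗ cone e = f a b e • (ev ω ∘ₗ cone e) := by
    ext l : 2
    simp [cup₂]
  exact LinearMap.congr_fun this c

lemma ev_cup₀_bdList (f : E → F) (ω : List E → F) (a b : E) (l : List E)
    (h : ev ω (bdList F (a :: b :: l)) = 0) :
    ev (cup₀ f ω) (bdList F (a :: b :: l)) = cup₁ (fun a b => f b - f a) ω (a :: b :: l) := by
  rw [bdList, map_sub, ev_single, one_mul, sub_eq_zero] at h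
  rw [bdList, map_sub, ev_cup₀_cone, ← h]
  simp [cup₀, cup₁]
  ring

lemma ev_cup₁_bdList (f : E → E → F) (ω : List E → F) (a b c : E) (l : List E)
    (h : ev ω (bdList F (b :: c :: l)) = 0) :
    ev (cup₁ f ω) (bdList F (a :: b :: c :: l)) =
      cup₂ (fun a b c => f b c - f a c + f a b) ω (a :: b :: c :: l) := by
  rw [bdList, map_sub, ev_single, one_mul, sub_eq_zero] at h
  rw [bdList, bdList, map_sub, map_sub, map_sub, ev_cup₁_cone, ← h]
  simp [cup₁, cup₂]
  ring

lemma ev_cup₂_bdList (f : E → E → E → F) (ω : List E → F) (a b c e : E) (l : List E)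
    (h : ev ω (bdList F (c :: e :: l)) = 0) :
    ev (cup₂ f ω) (bdList F (a :: b :: c :: e :: l)) =
      (f b c e - f a c e + f a b e - f a b c) * ω (e :: l) := by
  rw [bdList, map_sub, ev_single, one_mul, sub_eq_zero] at h
  rw [bdList, bdList, bdList, map_sub, map_sub, map_sub, map_sub, map_sub, map_sub,
    ev_cup₂_cone, ← h]
  simp [cup₂]
  ring

variable {ω : (ℕ → G) → List (Fin (d + 1) → ℝ) → F} {w : ℕ → G → F}

/-- Removing the coboundary of a label from the front of a cup product. -/
lemma colorSum_cup₁ (hw0 : ∑ u, w 0 u = 0)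
    (hw : ∀ m s, ∑ u, w (m + 1) u * w m (s - u) = 0) {m : ℕ} (hm : m < d) (N : ℕ)
    (hsum : ∑ u, w m u = 0) (hloc : IsLocal ω) (hinv : IsInv ω) (hcoc : IsCocycle m ω)
    {lab : (ℕ → G) → (Fin (d + 1) → ℝ) → F} (hlab : IsLocalLabel lab) (χ : G → F)
    (heq : ∀ g t, ∀ v ∈ stdSimplex ℝ (Fin (d + 1)), lab (fun i => g i + t) v = lab g v + χ t) :
    colorSum w (m + 1) (fun g =>
        ev (cup₁ (fun a b => lab g b - lab g a) (ω g)) (sdFace F d N (m + 1))) =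
      (∑ u, w m u * χ u) * colorSum w m (fun g => ev (ω g) (sdFace F d N m)) := by
  have hψ : IsLocal (fun g => cup₀ (lab g) (ω g)) := by
    intro g g' l hl hgg
    cases l with
    | nil => rfl
    | cons a l =>
      simp only [cup₀]
      rw [hloc g g' _ hl hgg, hlab g g' a (hl a (by simp)) (hgg a (by simp))]
  have h1 := colorSum_bd_sdFace w hw0 hw hψ N hm
  have h2 : ∀ g, ev (cup₀ (lab g) (ω g)) (bd (sdFace F d N (m + 1))) =
      ev (cup₁ (fun a b => lab g b - lab g a) (ω g)) (sdFace F d N (m + 1)) := fun g => by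
    refine eq_of_single (ev (cup₀ (lab g) (ω g)) ∘ₗ bd) (ev _) ?_ (sdFace_mem N (by omega))
    rintro l ⟨hl, -⟩
    match l, hl with
    | a :: b :: l, hl =>
      rw [LinearMap.comp_apply, bd_single, ev_single, one_mul]
      exact ev_cup₀_bdList _ _ a b l (hcoc g _ (by simpa using hl))
  simp_rw [h2] at h1
  rw [h1]
  have h3 : ∀ u, colorSum w m (fun g => ev (cup₀ (lab fun i => g i + u) (ω fun i => g i + u))
      (sdFace F d N m)) = colorSum w m (fun g => ev (cup₀ (lab g) (ω g)) (sdFace F d N m)) +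
        χ u * colorSum w m (fun g => ev (ω g) (sdFace F d N m)) := fun u => by
    rw [← smul_eq_mul, ← map_smul, ← map_add]
    congr 1
    funext g
    refine eq_of_single (ev (cup₀ (lab fun i => g i + u) (ω fun i => g i + u)))
      (ev (cup₀ (lab g) (ω g)) + χ u • ev (ω g)) ?_ (sdFace_mem N hm.le)
    rintro l ⟨hl, hlS⟩
    match l, hl with
    | a :: l, hl =>
      have := heq g u a (hlS a (by simp)).1
      simp only [ev_single, cup₀, LinearMap.add_apply, LinearMap.smul_apply, smul_eq_mul,
        hinv g u (a :: l) (fun v hv => (hlS v hv).1), this]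
      ring
  simp_rw [h3, mul_add, Finset.sum_add_distrib, ← Finset.sum_mul, hsum, ← mul_assoc,
    ← Finset.sum_mul]
  ring

/-- Replacing an Euler cocycle at the front of a cup product by the coboundary of a label. -/
lemma colorSum_cup₂ {p : ℕ} [NeZero p] [Algebra (ZMod p) F] (hw0 : ∑ u, w 0 u = 0)
    (hw : ∀ m s, ∑ u, w (m + 1) u * w m (s - u) = 0) {m : ℕ} (hm : m + 1 < d) (N : ℕ)
    (hsum : ∑ u, w (m + 1) u = 0) (hloc : IsLocal ω) (hinv : IsInv ω) (hcoc : IsCocycle m ω)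
    {lab : (ℕ → G) → (Fin (d + 1) → ℝ) → ZMod p} (hlab : IsLocalLabel lab) (χ : G → ZMod p)
    (heq : ∀ g t, ∀ v ∈ stdSimplex ℝ (Fin (d + 1)), lab (fun i => g i + t) v = lab g v + χ t)
    (K : F) (hK : ∀ a, ∑ u, w (m + 1) u * (carry a (χ u) : F) = K * algebraMap (ZMod p) F a) :
    colorSum w (m + 2) (fun g =>
        ev (cup₂ (fun a b c => (euler (lab g a) (lab g b) (lab g c) : F)) (ω g))
          (sdFace F d N (m + 2))) =
      K * colorSum w (m + 1) (fun g => ev (cup₁ (fun a b => algebraMap (ZMod p) F (lab g b) -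
        algebraMap (ZMod p) F (lab g a)) (ω g)) (sdFace F d N (m + 1))) := by
  have hψ : IsLocal (fun g => cup₁ (fun a b => (lift₁ (lab g a) (lab g b) : F)) (ω g)) := by
    intro g g' l hl hgg
    match l with
    | [] => rfl
    | [a] => rfl
    | a :: b :: l =>
      simp only [cup₁]
      rw [hloc g g' (b :: l) (fun v hv => hl v (List.mem_cons_of_mem _ hv))
        (fun v hv => hgg v (List.mem_cons_of_mem _ hv)),
        hlab g g' a (hl a (by simp)) (hgg a (by simp)),
        hlab g g' b (hl b (by simp)) (hgg b (by simp))]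
  have h1 := colorSum_bd_sdFace w hw0 hw hψ N hm
  have h2 : ∀ g, ev (cup₁ (fun a b => (lift₁ (lab g a) (lab g b) : F)) (ω g))
      (bd (sdFace F d N (m + 2))) =
      ev (cup₂ (fun a b c => (euler (lab g a) (lab g b) (lab g c) : F)) (ω g))
        (sdFace F d N (m + 2)) := fun g => by
    refine eq_of_single (ev (cup₁ (fun a b => (lift₁ (lab g a) (lab g b) : F)) (ω g)) ∘ₗ bd)
      (ev _) ?_ (sdFace_mem N (by omega))
    rintro l ⟨hl, -⟩
    match l, hl with
    | a :: b :: c :: l, hl =>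
      rw [LinearMap.comp_apply, bd_single, ev_single, one_mul,
        ev_cup₁_bdList _ _ a b c l (hcoc g _ (by simpa using hl))]
      simp [cup₂, euler]
  simp_rw [h2] at h1
  rw [h1]
  simp_rw [← smul_eq_mul, ← map_smul, ← map_sum]
  congr 1
  funext g
  simp only [Finset.sum_apply, Pi.smul_apply]
  have h3 := eq_of_single (∑ u, w (m + 1) u • ev (cup₁ (fun a b =>
      (lift₁ (lab (fun i => g i + u) a) (lab (fun i => g i + u) b) : F)) (ω fun i => g i + u)))
    (K • ev (cup₁ (fun a b => algebraMap (ZMod p) F (lab g b) -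
        algebraMap (ZMod p) F (lab g a)) (ω g))) ?_ (sdFace_mem N hm.le)
  · simpa [LinearMap.sum_apply] using h3
  rintro l ⟨hl, hlS⟩
  match l, hl with
  | a :: b :: l, hl =>
    have e1 : ∀ u, (ω fun i => g i + u) (b :: l) = ω g (b :: l) := fun u =>
      hinv g u (b :: l) (fun v hv => (hlS v (List.mem_cons_of_mem _ hv)).1)
    have e2 : ∀ u, lab (fun i => g i + u) a = lab g a + χ u := fun u =>
      heq g u a (hlS a (by simp)).1
    have e3 : ∀ u, lab (fun i => g i + u) b = lab g b + χ u := fun u =>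
      heq g u b (hlS b (by simp)).1
    simp only [LinearMap.sum_apply, LinearMap.smul_apply, ev_single, cup₁, e1, e2, e3, lift₁_add,
      smul_eq_mul, one_mul]
    simp_rw [← mul_assoc, ← Finset.sum_mul]
    congr 1
    push_cast
    simp_rw [mul_sub, mul_add, Finset.sum_sub_distrib, Finset.sum_add_distrib, hK,
      ← Finset.sum_mul, hsum]
    ring

end Cup

/-! ### Iterated cup products -/

section Iterated

variable {G F : Type*} [CommRing F] {d : ℕ}

lemma sdFace_zero (N : ℕ) : sdFace F d N 0 = Finsupp.single [vert d 0] 1 := by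
  rw [sdFace, face]
  induction N with
  | zero => simp
  | succ N ih =>
    rw [pow_succ', Module.End.mul_apply, ih, sd_succ_single]
    simp [bdList, sd, bary]

lemma colorSum_zero [AddCommGroup G] [Fintype G] (w : ℕ → G → F) (f : (ℕ → G) → F) : colorSum w 0 f = f 0 := rfl

lemma isCocycle_one : IsCocycle 0 (fun (_ : ℕ → G) (_ : List (Fin (d + 1) → ℝ)) => (1 : F)) := by
  rintro g l hl
  match l, hl with
  | [a, b], _ => simp [bdList]

/-- The cup product of the coboundaries of the first labels. -/
def coboundaryPow {E : Type*} (lab : ℕ → (ℕ → G) → E → F) : ℕ → (ℕ → G) → List E → F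
  | 0 => fun _ _ => 1
  | j + 1 => fun g => cup₁ (fun a b => lab j g b - lab j g a) (coboundaryPow lab j g)

/-- The cup product of the Euler cocycles of the first labels. -/
def eulerPow (F : Type*) [CommRing F] {p : ℕ} {E : Type*} (lab : ℕ → (ℕ → G) → E → ZMod p) :
    ℕ → (ℕ → G) → List E → F
  | 0 => fun _ _ => 1
  | j + 1 => fun g => cup₂ (fun a b c => (euler (lab j g a) (lab j g b) (lab j g c) : F))
      (eulerPow F lab j g)

section Coboundary

variable {lab : ℕ → (ℕ → G) → (Fin (d + 1) → ℝ) → F}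

lemma isLocal_coboundaryPow (hlab : ∀ j, IsLocalLabel (lab j)) (j : ℕ) : IsLocal (coboundaryPow lab j) := by
  induction j with
  | zero => intro g g' l _ _; rfl
  | succ j ih =>
    intro g g' l hl hgg
    match l with
    | [] => rfl
    | [a] => rfl
    | a :: b :: l =>
      simp only [coboundaryPow, cup₁]
      rw [ih g g' (b :: l) (fun v hv => hl v (List.mem_cons_of_mem _ hv))
        (fun v hv => hgg v (List.mem_cons_of_mem _ hv)),
        hlab j g g' a (hl a (by simp)) (hgg a (by simp)),
        hlab j g g' b (hl b (by simp)) (hgg b (by simp))]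

lemma isInv_coboundaryPow [AddCommGroup G] {χ : ℕ → G → F}
    (heq : ∀ j g t, ∀ v ∈ stdSimplex ℝ (Fin (d + 1)),
      lab j (fun i => g i + t) v = lab j g v + χ j t) (j : ℕ) : IsInv (coboundaryPow lab j) := by
  induction j with
  | zero => intro g t l _; rfl
  | succ j ih =>
    intro g t l hl
    match l with
    | [] => rfl
    | [a] => rfl
    | a :: b :: l =>
      simp only [coboundaryPow, cup₁]
      rw [ih g t (b :: l) (fun v hv => hl v (List.mem_cons_of_mem _ hv)),
        heq j g t a (hl a (by simp)), heq j g t b (hl b (by simp))]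
      ring

lemma isCocycle_coboundaryPow (j : ℕ) : IsCocycle j (coboundaryPow lab j) := by
  induction j with
  | zero => exact isCocycle_one
  | succ j ih =>
    intro g l hl
    match l, hl with
    | a :: b :: c :: l, hl =>
      rw [coboundaryPow, ev_cup₁_bdList _ _ a b c l (ih g _ (by simpa using hl))]
      simp [cup₂]

lemma colorSum_coboundaryPow_ne_zero [AddCommGroup G] [Fintype G] [IsDomain F]
    (hlab : ∀ j, IsLocalLabel (lab j)) {χ : ℕ → G → F}
    (heq : ∀ j g t, ∀ v ∈ stdSimplex ℝ (Fin (d + 1)),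
      lab j (fun i => g i + t) v = lab j g v + χ j t)
    {w : ℕ → G → F} (hw0 : ∑ u, w 0 u = 0)
    (hw : ∀ m s, ∑ u, w (m + 1) u * w m (s - u) = 0) (hsum : ∀ m, ∑ u, w m u = 0)
    (hχ : ∀ m, ∑ u, w m u * χ m u ≠ 0) (N : ℕ) {m : ℕ} (hm : m ≤ d) :
    colorSum w m (fun g => ev (coboundaryPow lab m g) (sdFace F d N m)) ≠ 0 := by
  induction m with
  | zero => simp [colorSum_zero, sdFace_zero, coboundaryPow]
  | succ m ih =>
    have := colorSum_cup₁ hw0 hw (show m < d by omega) N (hsum m) (isLocal_coboundaryPow hlab m)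
      (isInv_coboundaryPow heq m) (isCocycle_coboundaryPow m) (hlab m) (χ m) (heq m)
    simp only [coboundaryPow]
    rw [this]
    exact mul_ne_zero (hχ m) (ih (by omega))

end Coboundary

section Euler

variable {p : ℕ} {lab : ℕ → (ℕ → G) → (Fin (d + 1) → ℝ) → ZMod p}

lemma isLocal_eulerPow (hlab : ∀ j, IsLocalLabel (lab j)) (j : ℕ) : IsLocal (eulerPow F lab j) := by
  induction j with
  | zero => intro g g' l _ _; rfl
  | succ j ih =>
    intro g g' l hl hgg
    match l with
    | [] => rfl
    | [a] => rfl
    | [a, b] => rfl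
    | a :: b :: c :: l =>
      simp only [eulerPow, cup₂]
      rw [ih g g' (c :: l)
        (fun v hv => hl v (List.mem_cons_of_mem _ (List.mem_cons_of_mem _ hv)))
        (fun v hv => hgg v (List.mem_cons_of_mem _ (List.mem_cons_of_mem _ hv))),
        hlab j g g' a (hl a (by simp)) (hgg a (by simp)),
        hlab j g g' b (hl b (by simp)) (hgg b (by simp)),
        hlab j g g' c (hl c (by simp)) (hgg c (by simp))]

lemma isInv_eulerPow [AddCommGroup G] [NeZero p] {χ : ℕ → G → ZMod p}
    (heq : ∀ j g t, ∀ v ∈ stdSimplex ℝ (Fin (d + 1)),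
      lab j (fun i => g i + t) v = lab j g v + χ j t) (j : ℕ) : IsInv (eulerPow F lab j) := by
  induction j with
  | zero => intro g t l _; rfl
  | succ j ih =>
    intro g t l hl
    match l with
    | [] => rfl
    | [a] => rfl
    | [a, b] => rfl
    | a :: b :: c :: l =>
      simp only [eulerPow, cup₂]
      rw [ih g t (c :: l)
        (fun v hv => hl v (List.mem_cons_of_mem _ (List.mem_cons_of_mem _ hv))),
        heq j g t a (hl a (by simp)), heq j g t b (hl b (by simp)), heq j g t c (hl c (by simp)),
        euler_add]

lemma isCocycle_eulerPow (j : ℕ) : IsCocycle (2 * j) (eulerPow F lab j) := by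
  induction j with
  | zero => exact isCocycle_one
  | succ j ih =>
    intro g l hl
    match l, hl with
    | a :: b :: c :: e :: l, hl =>
      simp only [List.length_cons] at hl
      rw [eulerPow, ev_cup₂_bdList _ _ a b c e l (ih g _ (by simp only [List.length_cons]; omega))]
      simp only [euler]
      push_cast
      ring

lemma colorSum_eulerPow_ne_zero [AddCommGroup G] [Fintype G] [NeZero p] [IsDomain F]
    [Algebra (ZMod p) F] (hlab : ∀ j, IsLocalLabel (lab j))
    {χ : ℕ → G → ZMod p}
    (heq : ∀ j g t, ∀ v ∈ stdSimplex ℝ (Fin (d + 1)),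
      lab j (fun i => g i + t) v = lab j g v + χ j t)
    {w : ℕ → G → F}
    (hw0 : ∑ u, w 0 u = 0)
    (hw : ∀ m s, ∑ u, w (m + 1) u * w m (s - u) = 0) (hsum : ∀ m, ∑ u, w m u = 0)
    (hχ : ∀ m, ∑ u, w (2 * m) u * algebraMap (ZMod p) F (χ m u) ≠ 0)
    (hK : ∀ m, ∃ K : F, K ≠ 0 ∧ ∀ a, ∑ u, w (2 * m + 1) u * (carry a (χ m u) : F) =
      K * algebraMap (ZMod p) F a) (N : ℕ) {m : ℕ} (hm : 2 * m ≤ d) :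
    colorSum w (2 * m) (fun g => ev (eulerPow F lab m g) (sdFace F d N (2 * m))) ≠ 0 := by
  induction m with
  | zero => simp [colorSum_zero, sdFace_zero, eulerPow]
  | succ m ih =>
    obtain ⟨K, hK0, hK⟩ := hK m
    have h2 := colorSum_cup₂ hw0 hw (show 2 * m + 1 < d by omega) N (hsum _)
      (isLocal_eulerPow (F := F) hlab m) (isInv_eulerPow heq m) (isCocycle_eulerPow m) (hlab m)
      (χ m) (heq m) K hK
    have h1 := colorSum_cup₁ hw0 hw (show 2 * m < d by omega) N (hsum _)
      (isLocal_eulerPow (F := F) hlab m) (isInv_eulerPow heq m) (isCocycle_eulerPow m)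
      (lab := fun g v => algebraMap (ZMod p) F (lab m g v))
      (fun g g' v hv h => by simp only [hlab m g g' v hv h])
      (fun u => algebraMap (ZMod p) F (χ m u)) (fun g t v hv => by simp [heq m g t v hv])
    rw [h1] at h2
    simp only [eulerPow, mul_add, mul_one]
    rw [h2]
    exact mul_ne_zero hK0 (mul_ne_zero (hχ m) (ih (by omega)))

end Euler

/-- A nonvanishing weighted sum forces a small simplex with nonvanishing cochain. -/
lemma exists_simplex_of_colorSum_ne_zero [AddCommGroup G] [Fintype G] {w : ℕ → G → F}
    {ω : (ℕ → G) → List (Fin (d + 1) → ℝ) → F}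
    (N : ℕ) (h : colorSum w d (fun g => ev (ω g) (sdFace F d N d)) ≠ 0) :
    ∃ g l, ω g l ≠ 0 ∧ l ≠ [] ∧ (∀ v ∈ l, v ∈ stdSimplex ℝ (Fin (d + 1))) ∧
      ∀ v ∈ l, ∀ v' ∈ l, dist v v' ≤ ((d : ℝ) / (d + 1)) ^ N := by
  by_contra! hcon
  refine h ?_
  rw [show (fun g => ev (ω g) (sdFace F d N d)) = 0 from ?_, map_zero]
  funext g
  have hface : Finsupp.single (face d d) (1 : F) ∈ chainsIn F (fun l => l.length = d + 1 ∧
      ∀ v ∈ l, ∀ v' ∈ l, dist v v' ≤ 1) := by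
    refine single_mem_chainsIn ⟨length_face d d, fun v hv v' hv' => ?_⟩ 1
    obtain ⟨i, -, rfl⟩ := mem_face.1 hv
    obtain ⟨i', -, rfl⟩ := mem_face.1 hv'
    refine (dist_pi_le_iff zero_le_one).2 fun j => ?_
    simp only [vert, Pi.single_apply]
    split_ifs <;> simp
  have h2 := sd_pow_mesh d N hface
  rw [mul_one] at h2
  have h3 := Submodule.mem_inf.2 ⟨sdFace_mem (F := F) (d := d) N le_rfl, h2⟩
  rw [← Finsupp.supported_inter] at h3
  refine eq_of_single (ev (ω g)) 0 ?_ h3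
  rintro l ⟨⟨hl, hl1⟩, -, hl2⟩
  by_contra h0
  obtain ⟨v, hv, v', hv', h4⟩ := hcon g l (by simpa using h0)
    (by rintro rfl; simp at hl) (fun v hv => (hl1 v hv).1)
  exact absurd (hl2 v hv v' hv') (not_le.2 h4)

/-- The simplices on which the cup product of coboundaries does not vanish have, for every label,
two vertices with distinct labels. -/
lemma exists_ne_of_coboundaryPow_ne_zero {E : Type*} {lab : ℕ → (ℕ → G) → E → F} {g : ℕ → G}
    {m : ℕ} {l : List E} (h : coboundaryPow lab m g l ≠ 0) {j : ℕ} (hj : j < m) :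
    ∃ a ∈ l, ∃ b ∈ l, lab j g a ≠ lab j g b := by
  induction m generalizing l with
  | zero => omega
  | succ m ih =>
    match l with
    | [] => simp [coboundaryPow, cup₁] at h
    | [a] => simp [coboundaryPow, cup₁] at h
    | a :: b :: l =>
      simp only [coboundaryPow, cup₁] at h
      rcases Nat.lt_succ_iff_lt_or_eq.1 hj with hj | rfl
      · obtain ⟨x, hx, y, hy, hxy⟩ := ih (right_ne_zero_of_mul h) hj
        exact ⟨x, List.mem_cons_of_mem _ hx, y, List.mem_cons_of_mem _ hy, hxy⟩
      · refine ⟨a, by simp, b, by simp, fun hab => left_ne_zero_of_mul h ?_⟩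
        rw [hab, sub_self]

/-- The simplices on which the cup product of Euler cocycles does not vanish have, for every
label, three vertices with distinct labels. -/
lemma exists_ne_of_eulerPow_ne_zero {E : Type*} {p : ℕ} [NeZero p] (hp : Odd p)
    {lab : ℕ → (ℕ → G) → E → ZMod p} {g : ℕ → G}
    {m : ℕ} {l : List E} (h : eulerPow F lab m g l ≠ 0) {j : ℕ} (hj : j < m) :
    ∃ a ∈ l, ∃ b ∈ l, ∃ c ∈ l, lab j g a ≠ lab j g b ∧ lab j g b ≠ lab j g c ∧
      lab j g a ≠ lab j g c := by
  induction m generalizing l with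
  | zero => omega
  | succ m ih =>
    match l with
    | [] => simp [eulerPow, cup₂] at h
    | [a] => simp [eulerPow, cup₂] at h
    | [a, b] => simp [eulerPow, cup₂] at h
    | a :: b :: c :: l =>
      simp only [eulerPow, cup₂] at h
      rcases Nat.lt_succ_iff_lt_or_eq.1 hj with hj | rfl
      · obtain ⟨x, hx, y, hy, z, hz, hxyz⟩ := ih (right_ne_zero_of_mul h) hj
        have hs : c :: l ⊆ a :: b :: c :: l := fun v hv =>
          List.mem_cons_of_mem _ (List.mem_cons_of_mem _ hv)
        exact ⟨x, hs hx, y, hs hy, z, hs hz, hxyz⟩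
      · refine ⟨a, by simp, b, by simp, c, by simp, euler_ne_zero hp fun h0 => ?_⟩
        rw [h0] at h
        simp at h

end Iterated

/-! ### Weights -/

section Weights

open AddMonoidAlgebra

variable {F : Type*} [Field F]

/-- The augmentation of a group algebra. -/
def aug (F G : Type*) [Field F] [AddCommGroup G] : AddMonoidAlgebra F G →ₐ[F] F :=
  AddMonoidAlgebra.lift F F G 1

@[simp] lemma aug_single {G : Type*} [AddCommGroup G] (g : G) (r : F) :
    aug F G (single g r) = r := by
  simp [aug]

lemma aug_eq_sum {G : Type*} [AddCommGroup G] [Fintype G] (x : AddMonoidAlgebra F G) :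
    aug F G x = ∑ u, x.coeff u := by
  classical
  induction x using AddMonoidAlgebra.induction_linear with
  | zero => simp
  | add x y hx hy => simp [hx, hy, Finset.sum_add_distrib]
  | single g r => simp [Finsupp.single_apply]

lemma sum_coeff_comp {G H : Type*} [AddCommGroup G] [Fintype G] [AddCommGroup H] [Fintype H]
    (χ : G →+ H) (x : AddMonoidAlgebra F G) (h : H → F) :
    ∑ u, x.coeff u * h (χ u) = ∑ s, (mapDomainAlgHom F F χ x).coeff s * h s := by
  classical
  induction x using AddMonoidAlgebra.induction_linear with
  | zero => simp
  | add x y hx hy =>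
    simp only [map_add, coeff_add, Finsupp.add_apply, add_mul, Finset.sum_add_distrib, hx, hy]
  | single g r => simp [Finsupp.single_apply]

variable {p : ℕ} [Fact p.Prime]

lemma sub_one_pow_pred [Algebra (ZMod p) F] :
    ((Polynomial.X : Polynomial F) - 1) ^ (p - 1) = ∑ i ∈ Finset.range p, Polynomial.X ^ i := by
  have hp : p.Prime := Fact.out
  have : CharP F p := charP_of_injective_algebraMap (algebraMap (ZMod p) F).injective p
  refine mul_right_cancel₀ (Polynomial.X_sub_C_ne_zero (1 : F)) ?_
  rw [map_one, ← pow_succ, Nat.sub_add_cancel hp.one_le, geom_sum_mul, sub_pow_char, one_pow]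

/-- The sum of all group elements. -/
def total (F : Type*) [Field F] (p : ℕ) [Fact p.Prime] : AddMonoidAlgebra F (ZMod p) :=
  ∑ s, single s 1

lemma mul_total (z : AddMonoidAlgebra F (ZMod p)) :
    z * total F p = aug F (ZMod p) z • total F p := by
  induction z using AddMonoidAlgebra.induction_linear with
  | zero => simp
  | add x y hx hy => simp [add_mul, add_smul, hx, hy]
  | single g r =>
    rw [total, Finset.mul_sum, Finset.smul_sum]
    simp only [single_mul_single, aug_single, mul_one, smul_single']
    exact Equiv.sum_comp (Equiv.addLeft g) (fun s => single s r)

lemma single_sub_one_pow_pred [Algebra (ZMod p) F] :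
    (single (1 : ZMod p) (1 : F) - 1) ^ (p - 1) = total F p := by
  have := congrArg (Polynomial.aeval (single (1 : ZMod p) (1 : F))) (sub_one_pow_pred (F := F) (p := p))
  simp only [map_pow, map_sub, Polynomial.aeval_X, map_one, map_sum] at this
  rw [this, total]
  refine Finset.sum_nbij' (fun i => (i : ZMod p)) ZMod.val (by simp) ?_ ?_ (by simp) ?_
  · intro s _
    exact Finset.mem_range.2 s.val_lt
  · intro i hi
    exact ZMod.val_cast_of_lt (Finset.mem_range.1 hi)
  · intro i _
    simp [single_pow]

lemma exists_single_sub_one [Algebra (ZMod p) F] (c : ZMod p) :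
    ∃ s : AddMonoidAlgebra F (ZMod p), aug F (ZMod p) s = algebraMap (ZMod p) F c ∧
      single c (1 : F) - 1 = (single 1 1 - 1) * s := by
  refine ⟨∑ i ∈ Finset.range c.val, single 1 1 ^ i, ?_, ?_⟩
  · rw [map_sum]
    simp only [map_pow, aug_single, one_pow, Finset.sum_const, Finset.card_range, nsmul_eq_mul,
      mul_one]
    rw [← map_natCast (algebraMap (ZMod p) F), ZMod.natCast_zmod_val]
  · rw [mul_geom_sum, single_pow]
    simp

variable {ι : Type*} [Fintype ι] [DecidableEq ι]

/-- A nilpotent element of the group algebra on which characters do not vanish. -/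
def weight (τ : ι → F) : AddMonoidAlgebra F (ι → ZMod p) :=
  ∑ i, τ i • (single (Pi.single i 1) 1 - 1)

lemma aug_weight (τ : ι → F) : aug F _ (weight (p := p) τ) = 0 := by
  simp [weight, map_sum]

lemma weight_pow [Algebra (ZMod p) F] (τ : ι → F) : (weight (p := p) τ) ^ p = 0 := by
  have : CharP (AddMonoidAlgebra F (ι → ZMod p)) p :=
    charP_of_injective_algebraMap (algebraMap (ZMod p) _).injective p
  rw [weight, sum_pow_char]
  refine Finset.sum_eq_zero fun i _ => ?_
  rw [smul_pow, sub_pow_char, single_pow]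
  have : p • (Pi.single i 1 : ι → ZMod p) = 0 := by ext; simp
  simp [this, AddMonoidAlgebra.one_def]

lemma mapDomain_weight [Algebra (ZMod p) F] (τ : ι → F) (χ : (ι → ZMod p) →+ ZMod p) :
    ∃ s : AddMonoidAlgebra F (ZMod p),
      aug F (ZMod p) s = ∑ i, τ i * algebraMap (ZMod p) F (χ (Pi.single i 1)) ∧
      mapDomainAlgHom F F χ (weight τ) = (single 1 1 - 1) * s := by
  choose s hs1 hs2 using exists_single_sub_one (F := F) (p := p)
  refine ⟨∑ i, τ i • s (χ (Pi.single i 1)), by simp [map_sum, hs1], ?_⟩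
  rw [weight, map_sum, Finset.mul_sum]
  refine Finset.sum_congr rfl fun i _ => ?_
  rw [mul_smul_comm, ← hs2]
  rw [map_smul, map_sub, map_one]
  simp

lemma sum_weight_mul [Algebra (ZMod p) F] (τ : ι → F) (χ : (ι → ZMod p) →+ ZMod p) :
    ∑ u, (weight τ).coeff u * algebraMap (ZMod p) F (χ u) =
      ∑ i, τ i * algebraMap (ZMod p) F (χ (Pi.single i 1)) := by
  simp_rw [weight, coeff_sum, Finsupp.finsetSum_apply, Finset.sum_mul]
  rw [Finset.sum_comm]
  refine Finset.sum_congr rfl fun i _ => ?_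
  simp [one_def, Finsupp.single_apply, mul_assoc, sub_mul, ← Finset.mul_sum,
    Finset.sum_sub_distrib]

lemma sum_weight_pow_mul_carry [Algebra (ZMod p) F] (τ : ι → F) (χ : (ι → ZMod p) →+ ZMod p)
    (a : ZMod p) :
    ∑ u, ((weight τ) ^ (p - 1)).coeff u * (carry a (χ u) : F) =
      (∑ i, τ i * algebraMap (ZMod p) F (χ (Pi.single i 1))) ^ (p - 1) *
        algebraMap (ZMod p) F a := by
  obtain ⟨s, hs1, hs2⟩ := mapDomain_weight τ χ
  rw [sum_coeff_comp χ _ (fun s => (carry a s : F)), map_pow, hs2, mul_pow,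
    single_sub_one_pow_pred, mul_comm, mul_total, map_pow, hs1]
  have : ∀ s, (total F p).coeff s = 1 := fun s => by
    simp [total, coeff_sum, Finsupp.finsetSum_apply, Finsupp.single_apply]
  simp only [coeff_smul, Finsupp.smul_apply, this, smul_eq_mul, mul_one]
  rw [← Finset.mul_sum]
  congr 1
  rw [← Int.cast_sum, sum_carry]
  rw [Int.cast_natCast, ← map_natCast (algebraMap (ZMod p) F), ZMod.natCast_zmod_val]

lemma exists_weights (p : ℕ) [Fact p.Prime] {k : ℕ} (hk : k ≠ 0) :
    ∃ (F : Type) (_ : Field F) (_ : Algebra (ZMod p) F) (w : ℕ → (Fin k → ZMod p) → F),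
      (∀ m, ∑ u, w m u = 0) ∧ (∀ m s, ∑ u, w (m + 1) u * w m (s - u) = 0) ∧
      ∀ χ : (Fin k → ZMod p) →+ ZMod p, χ ≠ 0 →
        (∀ m, (p = 2 ∨ Even m) → ∑ u, w m u * algebraMap (ZMod p) F (χ u) ≠ 0) ∧
        ∀ m, Odd m → ∃ K : F, K ≠ 0 ∧
          ∀ a, ∑ u, w m u * (carry a (χ u) : F) = K * algebraMap (ZMod p) F a := by
  have hp : p.Prime := Fact.out
  let b := Module.finBasisOfFinrankEq (ZMod p) (GaloisField p k) (GaloisField.finrank p hk)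
  have hγ : ∀ χ : (Fin k → ZMod p) →+ ZMod p, χ ≠ 0 →
      ∑ i, b i * algebraMap (ZMod p) (GaloisField p k) (χ (Pi.single i 1)) ≠ 0 := by
    intro χ hχ h
    have h0 := Fintype.linearIndependent_iff.1 b.linearIndependent (fun i => χ (Pi.single i 1))
      (by rw [← h]; exact Finset.sum_congr rfl fun i _ => by rw [Algebra.smul_def, mul_comm])
    refine hχ (AddMonoidHom.functions_ext _ _ _ fun i c => ?_)
    have : (Pi.single i c : Fin k → ZMod p) = c.val • Pi.single i 1 := by
      rw [← Pi.single_smul]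
      simp
    rw [this, map_nsmul, h0]
    simp
  have hx : weight (p := p) b ^ (p - 1) * weight b = 0 := by
    rw [← pow_succ, Nat.sub_add_cancel hp.one_le, weight_pow]
  have hx' : weight (p := p) b * weight b ^ (p - 1) = 0 := by rw [mul_comm, hx]
  refine ⟨GaloisField p k, inferInstance, inferInstance,
    fun m => (if Even m then weight b else weight b ^ (p - 1)).coeff, ?_, ?_, ?_⟩
  · intro m
    dsimp only
    split_ifs
    · rw [← aug_eq_sum, aug_weight]
    · rw [← aug_eq_sum, map_pow, aug_weight, zero_pow (Nat.sub_ne_zero_of_lt hp.one_lt)]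
  · intro m s
    dsimp only
    have key : ∀ x y : AddMonoidAlgebra (GaloisField p k) (Fin k → ZMod p), x * y = 0 →
        ∑ u, x.coeff u * y.coeff (s - u) = 0 := fun x y h => by
      have := coeff_mul_apply_left x y s
      rw [h, Finsupp.sum_fintype _ _ (by simp)] at this
      simpa [neg_add_eq_sub] using this.symm
    by_cases hm : Even m
    · rw [if_pos hm, if_neg (by simpa [Nat.even_add_one] using hm)]
      exact key _ _ hx
    · rw [if_neg hm, if_pos (by simpa [Nat.even_add_one] using hm)]
      exact key _ _ hx'
  · intro χ hχ
    refine ⟨fun m hm => ?_, fun m hm => ?_⟩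
    · have : (if Even m then weight (p := p) b else weight b ^ (p - 1)) = weight b := by
        rcases hm with rfl | hm
        · simp
        · simp [hm]
      simp only [this]
      rw [sum_weight_mul]
      exact hγ χ hχ
    · refine ⟨_, pow_ne_zero (p - 1) (hγ χ hχ), fun a => ?_⟩
      simp only [Nat.not_even_iff_odd.2 hm, if_false]
      exact sum_weight_pow_mul_carry _ χ a

end Weights

/-! ### Simplices with many labels -/

section Labels

variable {p : ℕ} [Fact p.Prime]

lemma exists_simplex_labels {k : ℕ} (hk : k ≠ 0) {d : ℕ} (hd : 0 < d) {J : Type*} [Fintype J]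
    (hJ : Fintype.card J * (if p = 2 then 1 else 2) = d)
    {lab : J → (ℕ → (Fin k → ZMod p)) → (Fin (d + 1) → ℝ) → ZMod p}
    (hlab : ∀ j, IsLocalLabel (lab j)) {χ : J → (Fin k → ZMod p) →+ ZMod p} (hχ : ∀ j, χ j ≠ 0)
    (heq : ∀ j g t, ∀ v ∈ stdSimplex ℝ (Fin (d + 1)),
      lab j (fun i => g i + t) v = lab j g v + χ j t) (N : ℕ) :
    ∃ g l, l ≠ [] ∧ (∀ v ∈ l, v ∈ stdSimplex ℝ (Fin (d + 1))) ∧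
      (∀ v ∈ l, ∀ v' ∈ l, dist v v' ≤ ((d : ℝ) / (d + 1)) ^ N) ∧
      ∀ j s, ∃ v ∈ l, lab j g v ≠ s ∧ (p ≠ 2 → lab j g v ≠ s - 1) := by
  have hp : p.Prime := Fact.out
  obtain ⟨F, _, _, w, hsum, hw, hwχ⟩ := exists_weights p hk
  have hcard : 0 < Fintype.card J := Nat.pos_of_ne_zero fun h => by simp [h] at hJ; omega
  let e := (Fintype.equivFin J).symm
  let r : ℕ → J := fun m => e ⟨m % Fintype.card J, Nat.mod_lt _ hcard⟩
  have hr : ∀ j, ∃ m < Fintype.card J, r m = j := fun j =>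
    ⟨e.symm j, (e.symm j).2, by simp [r, Nat.mod_eq_of_lt (e.symm j).2]⟩
  by_cases h2 : p = 2
  · rw [if_pos h2, mul_one] at hJ
    have hne := colorSum_coboundaryPow_ne_zero (lab := fun m g v =>
        algebraMap (ZMod p) F (lab (r m) g v)) (χ := fun m u => algebraMap (ZMod p) F (χ (r m) u))
      (fun m g g' v hv h => by simp only [hlab (r m) g g' v hv h])
      (fun m g t v hv => by simp only [heq (r m) g t v hv, map_add])
      (hsum 0) hw hsum (fun m => (hwχ _ (hχ (r m))).1 m (.inl h2)) N le_rfl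
    obtain ⟨g, l, hl, h1, h3, h4⟩ := exists_simplex_of_colorSum_ne_zero N hne
    refine ⟨g, l, h1, h3, h4, fun j s => ?_⟩
    obtain ⟨m, hm, rfl⟩ := hr j
    obtain ⟨a, ha, b, hb, hab⟩ := exists_ne_of_coboundaryPow_ne_zero hl (hJ ▸ hm)
    simp only [h2, ne_eq, not_true, false_imp_iff, and_true]
    by_contra! hcon
    exact hab (by simp only [hcon a ha, hcon b hb])
  · rw [if_neg h2, mul_comm] at hJ
    subst hJ
    have hne := colorSum_eulerPow_ne_zero (F := F) (lab := fun m => lab (r m))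
      (χ := fun m u => χ (r m) u) (fun m => hlab (r m)) (fun m => heq (r m))
      (hsum 0) hw hsum (fun m => (hwχ _ (hχ (r m))).1 _ (.inr (by simp)))
      (fun m => (hwχ _ (hχ (r m))).2 _ (by simp)) N le_rfl
    obtain ⟨g, l, hl, h1, h3, h4⟩ := exists_simplex_of_colorSum_ne_zero N hne
    refine ⟨g, l, h1, h3, h4, fun j s => ?_⟩
    obtain ⟨m, hm, rfl⟩ := hr j
    obtain ⟨a, ha, b, hb, c, hc, hab, hbc, hac⟩ :=
      exists_ne_of_eulerPow_ne_zero (hp.odd_of_ne_two h2) hl hm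
    by_contra! hcon
    have key : ∀ v ∈ l, lab (r m) g v = s ∨ lab (r m) g v = s - 1 := fun v hv => by
      by_cases h : lab (r m) g v = s
      · exact .inl h
      · exact .inr (hcon v hv h).2
    rcases key a ha with h | h <;> rcases key b hb with h' | h' <;>
      rcases key c hc with h'' | h'' <;> simp_all

end Labels

/-! ### Sectors of the complex plane -/

section Sector

variable {p : ℕ}

/-- The index of the sector of angle `2 * π / p` that contains a complex number. -/
def sector (p : ℕ) (z : ℂ) : ZMod p := (⌊p * z.arg / (2 * Real.pi)⌋ : ℤ)

lemma sector_mul_exp {r : ℝ} (hr : 0 < r) (φ : ℝ) :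
    sector p (r * Complex.exp (φ * Complex.I)) = (⌊p * φ / (2 * Real.pi)⌋ : ℤ) := by
  have h : ((r * Complex.exp (φ * Complex.I)).arg : Real.Angle) = (φ : Real.Angle) := by
    rw [Complex.arg_real_mul _ hr, Complex.arg_exp_mul_I, Real.Angle.coe_toIocMod]
  rw [Real.Angle.angle_eq_iff_two_pi_dvd_sub] at h
  obtain ⟨m, hm⟩ := h
  rw [sector, sub_eq_iff_eq_add.1 hm]
  have : (p * (2 * Real.pi * m + φ) / (2 * Real.pi) : ℝ) =
      p * φ / (2 * Real.pi) + ((p * m : ℤ) : ℝ) := by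
    have := Real.pi_ne_zero
    push_cast
    field_simp
    ring
  rw [this, Int.floor_add_intCast]
  simp

lemma sector_stdAddChar_mul [NeZero p] (t : ZMod p) {z : ℂ} (hz : z ≠ 0) :
    sector p (ZMod.stdAddChar t * z) = sector p z + t := by
  have h : ZMod.stdAddChar t * z =
      (‖z‖ : ℝ) * Complex.exp ((z.arg + 2 * Real.pi * t.val / p : ℝ) * Complex.I) := by
    conv_lhs => rw [← Complex.norm_mul_exp_arg_mul_I z]
    rw [ZMod.stdAddChar_apply, ZMod.toCircle_apply]
    rw [mul_left_comm, ← Complex.exp_add]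
    congr 2
    push_cast
    ring
  rw [h, sector_mul_exp (norm_pos_iff.2 hz), sector]
  have : (p * (z.arg + 2 * Real.pi * t.val / p) / (2 * Real.pi) : ℝ) =
      p * z.arg / (2 * Real.pi) + ((t.val : ℤ) : ℝ) := by
    have := Real.pi_ne_zero
    have : (p : ℝ) ≠ 0 := by exact_mod_cast NeZero.ne p
    push_cast
    field_simp
  rw [this, Int.floor_add_intCast]
  simp

lemma eventually_sector [NeZero p] {z₀ : ℂ} (hz : z₀ ≠ 0) :
    ∃ s : ZMod p, ∀ᶠ z in nhds z₀, sector p z = s ∨ sector p z = s - 1 := by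
  refine ⟨(⌊p * z₀.arg / (2 * Real.pi) + 1 / 2⌋ : ℤ), ?_⟩
  have hc : ContinuousAt (fun z => p * (z / z₀).arg / (2 * Real.pi)) z₀ := by
    have h1 : ContinuousAt Complex.arg (z₀ / z₀) := by
      rw [div_self hz]
      exact Complex.continuousAt_arg Complex.one_mem_slitPlane
    have h2 : ContinuousAt (fun z => (z / z₀).arg) z₀ :=
      ContinuousAt.comp (f := fun z => z / z₀) h1 (by fun_prop)
    exact (h2.const_mul (p : ℝ)).div_const _
  have h0 : p * (z₀ / z₀).arg / (2 * Real.pi) = 0 := by simp [hz]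
  rw [ContinuousAt, h0, Metric.tendsto_nhds] at hc
  filter_upwards [hc (1 / 2) (by norm_num), isOpen_ne.mem_nhds hz] with z hz1 hz2
  rw [Real.dist_eq, sub_zero, abs_lt] at hz1
  have h : z = (‖z‖ : ℝ) * Complex.exp ((z₀.arg + (z / z₀).arg : ℝ) * Complex.I) := by
    have e1 := Complex.norm_mul_exp_arg_mul_I z₀
    have e2 := Complex.norm_mul_exp_arg_mul_I (z / z₀)
    calc z = z₀ * (z / z₀) := by field_simp
      _ = (‖z₀‖ * Complex.exp (z₀.arg * Complex.I)) *
          (‖z / z₀‖ * Complex.exp ((z / z₀).arg * Complex.I)) := by rw [e1, e2]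
      _ = (‖z₀‖ * ‖z / z₀‖ : ℝ) *
          (Complex.exp (z₀.arg * Complex.I) * Complex.exp ((z / z₀).arg * Complex.I)) := by
        push_cast
        ring
      _ = _ := by
        rw [← Complex.exp_add, ← norm_mul, mul_div_cancel₀ _ hz]
        push_cast
        ring_nf
  rw [h, sector_mul_exp (norm_pos_iff.2 hz2), mul_add, add_div]
  set β := p * z₀.arg / (2 * Real.pi)
  set η := p * (z / z₀).arg / (2 * Real.pi)
  have h1 : ⌊β + η⌋ ≤ ⌊β + 1 / 2⌋ := Int.floor_le_floor (by linarith)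
  have h2 : ⌊β + 1 / 2⌋ - 1 ≤ ⌊β + η⌋ := by
    rw [← Int.floor_sub_one]
    exact Int.floor_le_floor (by linarith)
  rcases (show ⌊β + η⌋ = ⌊β + 1 / 2⌋ ∨ ⌊β + η⌋ = ⌊β + 1 / 2⌋ - 1 by omega) with h | h
  · exact .inl (by rw [h])
  · exact .inr (by rw [h]; push_cast; rfl)

lemma eventually_sector_of_im_eq_zero {z₀ : ℂ} (hz : z₀ ≠ 0) (hz' : z₀.im = 0) :
    ∀ᶠ z in nhds z₀, z.im = 0 → sector p z = sector p z₀ := by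
  have hc : ContinuousAt (fun z : ℂ => (z / z₀).re) z₀ := by
    exact Complex.continuous_re.continuousAt.comp (f := fun z => z / z₀) (by fun_prop)
  have h0 : (z₀ / z₀).re = 1 := by simp [hz]
  rw [ContinuousAt, h0] at hc
  filter_upwards [hc.eventually (lt_mem_nhds one_pos)] with z hz1 hz2
  have h : z = ((z / z₀).re : ℝ) * z₀ := by
    have : ((z / z₀).re : ℂ) = z / z₀ := by
      apply Complex.ext <;> simp [Complex.div_im, hz2, hz']
    rw [this]
    field_simp
  rw [sector, sector, h, Complex.arg_real_mul _ hz1]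

end Sector

/-! ### Common zeros of character sums -/

section CharacterSums

variable {p : ℕ} [Fact p.Prime] {G : Type*} [AddCommGroup G]

/-- The character sum of the colored real numbers `y ν`. -/
def charSum (χ : G →+ ZMod p) {ι : Type*} [Fintype ι] (y : ι → ℝ) (g : ι → G) : ℂ :=
  ∑ ν, (y ν : ℂ) * ZMod.stdAddChar (χ (g ν))

lemma charSum_add {ι : Type*} [Fintype ι] (χ : G →+ ZMod p) (y : ι → ℝ) (g : ι → G) (t : G) :
    charSum χ y (fun ν => g ν + t) = ZMod.stdAddChar (χ t) * charSum χ y g := by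
  rw [charSum, charSum, Finset.mul_sum]
  refine Finset.sum_congr rfl fun ν _ => ?_
  rw [map_add, AddChar.map_add_eq_mul]
  ring

lemma charSum_neg {ι : Type*} [Fintype ι] (χ : G →+ ZMod p) (y : ι → ℝ) (g : ι → G) :
    charSum (-χ) y g = (starRingEnd ℂ) (charSum χ y g) := by
  rw [charSum, charSum, map_sum]
  refine Finset.sum_congr rfl fun ν _ => ?_
  rw [map_mul, Complex.conj_ofReal, AddMonoidHom.neg_apply, AddChar.map_neg_eq_conj]

lemma charSum_im_of_eq_two (hp : p = 2) {ι : Type*} [Fintype ι] (χ : G →+ ZMod p) (y : ι → ℝ)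
    (g : ι → G) : (charSum χ y g).im = 0 := by
  rw [← Complex.conj_eq_iff_im, ← charSum_neg]
  congr 1
  ext u
  subst hp
  exact ZMod.neg_eq_self_mod_two _

/-- Near a point with a nonzero character sum, the labels lie in two adjacent sectors, and in a
single one if `p = 2`. -/
lemma eventually_sector_charSum (χ : G →+ ZMod p) {ι : Type*} [Fintype ι] (g : ι → G)
    {y₀ : ι → ℝ} (h : charSum χ y₀ g ≠ 0) :
    ∃ s : ZMod p, ∀ᶠ y in nhds y₀, charSum χ y g ≠ 0 ∧
      (sector p (charSum χ y g) ≠ s → p ≠ 2 ∧ sector p (charSum χ y g) = s - 1) := by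
  have hc : Continuous (fun y : ι → ℝ => charSum χ y g) := by
    unfold charSum
    fun_prop
  have hne := hc.continuousAt.eventually_ne h
  by_cases hp : p = 2
  · refine ⟨sector p (charSum χ y₀ g), ?_⟩
    have h1 := eventually_sector_of_im_eq_zero (p := p) h (charSum_im_of_eq_two hp _ _ _)
    filter_upwards [hne, hc.continuousAt.eventually h1] with y hy1 hy2
    exact ⟨hy1, fun hs => absurd (hy2 (charSum_im_of_eq_two hp _ _ _)) hs⟩
  · obtain ⟨s, hs⟩ := eventually_sector (p := p) h
    refine ⟨s, ?_⟩
    filter_upwards [hne, hc.continuousAt.eventually hs] with y hy1 hy2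
    exact ⟨hy1, fun hs => ⟨hp, hy2.resolve_left hs⟩⟩

theorem exists_charSum_eq_zero {k : ℕ} (hk : k ≠ 0) {d : ℕ} (hd : 0 < d) {J : Type*} [Fintype J]
    (hJ : Fintype.card J * (if p = 2 then 1 else 2) = d)
    {χ : J → (Fin k → ZMod p) →+ ZMod p} (hχ : ∀ j, χ j ≠ 0)
    {f : J → (Fin (d + 1) → ℝ) → Fin (d + 1) → ℝ}
    (hf : ∀ j, ContinuousOn (f j) (stdSimplex ℝ (Fin (d + 1))))
    (hf0 : ∀ j, ∀ x ∈ stdSimplex ℝ (Fin (d + 1)), ∀ ν, x ν = 0 → f j x ν = 0) :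
    ∃ x ∈ stdSimplex ℝ (Fin (d + 1)), ∃ g : Fin (d + 1) → Fin k → ZMod p,
      ∀ j, charSum (χ j) (f j x) g = 0 := by
  classical
  by_contra! hcon
  have hlocal : ∀ g : Fin (d + 1) → Fin k → ZMod p, ∃ δ > 0, ∀ x ∈ stdSimplex ℝ (Fin (d + 1)),
      ∃ j s, ∀ y ∈ stdSimplex ℝ (Fin (d + 1)), dist y x < δ → charSum (χ j) (f j y) g ≠ 0 ∧
        (sector p (charSum (χ j) (f j y) g) ≠ s →
          p ≠ 2 ∧ sector p (charSum (χ j) (f j y) g) = s - 1) := by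
    intro g
    have : ∀ x : stdSimplex ℝ (Fin (d + 1)), ∃ U : Set (Fin (d + 1) → ℝ), IsOpen U ∧ x.1 ∈ U ∧
        ∃ j s, ∀ y ∈ U ∩ stdSimplex ℝ (Fin (d + 1)), charSum (χ j) (f j y) g ≠ 0 ∧
          (sector p (charSum (χ j) (f j y) g) ≠ s →
            p ≠ 2 ∧ sector p (charSum (χ j) (f j y) g) = s - 1) := by
      rintro ⟨x, hx⟩
      obtain ⟨j, hj⟩ := hcon x hx g
      obtain ⟨s, hs⟩ := eventually_sector_charSum (χ j) g hj
      obtain ⟨U, hU, hxU, hUs⟩ := mem_nhdsWithin.1 ((hf j x hx).eventually hs)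
      exact ⟨U, hU, hxU, j, s, fun y hy => hUs hy⟩
    choose U hU hxU hUs using this
    obtain ⟨δ, hδ, h⟩ := lebesgue_number_lemma_of_metric (isCompact_stdSimplex ℝ (Fin (d + 1))) hU
      (fun x hx => Set.mem_iUnion.2 ⟨⟨x, hx⟩, hxU _⟩)
    refine ⟨δ, hδ, fun x hx => ?_⟩
    obtain ⟨i, hi⟩ := h x hx
    obtain ⟨j, s, hjs⟩ := hUs i
    exact ⟨j, s, fun y hy hyx => hjs y ⟨hi hyx, hy⟩⟩
  choose δ hδ hlocal using hlocal
  have hmesh : ∃ N : ℕ, ∀ g, ((d : ℝ) / (d + 1)) ^ N < δ g := by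
    have h0 := tendsto_pow_atTop_nhds_zero_of_lt_one (r := (d : ℝ) / (d + 1)) (by positivity)
      ((div_lt_one (by positivity)).2 (by linarith))
    exact (Filter.eventually_all.2 fun g => h0.eventually_lt_const (hδ g)).exists
  obtain ⟨N, hN⟩ := hmesh
  have hne : ∀ v : Fin (d + 1) → ℝ, ∃ i, v ∈ stdSimplex ℝ (Fin (d + 1)) → v i ≠ 0 := by
    intro v
    by_contra! h
    have h1 := (h 0).1.2
    rw [Finset.sum_eq_zero fun i _ => (h i).2] at h1
    exact zero_ne_one h1
  choose σ hσ using hne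
  obtain ⟨g, l, hl, hlS, hldist, hlab⟩ := exists_simplex_labels hk hd hJ
    (lab := fun j g v => if charSum (χ j) (f j v) (fun i => g i) = 0 then χ j (g (σ v)) else
      sector p (charSum (χ j) (f j v) (fun i => g i)))
    (by
      intro j g g' v hv h
      have e : charSum (χ j) (f j v) (fun i => g i) = charSum (χ j) (f j v) (fun i => g' i) := by
        refine Finset.sum_congr rfl fun ν _ => ?_
        by_cases hν : v ν = 0
        · simp [hf0 j v hv ν hν]
        · simp only [h ν hν]
      simp only [e, h _ (hσ v hv)])
    hχ
    (by
      intro j g t v hv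
      have hz : (ZMod.stdAddChar (χ j t) : ℂ) ≠ 0 := by
        rw [ZMod.stdAddChar_apply]
        exact Circle.coe_ne_zero _
      simp only [charSum_add, mul_eq_zero, hz, false_or]
      split_ifs with h0
      · rw [map_add]
      · rw [sector_stdAddChar_mul _ h0]) N
  obtain ⟨v₀, hv₀⟩ := List.exists_mem_of_ne_nil l hl
  obtain ⟨j, s, hjs⟩ := hlocal (fun i => g i) v₀ (hlS v₀ hv₀)
  obtain ⟨v, hv, h1, h2⟩ := hlab j s
  obtain ⟨h3, h4⟩ := hjs v (hlS v hv) ((hldist v hv v₀ hv₀).trans_lt (hN _))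
  rw [if_neg h3] at h1 h2
  exact h2 (h4 h1).1 (h4 h1).2

end CharacterSums

/-! ### Equal shares from vanishing character sums -/

section

variable {p : ℕ} [Fact p.Prime] {k : ℕ}

/-- The character `u ↦ c ⬝ u` of `(ℤ/p)ᵏ`. -/
def dotHom (c : Fin k → ZMod p) : (Fin k → ZMod p) →+ ZMod p where
  toFun u := c ⬝ᵥ u
  map_zero' := dotProduct_zero c
  map_add' := dotProduct_add c

lemma dotHom_ne_zero {c : Fin k → ZMod p} (hc : c ≠ 0) : dotHom c ≠ 0 := by
  intro h
  refine hc (dotProduct_eq_zero c fun u => ?_)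
  exact DFunLike.congr_fun h u

lemma dotHom_neg (c : Fin k → ZMod p) : dotHom (-c) = -dotHom c := by
  ext u
  simp [dotHom]

lemma sum_stdAddChar_dotHom (u : Fin k → ZMod p) :
    ∑ c : Fin k → ZMod p, (ZMod.stdAddChar (dotHom c u) : ℂ) = if u = 0 then (p : ℂ) ^ k else 0 := by
  have e : ∀ c : Fin k → ZMod p, (ZMod.stdAddChar (dotHom c u) : ℂ) =
      ((ZMod.stdAddChar (N := p)).compAddMonoidHom (dotHom u)) c := by
    intro c
    simp [dotHom, dotProduct_comm]
  simp only [e]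
  split_ifs with h
  · subst h
    simp [dotHom, ZMod.card]
  · refine AddChar.sum_eq_zero_of_ne_one fun h1 => dotHom_ne_zero h ?_
    refine AddMonoidHom.ext fun v => ?_
    have h2 := DFunLike.congr_fun h1 v
    apply ZMod.injective_stdAddChar
    simpa using h2

lemma sum_eq_of_charSum_eq_zero {ι : Type*} [Fintype ι] {y : ι → ℝ} {g : ι → Fin k → ZMod p}
    (h : ∀ c : Fin k → ZMod p, c ≠ 0 → charSum (dotHom c) y g = 0) (t : Fin k → ZMod p) :
    (p : ℝ) ^ k * ∑ ν with g ν = t, y ν = ∑ ν, y ν := by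
  have h1 : ∑ c : Fin k → ZMod p, charSum (dotHom c) y (fun ν => g ν + -t) = ∑ ν, (y ν : ℂ) := by
    rw [Finset.sum_eq_single 0]
    · simp [charSum, dotHom]
    · intro c _ hc
      rw [charSum_add, h c hc, mul_zero]
    · simp
  have h2 : ∑ c : Fin k → ZMod p, charSum (dotHom c) y (fun ν => g ν + -t) =
      (p : ℂ) ^ k * ∑ ν with g ν = t, (y ν : ℂ) := by
    simp only [charSum]
    rw [Finset.sum_comm]
    simp only [← Finset.mul_sum, sum_stdAddChar_dotHom]
    rw [Finset.sum_filter, Finset.mul_sum]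
    refine Finset.sum_congr rfl fun ν _ => ?_
    simp only [← sub_eq_add_neg, sub_eq_zero]
    split_ifs <;> ring
  rw [h1] at h2
  exact_mod_cast h2.symm

lemma exists_half_system (hp : p ≠ 2) :
    ∃ H : Finset (Fin k → ZMod p), 0 ∉ H ∧ (∀ c, c ≠ 0 → c ∈ H ∨ -c ∈ H) ∧
      H.card * 2 = p ^ k - 1 := by
  classical
  let e := Fintype.equivFin (Fin k → ZMod p)
  have hne : ∀ c : Fin k → ZMod p, c ≠ 0 → c ≠ -c := by
    intro c hc h
    refine hc (funext fun i => ?_)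
    refine ((ZMod.neg_eq_self_iff _).1 (congrFun h i).symm).resolve_right fun h2 => hp ?_
    exact ((Nat.prime_dvd_prime_iff_eq Nat.prime_two Fact.out).1 ⟨_, h2.symm⟩).symm
  let H : Finset (Fin k → ZMod p) := {c | e c < e (-c)}
  have h0 : (0 : Fin k → ZMod p) ∉ H := by simp [H]
  have hor : ∀ c, c ≠ 0 → c ∈ H ∨ -c ∈ H := by
    intro c hc
    have := (e.injective.ne (hne c hc)).lt_or_gt
    simpa [H] using this
  refine ⟨H, h0, hor, ?_⟩
  have hdis : Disjoint H (H.map (Equiv.neg _).toEmbedding) := by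
    rw [Finset.disjoint_left]
    intro c hc hc'
    simp [H] at hc hc'
    exact absurd hc (lt_asymm hc')
  have hun : H.disjUnion _ hdis = Finset.univ.erase 0 := by
    ext c
    simp only [Finset.mem_disjUnion, Finset.mem_map, Finset.mem_erase, Finset.mem_univ, and_true]
    constructor
    · rintro (h | ⟨b, hb, rfl⟩) h'
      · exact h0 (h' ▸ h)
      · have : b = 0 := by simpa using h'
        exact h0 (this ▸ hb)
    · intro hc
      exact (hor c hc).imp id fun h => ⟨-c, h, by simp⟩
  have := congrArg Finset.card hun
  rw [Finset.card_disjUnion, Finset.card_map, Finset.card_erase_of_mem (Finset.mem_univ _)] at this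
  simp [ZMod.card] at this
  omega

end

theorem exists_equal_shares {p k n : ℕ} (hp : p.Prime) (hk : 0 < k) (hn : 1 ≤ n) {d : ℕ}
    (hd : d = n * (p ^ k - 1)) {f : Fin n → (Fin (d + 1) → ℝ) → Fin (d + 1) → ℝ}
    (hf : ∀ i, ContinuousOn (f i) (stdSimplex ℝ (Fin (d + 1))))
    (hf0 : ∀ i, ∀ x ∈ stdSimplex ℝ (Fin (d + 1)), ∀ ν, x ν = 0 → f i x ν = 0) :
    ∃ x ∈ stdSimplex ℝ (Fin (d + 1)), ∃ θ : Fin (d + 1) → Fin (p ^ k), ∀ i j,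
      (p : ℝ) ^ k * ∑ ν with θ ν = j, f i x ν = ∑ ν, f i x ν := by
  classical
  have : Fact p.Prime := ⟨hp⟩
  have hdpos : 0 < d := by
    rw [hd]
    exact Nat.mul_pos hn (Nat.sub_pos_of_lt (Nat.one_lt_pow hk.ne' hp.one_lt))
  obtain ⟨H, h0, hor, hcard⟩ : ∃ H : Finset (Fin k → ZMod p), 0 ∉ H ∧
      (∀ c, c ≠ 0 → c ∈ H ∨ -c ∈ H) ∧ H.card * (if p = 2 then 1 else 2) = p ^ k - 1 := by
    split_ifs with h
    · refine ⟨Finset.univ.erase 0, by simp, by simp +contextual, ?_⟩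
      rw [Finset.card_erase_of_mem (Finset.mem_univ _)]
      simp [ZMod.card]
    · exact exists_half_system h
  obtain ⟨x, hx, g, hg⟩ := exists_charSum_eq_zero (p := p) hk.ne' hdpos (J := Fin n × H)
    (by rw [Fintype.card_prod, Fintype.card_fin, Fintype.card_coe, mul_assoc, hcard, hd])
    (χ := fun j => dotHom j.2.1) (fun j => dotHom_ne_zero fun h => h0 (h ▸ j.2.2))
    (f := fun j => f j.1) (fun j => hf j.1) (fun j => hf0 j.1)
  have hz : ∀ i, ∀ c : Fin k → ZMod p, c ≠ 0 → charSum (dotHom c) (f i x) g = 0 := by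
    intro i c hc
    rcases hor c hc with h | h
    · exact hg (i, ⟨c, h⟩)
    · have h1 := hg (i, ⟨-c, h⟩)
      rwa [dotHom_neg, charSum_neg, map_eq_zero] at h1
  let e : (Fin k → ZMod p) ≃ Fin (p ^ k) := Fintype.equivFinOfCardEq (by simp [ZMod.card])
  refine ⟨x, hx, fun ν => e (g ν), fun i j => ?_⟩
  rw [← sum_eq_of_charSum_eq_zero (hz i) (e.symm j)]
  simp only [Equiv.eq_symm_apply]

/-! ### The cones in barycentric coordinates -/

section Geometry

variable {d : ℕ}

/-- The points whose coordinate ratio against `w` is smallest at the index `ν`. -/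
def ratioCell (b : AffineBasis (Fin (d + 1)) ℝ (EuclideanSpace ℝ (Fin d))) (w : Fin (d + 1) → ℝ)
    (ν : Fin (d + 1)) : Set (EuclideanSpace ℝ (Fin d)) :=
  {z | ∀ l, b.coord ν z * w l ≤ b.coord l z * w ν}

/-- A point of the open simplex all of whose coordinate ratios against `w` are distinct. -/
structure IsGeneric (b : AffineBasis (Fin (d + 1)) ℝ (EuclideanSpace ℝ (Fin d)))
    (w : Fin (d + 1) → ℝ) (z : EuclideanSpace ℝ (Fin d)) : Prop where
  pos : ∀ ν, 0 < b.coord ν z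
  ne : ∀ ν l, ν ≠ l → ¬ (w ν = 0 ∧ w l = 0) → b.coord ν z * w l ≠ b.coord l z * w ν

lemma volume_zeros_affineMap (g : EuclideanSpace ℝ (Fin d) →ᵃ[ℝ] ℝ) {z : EuclideanSpace ℝ (Fin d)}
    (hz : g z ≠ 0) : volume {y | g y = 0} = 0 := by
  have h := Measure.addHaar_affineSubspace (volume : Measure (EuclideanSpace ℝ (Fin d)))
    ((AffineSubspace.mk' (0 : ℝ) ⊥).comap g) fun h => hz (by
      have : z ∈ (AffineSubspace.mk' (0 : ℝ) ⊥).comap g :=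
        h ▸ AffineSubspace.mem_top ℝ (EuclideanSpace ℝ (Fin d)) z
      simpa using this)
  convert h using 2
  ext y
  simp

variable {b : AffineBasis (Fin (d + 1)) ℝ (EuclideanSpace ℝ (Fin d))} {w : Fin (d + 1) → ℝ}
  {ν : Fin (d + 1)}

lemma measurableSet_ratioCell : MeasurableSet (ratioCell b w ν) := by
  have h : ∀ l, Continuous (b.coord l) := fun l => (b.coord l).continuous_of_finiteDimensional
  refine IsClosed.measurableSet ?_
  simp only [ratioCell, Set.ofPred_forall]
  exact isClosed_iInter fun l =>
    isClosed_le ((h ν).mul continuous_const) ((h l).mul continuous_const)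

lemma ae_isGeneric {m : Measure (EuclideanSpace ℝ (Fin d))} (hac : m ≪ volume)
    (hsupp : m (convexHull ℝ (Set.range b))ᶜ = 0) (w : Fin (d + 1) → ℝ) :
    ∀ᵐ z ∂m, IsGeneric b w z := by
  have h1 : ∀ᵐ z ∂m, ∀ ν, 0 ≤ b.coord ν z := by
    rw [b.convexHull_eq_nonneg_coord] at hsupp
    exact hsupp
  have h2 : ∀ᵐ z ∂m, ∀ ν, b.coord ν z ≠ 0 := by
    refine ae_all_iff.2 fun ν => hac.ae_le ?_
    exact measure_eq_zero_iff_ae_notMem.1 (volume_zeros_affineMap (b.coord ν) (z := b ν) (by simp))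
  have h3 : ∀ᵐ z ∂m, ∀ ν l, ν ≠ l → ¬ (w ν = 0 ∧ w l = 0) →
      b.coord ν z * w l ≠ b.coord l z * w ν := by
    refine ae_all_iff.2 fun ν => ae_all_iff.2 fun l => ?_
    by_cases hνl : ν = l
    · exact Filter.Eventually.of_forall fun z h => absurd hνl h
    by_cases hw : w ν = 0 ∧ w l = 0
    · exact Filter.Eventually.of_forall fun z _ h => absurd hw h
    have key : volume
        {z | (w l • b.coord ν - w ν • b.coord l : EuclideanSpace ℝ (Fin d) →ᵃ[ℝ] ℝ) z = 0} = 0 := by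
      by_cases hl : w l = 0
      · refine volume_zeros_affineMap _ (z := b l) ?_
        have : w ν ≠ 0 := fun h => hw ⟨h, hl⟩
        simp [hl, this]
      · refine volume_zeros_affineMap _ (z := b ν) ?_
        simp [hl, b.coord_apply, Ne.symm hνl]
    filter_upwards [hac.ae_le (show ∀ᵐ z ∂volume, _ from measure_eq_zero_iff_ae_notMem.1 key)]
      with z hz _ _ h
    refine hz ?_
    simp only [AffineMap.coe_sub, AffineMap.coe_smul, Pi.sub_apply,
      Pi.smul_apply, smul_eq_mul]
    linarith
  filter_upwards [h1, h2, h3] with z hz1 hz2 hz3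
  exact ⟨fun ν => lt_of_le_of_ne (hz1 ν) (hz2 ν).symm, hz3⟩

lemma IsGeneric.weight_pos {z : EuclideanSpace ℝ (Fin d)} (hz : IsGeneric b w z)
    (hw : w ∈ stdSimplex ℝ (Fin (d + 1)))
    (h : z ∈ ratioCell b w ν) : 0 < w ν := by
  refine lt_of_le_of_ne (hw.1 ν) fun h0 => ?_
  obtain ⟨l, -, hl⟩ : ∃ l ∈ Finset.univ, 0 < w l := by
    by_contra! hcon
    have := Finset.sum_nonpos hcon
    rw [hw.2] at this
    linarith
  have h1 := h l
  rw [← h0, mul_zero] at h1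
  exact absurd h1 (not_le.2 (mul_pos (hz.pos ν) hl))

lemma IsGeneric.lt {z : EuclideanSpace ℝ (Fin d)} (hz : IsGeneric b w z)
    (hw : w ∈ stdSimplex ℝ (Fin (d + 1)))
    (h : z ∈ ratioCell b w ν) {l : Fin (d + 1)} (hl : ν ≠ l) :
    b.coord ν z * w l < b.coord l z * w ν :=
  lt_of_le_of_ne (h l) (hz.ne ν l hl fun h0 => (hz.weight_pos hw h).ne' h0.1)

lemma IsGeneric.existsUnique_mem_ratioCell {z : EuclideanSpace ℝ (Fin d)} (hz : IsGeneric b w z)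
    (hw : w ∈ stdSimplex ℝ (Fin (d + 1))) : ∃! ν, z ∈ ratioCell b w ν := by
  obtain ⟨ν, hν⟩ := Finite.exists_max fun ν => w ν / b.coord ν z
  refine ⟨ν, fun l => ?_, fun l hl => ?_⟩
  · have := hν l
    rw [div_le_div_iff₀ (hz.pos l) (hz.pos ν)] at this
    linarith
  · by_contra hne
    have h1 := hz.lt hw hl hne
    have := hν l
    rw [div_le_div_iff₀ (hz.pos l) (hz.pos ν)] at this
    linarith

lemma continuousOn_measureReal_ratioCell {m : Measure (EuclideanSpace ℝ (Fin d))} [IsFiniteMeasure m]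
    (hac : m ≪ volume) (hsupp : m (convexHull ℝ (Set.range b))ᶜ = 0) :
    ContinuousOn (fun w ν => m.real (ratioCell b w ν)) (stdSimplex ℝ (Fin (d + 1))) := by
  intro w₀ hw₀
  refine ContinuousAt.continuousWithinAt (continuousAt_pi.2 fun ν => ?_)
  refine (ENNReal.tendsto_toReal (measure_ne_top m _)).comp
    (tendsto_measure_of_ae_tendsto_indicator_of_isFiniteMeasure (nhds w₀)
      measurableSet_ratioCell (fun w => measurableSet_ratioCell) ?_)
  filter_upwards [ae_isGeneric hac hsupp w₀] with z hz
  have hc : ∀ l l', ContinuousAt (fun w : Fin (d + 1) → ℝ => b.coord l z * w l') w₀ :=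
    fun l l' => (continuous_const.mul (continuous_apply l')).continuousAt
  by_cases h : z ∈ ratioCell b w₀ ν
  · have h1 : ∀ᶠ w in nhds w₀, ∀ l, ν ≠ l → b.coord ν z * w l < b.coord l z * w ν := by
      refine Filter.eventually_all.2 fun l => ?_
      by_cases hl : ν = l
      · exact Filter.Eventually.of_forall fun w h => absurd hl h
      · filter_upwards [(hc ν l).eventually_lt (hc l ν) (hz.lt hw₀ h hl)] with w hw _ using hw
    filter_upwards [h1] with w hw
    refine iff_of_true (fun l => ?_) h
    rcases eq_or_ne ν l with rfl | hl
    · exact le_rfl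
    · exact (hw l hl).le
  · obtain ⟨l, hl⟩ : ∃ l, b.coord l z * w₀ ν < b.coord ν z * w₀ l := by
      by_contra! hcon
      exact h hcon
    filter_upwards [(hc l ν).eventually_lt (hc ν l) hl] with w hw
    exact iff_of_false (fun h' => absurd (h' l) (not_le.2 hw)) h

lemma sum_measureReal_ratioCell {m : Measure (EuclideanSpace ℝ (Fin d))} [IsFiniteMeasure m]
    (hac : m ≪ volume) (hsupp : m (convexHull ℝ (Set.range b))ᶜ = 0)
    (hw : w ∈ stdSimplex ℝ (Fin (d + 1))) :
    ∑ ν, m.real (ratioCell b w ν) = m.real Set.univ := by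
  have hg := ae_isGeneric hac hsupp w
  have hd : Pairwise (Function.onFun (AEDisjoint m) (ratioCell b w)) := by
    intro ν l hl
    refine measure_eq_zero_iff_ae_notMem.2 ?_
    filter_upwards [hg] with z hz h
    exact hl ((hz.existsUnique_mem_ratioCell hw).unique h.1 h.2)
  have hu : m (⋃ ν, ratioCell b w ν) = m Set.univ := by
    refine measure_congr ?_
    filter_upwards [hg] with z hz
    obtain ⟨ν, hν, -⟩ := hz.existsUnique_mem_ratioCell hw
    exact propext (iff_of_true (Set.mem_iUnion.2 ⟨ν, hν⟩) trivial)
  rw [measureReal_def, ← hu,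
    measure_iUnion₀ hd fun ν => measurableSet_ratioCell.nullMeasurableSet, tsum_fintype,
    ENNReal.toReal_sum fun ν _ => measure_ne_top m _]
  rfl

lemma measure_ratioCell_eq_zero {m : Measure (EuclideanSpace ℝ (Fin d))} (hac : m ≪ volume)
    (hsupp : m (convexHull ℝ (Set.range b))ᶜ = 0) (hw : w ∈ stdSimplex ℝ (Fin (d + 1)))
    (hν : w ν = 0) : m (ratioCell b w ν) = 0 := by
  refine measure_eq_zero_iff_ae_notMem.2 ?_
  filter_upwards [ae_isGeneric hac hsupp w] with z hz h
  exact (hz.weight_pos hw h).ne' hν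

lemma mem_facet_iff {z : EuclideanSpace ℝ (Fin d)} :
    z ∈ facet b ν ↔ (∀ l, 0 ≤ b.coord l z) ∧ b.coord ν z = 0 := by
  constructor
  · intro h
    refine ⟨?_, ?_⟩
    · have : z ∈ convexHull ℝ (Set.range b) := convexHull_mono (Set.image_subset_range _ _) h
      rwa [b.convexHull_eq_nonneg_coord] at this
    · have hconv : Convex ℝ (b.coord ν ⁻¹' {0}) := (convex_singleton 0).affine_preimage _
      refine convexHull_min ?_ hconv h
      rintro _ ⟨j, hj, rfl⟩
      simp [b.coord_apply, Ne.symm hj]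
  · rintro ⟨h0, h1⟩
    have hs : ∑ j ∈ Finset.univ.erase ν, b.coord j z = 1 := by
      rw [← b.sum_coord_apply_eq_one z, ← Finset.add_sum_erase _ _ (Finset.mem_univ ν), h1,
        zero_add]
    have hz : ∑ j ∈ Finset.univ.erase ν, b.coord j z • b j = z := by
      conv_rhs => rw [← b.linear_combination_coord_eq_self z,
        ← Finset.add_sum_erase _ _ (Finset.mem_univ ν), h1, zero_smul, zero_add]
    rw [← hz]
    exact (convex_convexHull ℝ _).sum_mem (fun j _ => h0 j) hs fun j hj =>
      subset_convexHull ℝ _ ⟨j, (Finset.mem_erase.1 hj).1, rfl⟩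

lemma IsGeneric.mem_coneApex_iff {z : EuclideanSpace ℝ (Fin d)} (hz : IsGeneric b w z) (hd : 0 < d)
    (hw : w ∈ stdSimplex ℝ (Fin (d + 1))) {x : EuclideanSpace ℝ (Fin d)}
    (hx : ∀ l, b.coord l x = w l) : z ∈ coneApex x (facet b ν) ↔ z ∈ ratioCell b w ν := by
  have hcoord : ∀ (t : ℝ) (y : EuclideanSpace ℝ (Fin d)) l,
      b.coord l (x + t • (y - x)) = (1 - t) * w l + t * b.coord l y := by
    intro t y l
    have : x + t • (y - x) = AffineMap.lineMap x y t := by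
      rw [AffineMap.lineMap_apply, vsub_eq_sub, vadd_eq_add, add_comm]
    rw [this, AffineMap.apply_lineMap, AffineMap.lineMap_apply_module, hx]
    simp
  constructor
  · rintro ⟨t, ht, y, hy, hzy⟩ l
    rw [mem_facet_iff] at hy
    rw [hzy, hcoord, hcoord, hy.2]
    nlinarith [mul_nonneg (mul_nonneg ht (hy.1 l)) (hw.1 ν)]
  · intro h
    have hν := hz.weight_pos hw h
    have : Nontrivial (Fin (d + 1)) := Fin.nontrivial_iff_two_le.2 (by omega)
    obtain ⟨l₀, hl₀⟩ := exists_ne ν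
    have hlt : b.coord ν z < w ν := by
      have h1 : ∑ l, b.coord ν z * w l < ∑ l, b.coord l z * w ν :=
        Finset.sum_lt_sum (fun l _ => h l) ⟨l₀, Finset.mem_univ _, hz.lt hw h hl₀.symm⟩
      rwa [← Finset.mul_sum, ← Finset.sum_mul, hw.2, b.sum_coord_apply_eq_one, mul_one,
        one_mul] at h1
    have ht : 0 < 1 - b.coord ν z / w ν := by
      rw [sub_pos, div_lt_one hν]
      exact hlt
    set t := 1 - b.coord ν z / w ν with ht'
    have hwt : (1 - t) * w ν = b.coord ν z := by
      rw [ht']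
      field_simp
      ring
    have hinv : (1 - t⁻¹) = -(t⁻¹ * (1 - t)) := by
      field_simp
      ring
    refine ⟨t, ht.le, x + t⁻¹ • (z - x), mem_facet_iff.2 ⟨fun l => ?_, ?_⟩, ?_⟩
    · rw [hcoord, hinv]
      have h1 : (1 - t) * w l ≤ b.coord l z := by
        refine le_of_mul_le_mul_right ?_ hν
        calc (1 - t) * w l * w ν = b.coord ν z * w l := by rw [← hwt]; ring
          _ ≤ _ := h l
      have := mul_nonneg (inv_pos.2 ht).le (sub_nonneg.2 h1)
      linarith
    · rw [hcoord, hinv, ← hwt]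
      ring
    · rw [add_sub_cancel_left, smul_smul, mul_inv_cancel₀ ht.ne', one_smul, add_sub_cancel]

lemma exists_affineBasis {a : Fin (d + 1) → EuclideanSpace ℝ (Fin d)}
    (h : LinearIndependent ℝ (fun i : Fin d => a i.succ - a 0)) :
    ∃ b : AffineBasis (Fin (d + 1)) ℝ (EuclideanSpace ℝ (Fin d)), ⇑b = a := by
  have hi : AffineIndependent ℝ a := by
    rw [affineIndependent_iff_linearIndependent_vsub ℝ a 0,
      ← linearIndependent_equiv (finSuccAboveEquiv 0)]
    have e : (fun i : {j : Fin (d + 1) // j ≠ 0} => (a i -ᵥ a 0 : EuclideanSpace ℝ (Fin d))) ∘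
        finSuccAboveEquiv 0 = fun i : Fin d => a i.succ - a 0 := by
      ext i : 1
      simp [finSuccAboveEquiv_apply]
    rw [e]
    exact h
  exact ⟨⟨a, hi, (hi.affineSpan_eq_top_iff_card_eq_finrank_add_one).2 (by simp)⟩, rfl⟩

end Geometry

end FairDivision

/-- **Fair division by moving-apex cones.** For `q = p^k` a prime power,
`d = n (q - 1)`, a non-degenerate simplex `Δ ⊂ ℝ^d`, and continuous mass
distributions `μ 1, …, μ n` supported in `Δ`, there is a point `x ∈ Δ` and an
allocation `θ : {0,…,d} → {1,…,q}` so that every color class of the cones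
`cone(x, F ν)` gets exactly `1/q` of each measure. -/
theorem fair_division_moving_apex
    (p k n : ℕ) (hp : p.Prime) (hk : 0 < k) (hn : 1 ≤ n)
    (q : ℕ) (hq : q = p ^ k) (d : ℕ) (hd : d = n * (q - 1))
    (a : Fin (d + 1) → EuclideanSpace ℝ (Fin d))
    (hnondeg : LinearIndependent ℝ (fun i : Fin d => a i.succ - a 0))
    (μ : Fin n → Measure (EuclideanSpace ℝ (Fin d)))
    (hfin : ∀ i, IsFiniteMeasure (μ i))
    (hac : ∀ i, μ i ≪ (volume : Measure (EuclideanSpace ℝ (Fin d))))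
    (hsupp : ∀ i, μ i (convexHull ℝ (Set.range a))ᶜ = 0) :
    ∃ x ∈ convexHull ℝ (Set.range a), ∃ θ : Fin (d + 1) → Fin q,
      ∀ (i : Fin n) (j : Fin q),
        ∑ ν ∈ Finset.univ.filter (fun ν => θ ν = j),
            μ i (coneApex x (facet a ν)) = μ i Set.univ / q := by
  obtain ⟨b, rfl⟩ := FairDivision.exists_affineBasis hnondeg
  subst hq
  have hq2 : 1 < p ^ k := Nat.one_lt_pow hk.ne' hp.one_lt
  have hdpos : 0 < d := hd ▸ Nat.mul_pos hn (Nat.sub_pos_of_lt hq2)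
  obtain ⟨w, hw, θ, hθ⟩ := FairDivision.exists_equal_shares hp hk hn hd
    (f := fun i w ν => (μ i).real (FairDivision.ratioCell b w ν))
    (fun i => FairDivision.continuousOn_measureReal_ratioCell (hac i) (hsupp i))
    (fun i w hw ν hν => by
      rw [measureReal_def, FairDivision.measure_ratioCell_eq_zero (hac i) (hsupp i) hw hν,
        ENNReal.toReal_zero])
  set x := Finset.univ.affineCombination ℝ b w with hxdef
  have hx : ∀ l, b.coord l x = w l := fun l =>
    b.coord_apply_combination_of_mem (Finset.mem_univ l) hw.2
  refine ⟨x, ?_, θ, fun i j => ?_⟩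
  · rw [b.convexHull_eq_nonneg_coord]
    intro l
    rw [hx]
    exact hw.1 l
  · have hcone : ∀ ν, μ i (coneApex x (facet b ν)) = μ i (FairDivision.ratioCell b w ν) := by
      intro ν
      refine measure_congr ?_
      filter_upwards [FairDivision.ae_isGeneric (hac i) (hsupp i) w] with z hz
      exact propext (hz.mem_coneApex_iff hdpos hw hx)
    have h1 := hθ i j
    rw [FairDivision.sum_measureReal_ratioCell (hac i) (hsupp i) hw] at h1
    simp only [hcone]
    rw [ENNReal.eq_div_iff (by simp [hp.ne_zero]) (by simp),
      ← ENNReal.toReal_eq_toReal_iff' (ENNReal.mul_ne_top (by simp)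
        (ENNReal.sum_ne_top.2 fun ν _ => measure_ne_top _ _)) (measure_ne_top _ _),
      ENNReal.toReal_mul, ENNReal.toReal_sum fun ν _ => measure_ne_top _ _]
    simpa [measureReal_def] using h1
end
end

section
/- Standard cubulation of the Δ-zonotope: Let Δ = conv{a_0,…,a_d} ⊂ ℝ^d be a non-degenerate simplex with a_0+⋯+a_d = 0, and for 0 ≤ i ≤ d let C_i = Σ_{j≠i} [0,a_j] be the parallelotope spanned by the vectors {a_j : j ≠ i}. Then R_Δ = C_0 ∪ C_1 ∪ ⋯ ∪ C_d, and the interiors of the parallelotopes C_i are pairwise disjoint. -/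
noncomputable section

/-- The Δ-zonotope `R_Δ = [0, a 0] + [0, a 1] + ⋯ + [0, a d]`, the Minkowski sum
of the segments `[0, a i] = {t • a i : 0 ≤ t ≤ 1}`. -/
def zonotope {d : ℕ} (a : Fin (d + 1) → EuclideanSpace ℝ (Fin d)) :
    Set (EuclideanSpace ℝ (Fin d)) :=
  {z | ∃ t : Fin (d + 1) → ℝ, (∀ k, t k ∈ Set.Icc (0 : ℝ) 1) ∧ z = ∑ k, t k • a k}

/-- The parallelotope `C i = ∑_{j ≠ i} [0, a j]`, the Minkowski sum of all the
segments `[0, a j]` with `j ≠ i`. -/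
def parallelotope {d : ℕ} (a : Fin (d + 1) → EuclideanSpace ℝ (Fin d)) (i : Fin (d + 1)) :
    Set (EuclideanSpace ℝ (Fin d)) :=
  {z | ∃ t : Fin (d + 1) → ℝ, (∀ k, t k ∈ Set.Icc (0 : ℝ) 1) ∧ t i = 0 ∧ z = ∑ k, t k • a k}

/-- For a non-degenerate simplex with barycenter at the origin, the only linear relations
among the vertices are the multiples of `∑ k, a k = 0`. -/
theorem coeff_eq_of_sum_smul_eq_zero {d : ℕ} {a : Fin (d + 1) → EuclideanSpace ℝ (Fin d)}
    (hnondeg : LinearIndependent ℝ (fun i : Fin d => a i.succ - a 0))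
    (hbary : ∑ i, a i = 0) {c : Fin (d + 1) → ℝ} (hc : ∑ k, c k • a k = 0)
    (i j : Fin (d + 1)) : c i = c j := by
  set m : ℝ := (∑ k, c k) / (d + 1) with hm
  have hd : (d + 1 : ℝ) ≠ 0 := by positivity
  have hsum : ∑ k, (c k - m) = 0 := by
    simp only [Finset.sum_sub_distrib, Finset.sum_const, Finset.card_univ, Fintype.card_fin,
      nsmul_eq_mul, Nat.cast_add, Nat.cast_one, hm]
    field_simp
    ring
  have hrel : ∑ k, (c k - m) • (a k - a 0) = 0 := by
    simp only [smul_sub, Finset.sum_sub_distrib, ← Finset.sum_smul, hsum, zero_smul, sub_zero]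
    simp only [sub_smul, Finset.sum_sub_distrib, ← Finset.smul_sum, hbary, hc, smul_zero, sub_zero]
  rw [Fin.sum_univ_succ, sub_self, smul_zero, zero_add] at hrel
  have hsucc := Fintype.linearIndependent_iff.1 hnondeg (fun k => c k.succ - m) hrel
  have hzero : c 0 - m = 0 := by
    rwa [Fin.sum_univ_succ, Finset.sum_eq_zero fun k _ => hsucc k, add_zero] at hsum
  have hall : ∀ k, c k = m := fun k =>
    sub_eq_zero.1 (Fin.cases (motive := fun k => c k - m = 0) hzero hsucc k)
  rw [hall i, hall j]

/-- Two representations of the same point differ by a constant. -/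
theorem coeff_sub_eq_of_sum_smul_eq {d : ℕ} {a : Fin (d + 1) → EuclideanSpace ℝ (Fin d)}
    (hnondeg : LinearIndependent ℝ (fun i : Fin d => a i.succ - a 0))
    (hbary : ∑ i, a i = 0) {s t : Fin (d + 1) → ℝ} (hst : ∑ k, s k • a k = ∑ k, t k • a k)
    (i j : Fin (d + 1)) : s i - t i = s j - t j :=
  coeff_eq_of_sum_smul_eq_zero (c := fun k => s k - t k) hnondeg hbary
    (by simp only [sub_smul, Finset.sum_sub_distrib, hst, sub_self]) i j

theorem zonotope_eq_iUnion_parallelotope {d : ℕ} {a : Fin (d + 1) → EuclideanSpace ℝ (Fin d)}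
    (hbary : ∑ i, a i = 0) : zonotope a = ⋃ i, parallelotope a i := by
  ext z
  simp only [Set.mem_iUnion]
  constructor
  · rintro ⟨t, ht, rfl⟩
    obtain ⟨i, hi⟩ := Finite.exists_min t
    refine ⟨i, fun k => t k - t i, fun k => ⟨sub_nonneg.2 (hi k), ?_⟩, sub_self _, ?_⟩
    · linarith [(ht k).2, (ht i).1]
    · simp only [sub_smul, Finset.sum_sub_distrib, ← Finset.smul_sum, hbary, smul_zero, sub_zero]
  · rintro ⟨i, t, ht, -, hz⟩
    exact ⟨t, ht, hz⟩

/-- A point of `C i` whose `j`-th coordinate vanishes lies on the boundary of `C i`. -/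
theorem sum_smul_notMem_interior_parallelotope {d : ℕ}
    {a : Fin (d + 1) → EuclideanSpace ℝ (Fin d)}
    (hnondeg : LinearIndependent ℝ (fun i : Fin d => a i.succ - a 0))
    (hbary : ∑ i, a i = 0) {i j : Fin (d + 1)} (hij : i ≠ j) {t : Fin (d + 1) → ℝ}
    (hi : t i = 0) (hj : t j = 0) : ∑ k, t k • a k ∉ interior (parallelotope a i) := by
  intro hx
  set x := ∑ k, t k • a k with hxt
  have hlim : Filter.Tendsto (fun ε : ℝ => x - ε • a j) (nhds 0) (nhds x) := by
    have hcont : Continuous fun ε : ℝ => x - ε • a j := by fun_prop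
    simpa using hcont.tendsto 0
  have hev := (hlim.mono_left (nhdsWithin_le_nhds (s := Set.Ioi 0))).eventually
    (mem_interior_iff_mem_nhds.1 hx)
  obtain ⟨ε, ⟨s, hs, hsi, hse⟩, hε⟩ := (hev.and self_mem_nhdsWithin).exists
  have hε : 0 < ε := hε
  have hrep : ∑ k, (t k - Pi.single (M := fun _ => ℝ) j ε k) • a k = ∑ k, s k • a k := by
    rw [← hse, hxt]
    simp [sub_smul, Finset.sum_sub_distrib, Pi.single_apply, ite_smul]
  have hdiff := coeff_sub_eq_of_sum_smul_eq hnondeg hbary hrep i j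
  simp only [hi, hj, hsi, Pi.single_eq_same, Pi.single_eq_of_ne hij] at hdiff
  linarith [(hs j).1]

/-- **Standard cubulation of the Δ-zonotope.** For a non-degenerate simplex
`Δ = conv {a 0, …, a d} ⊂ ℝ^d` with barycenter at the origin, the Δ-zonotope is the
union `R_Δ = C 0 ∪ ⋯ ∪ C d` of the parallelotopes `C i`, whose interiors are
pairwise disjoint. -/
theorem zonotope_standard_cubulation (d : ℕ)
    (a : Fin (d + 1) → EuclideanSpace ℝ (Fin d))
    (hnondeg : LinearIndependent ℝ (fun i : Fin d => a i.succ - a 0))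
    (hbary : ∑ i, a i = 0) :
    (zonotope a = ⋃ i, parallelotope a i) ∧
      ∀ i j, i ≠ j →
        interior (parallelotope a i) ∩ interior (parallelotope a j) = ∅ := by
  refine ⟨zonotope_eq_iUnion_parallelotope hbary, fun i j hij => ?_⟩
  refine Set.eq_empty_of_forall_notMem ?_
  rintro x ⟨hxi, hxj⟩
  obtain ⟨t, ht, hti, rfl⟩ := interior_subset hxi
  obtain ⟨s, hs, hsj, hst⟩ := interior_subset hxj
  have hdiff := coeff_sub_eq_of_sum_smul_eq hnondeg hbary hst i j
  have htj : t j = 0 := by linarith [(ht j).1, (hs i).1]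
  exact sum_smul_notMem_interior_parallelotope hnondeg hbary hij hti htj hxi
end
end
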